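/- Let n ≥ 5 and n/(n-4) < p < (n+4)/(n-4), and let u be a nonnegative C⁴ solution of Δ²u = u^p in the punctured ball B₁\{0} ⊂ ℝⁿ. Then either lim_{|x|→0} |x|^{4/(p-1)} u(x) = 0, or lim_{|x|→0} |x|^{4/(p-1)} u(x) = K₀(p,n)^{1/(p-1)}. -/

import Mathlib

open MeasureTheory Metric Filter

/-- The Euclidean Laplacian `Δu` of `u : ℝⁿ → ℝ`, computed as the trace of the second
derivative: `Δu(x) = ∑ i, ∂²u/∂xᵢ²(x)`. -/
noncomputable def lap {n : ℕ} (u : EuclideanSpace ℝ (Fin n) → ℝ) :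
    EuclideanSpace ℝ (Fin n) → ℝ :=
  fun x => ∑ i : Fin n,
    iteratedFDeriv ℝ 2 u x ![EuclideanSpace.single i 1, EuclideanSpace.single i 1]

/-- The biharmonic operator `Δ²u = Δ(Δu)`. -/
noncomputable def bilap {n : ℕ} (u : EuclideanSpace ℝ (Fin n) → ℝ) :
    EuclideanSpace ℝ (Fin n) → ℝ :=
  lap (lap u)

/-- The constant `K₀(p,n)`. -/
noncomputable def K0 (n : ℕ) (p : ℝ) : ℝ :=
  8 / (p - 1) ^ 4 *
    (((n : ℝ) - 2) * ((n : ℝ) - 4) * (p - 1) ^ 3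
      + 2 * ((n : ℝ) ^ 2 - 10 * (n : ℝ) + 20) * (p - 1) ^ 2
      - 16 * ((n : ℝ) - 4) * (p - 1) + 32)

section RadialIntegrals

variable {E : Type*} [NormedAddCommGroup E] [InnerProductSpace ℝ E] [FiniteDimensional ℝ E]
  [MeasurableSpace E] [BorelSpace E]

lemma integrableOn_ball_norm_rpow {a : ℝ} (ha : a < Module.finrank ℝ E) (R : ℝ) :
    IntegrableOn (fun x : E => ‖x‖ ^ (-a)) (ball 0 R) := by
  rcases subsingleton_or_nontrivial E with h | h
  · refine Measure.integrableOn_of_bounded (M := 1 + |(0:ℝ) ^ (-a)|) measure_ball_lt_top.ne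
      (measurable_norm.pow_const _).aestronglyMeasurable (Eventually.of_forall fun x => ?_)
    rw [Subsingleton.elim x 0, norm_zero, Real.norm_eq_abs]; linarith
  rw [integrableOn_fun_norm_addHaar volume (f := fun r => r ^ (-a))]
  have h1 : 0 < Module.finrank ℝ E := Module.finrank_pos
  have : IntegrableOn (fun y : ℝ => y ^ ((Module.finrank ℝ E : ℝ) - 1 - a)) (Set.Ioo 0 R) := by
    rcases le_or_gt R 0 with hR | hR
    · simp [Set.Ioo_eq_empty_of_le hR]
    · rw [intervalIntegral.integrableOn_Ioo_rpow_iff hR]; linarith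
  refine this.congr_fun (fun y hy => ?_) measurableSet_Ioo
  have hy0 : 0 < y := hy.1
  simp only [smul_eq_mul]
  rw [← Real.rpow_natCast, ← Real.rpow_add hy0, Nat.cast_sub h1]
  norm_num
  ring_nf

lemma integrableOn_compl_ball_norm_rpow {a : ℝ} (ha : (Module.finrank ℝ E : ℝ) < a)
    {δ : ℝ} (hδ : 0 < δ) :
    IntegrableOn (fun x : E => ‖x‖ ^ (-a)) (ball 0 δ)ᶜ := by
  rcases subsingleton_or_nontrivial E with h | h
  · have : (ball (0 : E) δ)ᶜ = ∅ := by
      ext x; simp [Subsingleton.elim x 0, hδ]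
    simp [this]
  have h1 : 0 < Module.finrank ℝ E := Module.finrank_pos
  rw [← integrable_indicator_iff measurableSet_ball.compl]
  have key : (fun x : E => (Set.Ici δ).indicator (fun r : ℝ => r ^ (-a)) ‖x‖) =
      (ball (0 : E) δ)ᶜ.indicator (fun x : E => ‖x‖ ^ (-a)) := by
    ext x
    by_cases hx : ‖x‖ < δ
    · simp [Set.indicator, hx, not_le.mpr hx]
    · simp [Set.indicator, hx, not_lt.mp hx]
  rw [← key, integrable_fun_norm_addHaar volume (f := (Set.Ici δ).indicator (fun r : ℝ => r ^ (-a)))]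
  have : IntegrableOn (fun y : ℝ => y ^ ((Module.finrank ℝ E : ℝ) - 1 - a)) (Set.Ioi δ) :=
    integrableOn_Ioi_rpow_of_lt (by linarith) hδ
  have h2 : IntegrableOn ((Set.Ici δ).indicator
      fun y : ℝ => y ^ ((Module.finrank ℝ E : ℝ) - 1 - a)) (Set.Ioi 0) := by
    have := (integrableOn_Ici_iff_integrableOn_Ioi).mpr this
    exact ((integrable_indicator_iff measurableSet_Ici).mpr this).integrableOn
  refine h2.congr_fun (fun y hy => ?_) measurableSet_Ioi
  have hy0 : 0 < y := hy
  by_cases hyd : δ ≤ y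
  · simp only [Set.indicator, Set.mem_Ici, hyd, if_true, smul_eq_mul]
    rw [← Real.rpow_natCast, ← Real.rpow_add hy0, Nat.cast_sub h1]
    norm_num
    ring_nf
  · simp [Set.indicator, hyd]

lemma setIntegral_ball_norm_rpow (a : ℝ) {δ : ℝ} (hδ : 0 < δ) :
    ∫ x in ball (0 : E) δ, ‖x‖ ^ (-a) =
      δ ^ ((Module.finrank ℝ E : ℝ) - a) * ∫ x in ball (0 : E) 1, ‖x‖ ^ (-a) := by
  have := Measure.setIntegral_comp_smul_of_pos (μ := (volume : Measure E))
    (fun x : E => ‖x‖ ^ (-a)) (ball (0 : E) 1) hδ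
  rw [smul_unitBall_of_pos hδ] at this
  rw [eq_comm, inv_smul_eq_iff₀ (by positivity)] at this
  rw [this, smul_eq_mul, Real.rpow_sub hδ, Real.rpow_natCast]
  simp_rw [norm_smul, Real.norm_of_nonneg hδ.le, Real.mul_rpow hδ.le (norm_nonneg _)]
  rw [integral_const_mul, Real.rpow_neg hδ.le]
  ring

open scoped Pointwise in
lemma setIntegral_compl_ball_norm_rpow (a : ℝ) {δ : ℝ} (hδ : 0 < δ) :
    ∫ x in (ball (0 : E) δ)ᶜ, ‖x‖ ^ (-a) =
      δ ^ ((Module.finrank ℝ E : ℝ) - a) * ∫ x in (ball (0 : E) 1)ᶜ, ‖x‖ ^ (-a) := by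
  have := Measure.setIntegral_comp_smul_of_pos (μ := (volume : Measure E))
    (fun x : E => ‖x‖ ^ (-a)) (ball (0 : E) 1)ᶜ hδ
  have hc : δ • (ball (0 : E) 1)ᶜ = (ball 0 δ)ᶜ := by
    ext x
    rw [Set.mem_smul_set_iff_inv_smul_mem₀ hδ.ne', Set.mem_compl_iff, Set.mem_compl_iff,
      ← Set.mem_smul_set_iff_inv_smul_mem₀ hδ.ne', smul_unitBall_of_pos hδ]
  rw [hc] at this
  rw [eq_comm, inv_smul_eq_iff₀ (by positivity)] at this
  rw [this, smul_eq_mul, Real.rpow_sub hδ, Real.rpow_natCast]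
  simp_rw [norm_smul, Real.norm_of_nonneg hδ.le, Real.mul_rpow hδ.le (norm_nonneg _)]
  rw [integral_const_mul, Real.rpow_neg hδ.le]
  ring

lemma setIntegral_comp_sub_left (f : E → ℝ) (s : Set E) (hs : MeasurableSet s) (y : E) :
    ∫ z in {z | y - z ∈ s}, f (y - z) = ∫ z in s, f z := by
  have hm : MeasurableSet {z | y - z ∈ s} := hs.preimage (by fun_prop : Measurable fun z => y - z)
  rw [← integral_indicator hs, ← integral_indicator hm,
    ← integral_sub_left_eq_self (s.indicator f) volume y]
  rfl

lemma integrableOn_comp_sub_left {f : E → ℝ} {s : Set E} (hs : MeasurableSet s) (y : E)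
    (hf : IntegrableOn f s) : IntegrableOn (fun z => f (y - z)) {z | y - z ∈ s} := by
  have hm : MeasurableSet {z | y - z ∈ s} := hs.preimage (by fun_prop : Measurable fun z => y - z)
  rw [← integrable_indicator_iff hs] at hf
  rw [← integrable_indicator_iff hm]
  exact hf.comp_sub_left y

/-- Local integrability of the inverse powers, with the scaling of the integral. -/
lemma exists_integral_ball_inv_pow_le {m j : ℕ} (hj : 0 < j)
    (hE : Module.finrank ℝ E = m + j) :
    ∃ C : ℝ, 0 < C ∧ ∀ (y : E) (δ : ℝ), 0 < δ →
      IntegrableOn (fun z => (‖y - z‖ ^ m)⁻¹) (ball y δ) ∧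
        ∫ z in ball y δ, (‖y - z‖ ^ m)⁻¹ ≤ C * δ ^ j := by
  have hpow : ∀ x : E, (‖x‖ ^ m)⁻¹ = ‖x‖ ^ (-(m : ℝ)) := fun x => by
    rw [Real.rpow_neg (norm_nonneg x), Real.rpow_natCast]
  have hset : ∀ (y : E) (δ : ℝ), ball y δ = {z | y - z ∈ ball (0 : E) δ} := fun y δ => by
    ext z; simp [dist_eq_norm, norm_sub_rev]
  have hlt : (m : ℝ) < Module.finrank ℝ E := by rw [hE]; push_cast; simpa using hj
  refine ⟨|∫ x in ball (0 : E) 1, ‖x‖ ^ (-(m : ℝ))| + 1, by positivity, fun y δ hδ => ⟨?_, ?_⟩⟩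
  · rw [hset]
    simp_rw [hpow]
    exact integrableOn_comp_sub_left measurableSet_ball y (integrableOn_ball_norm_rpow hlt δ)
  · rw [hset]
    simp_rw [hpow]
    rw [setIntegral_comp_sub_left (fun x : E => ‖x‖ ^ (-(m : ℝ))) _ measurableSet_ball,
      setIntegral_ball_norm_rpow _ hδ, hE]
    have : δ ^ (((m + j : ℕ) : ℝ) - m) = δ ^ j := by
      rw [← Real.rpow_natCast]; congr 1; push_cast; ring
    rw [this, mul_comm]
    gcongr
    linarith [le_abs_self (∫ x in ball (0 : E) 1, ‖x‖ ^ (-(m : ℝ)))]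

lemma exists_integral_compl_ball_inv_pow_le {m j : ℕ} (hj : 0 < j)
    (hE : Module.finrank ℝ E + j = m) :
    ∃ C : ℝ, 0 < C ∧ ∀ (y : E) (δ : ℝ), 0 < δ →
      IntegrableOn (fun z => (‖y - z‖ ^ m)⁻¹) (ball y δ)ᶜ ∧
        ∫ z in (ball y δ)ᶜ, (‖y - z‖ ^ m)⁻¹ ≤ C * (δ ^ j)⁻¹ := by
  have hpow : ∀ x : E, (‖x‖ ^ m)⁻¹ = ‖x‖ ^ (-(m : ℝ)) := fun x => by
    rw [Real.rpow_neg (norm_nonneg x), Real.rpow_natCast]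
  have hset : ∀ (y : E) (δ : ℝ), (ball y δ)ᶜ = {z | y - z ∈ (ball (0 : E) δ)ᶜ} := fun y δ => by
    ext z; simp [dist_eq_norm, norm_sub_rev]
  have hlt : (Module.finrank ℝ E : ℝ) < m := by rw [← hE]; push_cast; simpa using hj
  refine ⟨|∫ x in (ball (0 : E) 1)ᶜ, ‖x‖ ^ (-(m : ℝ))| + 1, by positivity, fun y δ hδ => ⟨?_, ?_⟩⟩
  · rw [hset]
    simp_rw [hpow]
    exact integrableOn_comp_sub_left measurableSet_ball.compl y
      (integrableOn_compl_ball_norm_rpow hlt hδ)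
  · rw [hset]
    simp_rw [hpow]
    rw [setIntegral_comp_sub_left (fun x : E => ‖x‖ ^ (-(m : ℝ))) _ measurableSet_ball.compl,
      setIntegral_compl_ball_norm_rpow _ hδ, ← hE]
    have : δ ^ ((Module.finrank ℝ E : ℝ) - (Module.finrank ℝ E + j : ℕ)) = (δ ^ j)⁻¹ := by
      rw [← Real.rpow_natCast, ← Real.rpow_neg hδ.le]; congr 1; push_cast; ring
    rw [this, mul_comm]
    gcongr
    linarith [le_abs_self (∫ x in (ball (0 : E) 1)ᶜ, ‖x‖ ^ (-((Module.finrank ℝ E + j : ℕ) : ℝ)))]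

lemma integrableOn_and_setIntegral_le_of_le {α : Type*} [MeasurableSpace α] {μ : Measure α}
    {f g : α → ℝ} {A : Set α} (hA : MeasurableSet A)
    (hfm : AEStronglyMeasurable f (μ.restrict A)) (hf : ∀ z ∈ A, 0 ≤ f z)
    (hfg : ∀ z ∈ A, f z ≤ g z) (hg : Integrable g μ) (hg0 : ∀ z, 0 ≤ g z) :
    IntegrableOn f A μ ∧ ∫ z in A, f z ∂μ ≤ ∫ z, g z ∂μ := by
  have hi : IntegrableOn f A μ := by
    refine Integrable.mono' hg.integrableOn hfm ?_
    filter_upwards [ae_restrict_mem hA] with z hz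
    rw [Real.norm_of_nonneg (hf z hz)]
    exact hfg z hz
  exact ⟨hi, (setIntegral_mono_on hi hg.integrableOn hA hfg).trans
    (setIntegral_le_integral hg (Eventually.of_forall hg0))⟩

lemma inv_pow_mul_inv_pow_le {a b : ℝ} (ha : 0 < a) (hb : 0 < b) (m j : ℕ) :
    (a ^ m)⁻¹ * (b ^ j)⁻¹ ≤ (a ^ (m + j))⁻¹ + (b ^ (m + j))⁻¹ := by
  rcases le_total a b with h | h
  · have : (b ^ j)⁻¹ ≤ (a ^ j)⁻¹ := by gcongr
    calc (a ^ m)⁻¹ * (b ^ j)⁻¹ ≤ (a ^ m)⁻¹ * (a ^ j)⁻¹ := by gcongr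
      _ = (a ^ (m + j))⁻¹ := by rw [pow_add, mul_inv]
      _ ≤ _ := le_add_of_nonneg_right (by positivity)
  · have : (a ^ m)⁻¹ ≤ (b ^ m)⁻¹ := by gcongr
    calc (a ^ m)⁻¹ * (b ^ j)⁻¹ ≤ (b ^ m)⁻¹ * (b ^ j)⁻¹ := by gcongr
      _ = (b ^ (m + j))⁻¹ := by rw [pow_add, mul_inv]
      _ ≤ _ := le_add_of_nonneg_left (by positivity)

/-- Uniform integrability of `z ↦ |y - z|⁻ᵈ |z|⁻⁸` away from the origin, in dimension `d + 4`. -/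
lemma exists_setIntegral_inv_pow_mul_le {d : ℕ} (hE : Module.finrank ℝ E = d + 4) :
    ∃ C : ℝ, 0 < C ∧ ∀ (l δ R : ℝ) (A : Set E) (y : E), 0 < l → 0 < δ → 0 < R →
      MeasurableSet A → (∀ z ∈ A, l ≤ ‖z‖) →
      IntegrableOn (fun z => (‖y - z‖ ^ d)⁻¹ * (‖z‖ ^ 8)⁻¹) A ∧
        ∫ z in A, (‖y - z‖ ^ d)⁻¹ * (‖z‖ ^ 8)⁻¹ ≤ (l ^ 8)⁻¹ * (C * δ ^ 4) +
          (δ ^ d)⁻¹ * (l ^ 8)⁻¹ * volume.real (A ∩ ball 0 R) +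
          (R ^ 2)⁻¹ * (C * (δ ^ 2)⁻¹ + C * (R ^ 2)⁻¹) := by
  obtain ⟨C1, hC1, h1⟩ := exists_integral_ball_inv_pow_le (E := E) (m := d) (j := 4)
    (by norm_num) hE
  obtain ⟨C2, hC2, h2⟩ := exists_integral_compl_ball_inv_pow_le (E := E) (m := d + 6) (j := 2)
    (by norm_num) (by rw [hE])
  refine ⟨C1 + C2, by positivity, fun l δ R A y hl hδ hR hA hAl => ?_⟩
  have hAm : MeasurableSet (A ∩ ball 0 R) := hA.inter measurableSet_ball
  have hAf : volume (A ∩ ball (0 : E) R) ≠ ⊤ :=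
    (measure_mono Set.inter_subset_right).trans_lt measure_ball_lt_top |>.ne
  obtain ⟨i1, b1⟩ := h1 y δ hδ
  obtain ⟨i2, b2⟩ := h2 y δ hδ
  obtain ⟨i3, b3⟩ := h2 (0 : E) R hR
  simp only [zero_sub, norm_neg] at i3 b3
  set g1 : E → ℝ := fun z => (l ^ 8)⁻¹ * (ball y δ).indicator (fun z => (‖y - z‖ ^ d)⁻¹) z
  set g2 : E → ℝ := fun z => (δ ^ d)⁻¹ * (l ^ 8)⁻¹ * (A ∩ ball 0 R).indicator (fun _ => 1) z
  set g3 : E → ℝ := fun z => (R ^ 2)⁻¹ *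
    ((ball y δ)ᶜ.indicator (fun z => (‖y - z‖ ^ (d + 6))⁻¹) z +
      (ball (0 : E) R)ᶜ.indicator (fun z => (‖z‖ ^ (d + 6))⁻¹) z)
  have I1 : Integrable g1 := (i1.integrable_indicator measurableSet_ball).const_mul _
  have I2 : Integrable g2 := ((integrableOn_const hAf).integrable_indicator hAm).const_mul _
  have j2 := i2.integrable_indicator measurableSet_ball.compl
  have j3 := i3.integrable_indicator measurableSet_ball.compl
  have I3 : Integrable g3 := (j2.add j3).const_mul _
  have p1 : ∀ z, 0 ≤ g1 z := fun z =>
    mul_nonneg (by positivity) (Set.indicator_nonneg (fun _ _ => by positivity) _)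
  have p2 : ∀ z, 0 ≤ g2 z := fun z =>
    mul_nonneg (by positivity) (Set.indicator_nonneg (fun _ _ => by positivity) _)
  have q3 : ∀ z, 0 ≤ (ball y δ)ᶜ.indicator (fun z => (‖y - z‖ ^ (d + 6))⁻¹) z := fun z =>
    Set.indicator_nonneg (fun _ _ => by positivity) _
  have q4 : ∀ z, 0 ≤ (ball (0 : E) R)ᶜ.indicator (fun z => (‖z‖ ^ (d + 6))⁻¹) z := fun z =>
    Set.indicator_nonneg (fun _ _ => by positivity) _
  have p3 : ∀ z, 0 ≤ g3 z := fun z => mul_nonneg (by positivity) (add_nonneg (q3 z) (q4 z))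
  have hpt : ∀ z ∈ A, (‖y - z‖ ^ d)⁻¹ * (‖z‖ ^ 8)⁻¹ ≤ g1 z + g2 z + g3 z := fun z hz => by
    have hzl := hAl z hz
    have hz0 : 0 < ‖z‖ := hl.trans_le hzl
    have hl8 : (‖z‖ ^ 8)⁻¹ ≤ (l ^ 8)⁻¹ := by gcongr
    by_cases hyz : z ∈ ball y δ
    · have : (‖y - z‖ ^ d)⁻¹ * (‖z‖ ^ 8)⁻¹ ≤ g1 z := by
        simp only [g1, Set.indicator_of_mem hyz]
        rw [mul_comm]; gcongr
      linarith [p2 z, p3 z]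
    · have hyz' : δ ≤ ‖y - z‖ := by
        simpa [dist_eq_norm, norm_sub_rev] using hyz
      by_cases hzR : z ∈ ball (0 : E) R
      · have : (‖y - z‖ ^ d)⁻¹ * (‖z‖ ^ 8)⁻¹ ≤ g2 z := by
          have hm : z ∈ A ∩ ball (0 : E) R := ⟨hz, hzR⟩
          simp only [g2, Set.indicator_of_mem hm, mul_one]
          gcongr
        linarith [p1 z, p3 z]
      · have hzR' : R ≤ ‖z‖ := by simpa using hzR
        have hz0' : 0 < ‖y - z‖ := hδ.trans_le hyz'
        have : (‖y - z‖ ^ d)⁻¹ * (‖z‖ ^ 8)⁻¹ ≤ g3 z := by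
          simp only [g3, Set.indicator_of_mem (Set.mem_compl hyz),
            Set.indicator_of_mem (Set.mem_compl hzR)]
          calc (‖y - z‖ ^ d)⁻¹ * (‖z‖ ^ 8)⁻¹
              = (‖z‖ ^ 2)⁻¹ * ((‖y - z‖ ^ d)⁻¹ * (‖z‖ ^ 6)⁻¹) := by
                rw [show (8 : ℕ) = 2 + 6 by norm_num, pow_add, mul_inv]; ring
            _ ≤ (R ^ 2)⁻¹ * ((‖y - z‖ ^ (d + 6))⁻¹ + (‖z‖ ^ (d + 6))⁻¹) := by
                gcongr
                exact inv_pow_mul_inv_pow_le hz0' hz0 d 6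
        linarith [p1 z, p2 z]
  obtain ⟨hi, hle⟩ := integrableOn_and_setIntegral_le_of_le (μ := (volume : Measure E))
    (f := fun z => (‖y - z‖ ^ d)⁻¹ * (‖z‖ ^ 8)⁻¹) (g := fun z => g1 z + g2 z + g3 z) hA
    (by apply Measurable.aestronglyMeasurable; fun_prop) (fun z _ => by positivity)
    hpt ((I1.add I2).add I3) (fun z => add_nonneg (add_nonneg (p1 z) (p2 z)) (p3 z))
  refine ⟨hi, hle.trans ?_⟩
  · rw [integral_add (f := fun z => g1 z + g2 z) (I1.add I2) I3, integral_add I1 I2]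
    gcongr ?_ + ?_ + ?_
    · rw [integral_const_mul, integral_indicator measurableSet_ball]
      have : C1 * δ ^ 4 ≤ (C1 + C2) * δ ^ 4 := by gcongr; linarith
      gcongr
      exact b1.trans this
    · rw [integral_const_mul, integral_indicator hAm]
      simp
    · rw [integral_const_mul, integral_add j2 j3, integral_indicator measurableSet_ball.compl,
        integral_indicator measurableSet_ball.compl]
      have e1 : C2 * (δ ^ 2)⁻¹ ≤ (C1 + C2) * (δ ^ 2)⁻¹ := by gcongr; linarith
      have e2 : C2 * (R ^ 2)⁻¹ ≤ (C1 + C2) * (R ^ 2)⁻¹ := by gcongr; linarith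
      gcongr
      · exact b2.trans e1
      · exact b3.trans e2

end RadialIntegrals

section Inversion

variable {E : Type*} [NormedAddCommGroup E] [InnerProductSpace ℝ E]

/-- Inversion of `z` in the sphere of radius `l` about the origin. -/
noncomputable def invPt (l : ℝ) (z : E) : E := (l / ‖z‖) ^ 2 • z

lemma invPt_eq_inversion (l : ℝ) : (invPt l : E → E) = EuclideanGeometry.inversion 0 l := by
  ext z; simp [invPt, EuclideanGeometry.inversion]

lemma norm_invPt (l : ℝ) {z : E} (hz : z ≠ 0) : ‖invPt l z‖ = l ^ 2 / ‖z‖ := by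
  have : ‖z‖ ≠ 0 := norm_ne_zero_iff.mpr hz
  rw [invPt, norm_smul, Real.norm_of_nonneg (by positivity)]
  field_simp

lemma invPt_invPt {l : ℝ} (hl : l ≠ 0) (z : E) : invPt l (invPt l z) = z := by
  rw [invPt_eq_inversion, EuclideanGeometry.inversion_inversion _ hl]

lemma invPt_ne_zero {l : ℝ} (hl : l ≠ 0) {z : E} (hz : z ≠ 0) : invPt l z ≠ 0 := by
  have : ‖z‖ ≠ 0 := norm_ne_zero_iff.mpr hz
  rw [invPt]
  exact smul_ne_zero (by positivity) hz

lemma invPt_image_compl_closedBall {l : ℝ} (hl : 0 < l) :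
    invPt l '' {z : E | l < ‖z‖} = ball 0 l \ {0} := by
  ext x
  simp only [Set.mem_image, Set.mem_ofPred_eq, Set.mem_sdiff, mem_ball, dist_zero_right,
    Set.mem_singleton_iff]
  constructor
  · rintro ⟨z, hz, rfl⟩
    have hz0 : z ≠ 0 := norm_ne_zero_iff.mp (hl.trans hz).ne'
    refine ⟨?_, invPt_ne_zero hl.ne' hz0⟩
    rw [norm_invPt l hz0, div_lt_iff₀ (hl.trans hz)]
    nlinarith
  · rintro ⟨hx, hx0⟩
    have : 0 < ‖x‖ := norm_pos_iff.mpr hx0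
    refine ⟨invPt l x, ?_, invPt_invPt hl.ne' x⟩
    rw [norm_invPt l hx0, lt_div_iff₀ this]
    nlinarith

lemma norm_mul_norm_invPt_sub (l : ℝ) {y z : E} (hy : y ≠ 0) (hz : z ≠ 0) :
    ‖y‖ * ‖invPt l y - z‖ = ‖z‖ * ‖y - invPt l z‖ := by
  have hy' : ‖y‖ ≠ 0 := norm_ne_zero_iff.mpr hy
  have hz' : ‖z‖ ≠ 0 := norm_ne_zero_iff.mpr hz
  rw [← sq_eq_sq₀ (by positivity) (by positivity), mul_pow, mul_pow, @norm_sub_sq_real,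
    @norm_sub_sq_real, norm_invPt l hy, norm_invPt l hz, invPt, invPt, real_inner_smul_left,
    real_inner_smul_right]
  field_simp
  ring

lemma norm_invPt_sub_invPt (l : ℝ) {y z : E} (hy : y ≠ 0) (hz : z ≠ 0) :
    ‖invPt l y - invPt l z‖ = l ^ 2 / (‖y‖ * ‖z‖) * ‖y - z‖ := by
  have := EuclideanGeometry.dist_inversion_inversion (c := (0 : E)) hy hz l
  rw [invPt_eq_inversion, ← dist_eq_norm, this]
  simp [dist_eq_norm]

lemma norm_sub_lt_of_inversion {l : ℝ} (hl : 0 < l) {y z : E} (hy : l < ‖y‖) (hz : l < ‖z‖) :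
    l * ‖y - z‖ < ‖z‖ * ‖y - invPt l z‖ := by
  have hz' : ‖z‖ ≠ 0 := (hl.trans hz).ne'
  have hz0 : z ≠ 0 := norm_ne_zero_iff.mp hz'
  have hy0 : 0 < ‖y‖ := hl.trans hy
  rw [← sq_lt_sq₀ (by positivity) (by positivity), mul_pow, mul_pow, @norm_sub_sq_real,
    @norm_sub_sq_real, norm_invPt l hz0, invPt, real_inner_smul_right]
  have h : 0 < (‖y‖ ^ 2 - l ^ 2) * (‖z‖ ^ 2 - l ^ 2) := by
    apply mul_pos <;> nlinarith
  have e : ‖z‖ ^ 2 * (‖y‖ ^ 2 - 2 * ((l / ‖z‖) ^ 2 * inner ℝ y z) + (l ^ 2 / ‖z‖) ^ 2) =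
      ‖z‖ ^ 2 * ‖y‖ ^ 2 - 2 * l ^ 2 * inner ℝ y z + l ^ 4 := by
    field_simp
  rw [e]
  nlinarith

lemma measurable_invPt [MeasurableSpace E] [BorelSpace E] [SecondCountableTopology E] (l : ℝ) :
    Measurable (invPt l : E → E) := by
  unfold invPt
  fun_prop

variable [FiniteDimensional ℝ E] [MeasurableSpace E] [BorelSpace E]

lemma abs_det_fderiv_inversion {l : ℝ} {z : E} :
    |((l / dist z 0) ^ 2 • ((ℝ ∙ (z - 0))ᗮ.reflection : E →L[ℝ] E)).det| =
      (l / ‖z‖) ^ (2 * Module.finrank ℝ E) := by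
  have h := Submodule.det_reflection (𝕜 := ℝ) (ℝ ∙ (z - 0))ᗮ
  have e : ((l / dist z 0) ^ 2 • ((ℝ ∙ (z - 0))ᗮ.reflection : E →L[ℝ] E)).det =
      ((l / dist z 0) ^ 2) ^ Module.finrank ℝ E *
        LinearMap.det (ℝ ∙ (z - 0))ᗮ.reflection.toLinearMap := by
    rw [← LinearMap.det_smul]; rfl
  rw [e, h, abs_mul, abs_pow, abs_pow, abs_pow, abs_neg, abs_one, one_pow, mul_one, pow_mul,
    ← abs_pow, abs_of_nonneg (by positivity), dist_zero_right]

lemma ball_diff_zero_ae_eq [Nontrivial E] (l : ℝ) :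
    (ball (0 : E) l \ {0} : Set E) =ᵐ[volume] ({z : E | l < ‖z‖}ᶜ : Set E) := by
  have h1 : (volume : Measure E) (sphere 0 l ∪ {0}) = 0 :=
    measure_union_null (Measure.addHaar_sphere _ _ _) (by simp)
  refine ae_eq_set.mpr ⟨?_, ?_⟩
  · refine measure_mono_null ?_ h1
    rintro x ⟨⟨hx, -⟩, hx'⟩
    simp only [Set.mem_compl_iff, Set.mem_ofPred_eq, not_not, mem_ball, dist_zero_right] at hx hx'
    linarith
  · refine measure_mono_null ?_ h1
    rintro x ⟨hx, hx'⟩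
    simp only [Set.mem_compl_iff, Set.mem_ofPred_eq, not_lt, Set.mem_sdiff, mem_ball,
      dist_zero_right, Set.mem_singleton_iff, not_and, not_not] at hx hx'
    rcases hx.lt_or_eq with h | h
    · exact Or.inr (hx' h)
    · exact Or.inl (by simpa using h)

/-- Change of variables under inversion. -/
lemma integral_eq_setIntegral_add_inversion [Nontrivial E] {l : ℝ} (hl : 0 < l) {f : E → ℝ}
    (hf : Integrable f) :
    IntegrableOn (fun z => (l / ‖z‖) ^ (2 * Module.finrank ℝ E) * f (invPt l z))
      {z : E | l < ‖z‖} ∧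
    ∫ z, f z = (∫ z in {z : E | l < ‖z‖}, f z) +
      ∫ z in {z : E | l < ‖z‖}, (l / ‖z‖) ^ (2 * Module.finrank ℝ E) * f (invPt l z) := by
  have hm : MeasurableSet {z : E | l < ‖z‖} := measurableSet_lt measurable_const measurable_norm
  have hder : ∀ z ∈ {z : E | l < ‖z‖}, HasFDerivWithinAt (invPt l)
      ((l / dist z 0) ^ 2 • ((ℝ ∙ (z - 0))ᗮ.reflection : E →L[ℝ] E)) {z : E | l < ‖z‖} z := by
    intro z hz
    rw [invPt_eq_inversion]
    exact (EuclideanGeometry.hasFDerivAt_inversion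
      (norm_ne_zero_iff.mp (hl.trans hz).ne')).hasFDerivWithinAt
  have hinj : Set.InjOn (invPt l) {z : E | l < ‖z‖} := by
    rw [invPt_eq_inversion]
    exact (EuclideanGeometry.inversion_injective _ hl.ne').injOn
  have h1 := integrableOn_image_iff_integrableOn_abs_det_fderiv_smul volume hm hder hinj f
  have h2 := integral_image_eq_integral_abs_det_fderiv_smul volume hm hder hinj f
  simp only [abs_det_fderiv_inversion, smul_eq_mul] at h1 h2
  refine ⟨h1.mp hf.integrableOn, ?_⟩
  rw [← h2, invPt_image_compl_closedBall hl, setIntegral_congr_set (ball_diff_zero_ae_eq l)]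
  exact (integral_add_compl hm hf).symm

end Inversion

section MovingSpheres

variable {E : Type*} [NormedAddCommGroup E] [InnerProductSpace ℝ E] [FiniteDimensional ℝ E]
  [MeasurableSpace E] [BorelSpace E]

/-- `U` is a positive continuous function off `q` that equals the Riesz potential of order four of
`κ Uᵖ`, up to a nonnegative additive constant `c`, with a subcritical exponent `p`. -/
structure IsPotential (d : ℕ) (p κ c : ℝ) (q : E) (U : E → ℝ) : Prop where
  finrank : Module.finrank ℝ E = d + 4
  one_lt : 1 < p
  subcrit : p * d < d + 8
  kappa_pos : 0 < κ
  nonneg : 0 ≤ c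
  cont : ContinuousOn U {q}ᶜ
  pos : ∀ y, y ≠ q → 0 < U y
  int : ∀ y, y ≠ q → Integrable (fun z => (‖y - z‖ ^ d)⁻¹ * U z ^ p)
  eq : ∀ y, y ≠ q → U y = κ * (∫ z, (‖y - z‖ ^ d)⁻¹ * U z ^ p) + c

/-- The Kelvin transform of `U` with respect to the sphere of radius `l`. -/
noncomputable def kelvin (d : ℕ) (U : E → ℝ) (l : ℝ) (y : E) : ℝ :=
  (l / ‖y‖) ^ d * U (invPt l y)

lemma rpow_sub_rpow_le {p X b : ℝ} (hp : 1 ≤ p) (hb : 0 ≤ b) (hbX : b ≤ X) :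
    X ^ p - b ^ p ≤ p * X ^ (p - 1) * (X - b) := by
  rcases hbX.eq_or_lt with rfl | hlt
  · simp
  have hX : 0 < X := hb.trans_lt hlt
  have h := one_add_mul_self_le_rpow_one_add (s := b / X - 1) (by
    have : 0 ≤ b / X := by positivity
    linarith) hp
  have e : (b / X) ^ p = b ^ p / X ^ p := Real.div_rpow hb hX.le p
  have hXp : 0 < X ^ p := by positivity
  have e2 : X ^ (p - 1) = X ^ p / X := by rw [Real.rpow_sub hX, Real.rpow_one]
  have h' : 1 + p * (b / X - 1) ≤ b ^ p / X ^ p := by rw [← e]; simpa using h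
  rw [le_div_iff₀ hXp] at h'
  rw [e2]
  have : p * (X ^ p / X) * (X - b) = - (p * (b / X - 1)) * X ^ p := by
    field_simp; ring
  rw [this]
  linarith

section Scalar

variable {d : ℕ} {p t a b A : ℝ}

lemma pow_mul_rpow_eq (ht : 0 < t) (ha : 0 < a) :
    t ^ (d + 8) * a ^ p = t ^ ((d : ℝ) + 8 - p * d) * (t ^ d * a) ^ p := by
  rw [Real.mul_rpow (by positivity) ha.le, ← Real.rpow_natCast, ← Real.rpow_natCast,
    ← Real.rpow_mul ht.le, ← mul_assoc, ← Real.rpow_add ht]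
  push_cast
  ring_nf

lemma pow_mul_rpow_lt (hp : 1 < p) (hs : p * d < d + 8) (ht : 0 < t) (ht1 : t < 1) (ha : 0 < a)
    (h : t ^ d * a ≤ b) : t ^ (d + 8) * a ^ p < b ^ p := by
  rw [pow_mul_rpow_eq ht ha]
  have h1 : t ^ ((d : ℝ) + 8 - p * d) < 1 := Real.rpow_lt_one ht.le ht1 (by linarith)
  have h2 : (t ^ d * a) ^ p ≤ b ^ p := by gcongr
  have h3 : 0 < (t ^ d * a) ^ p := by positivity
  nlinarith

lemma pow_mul_rpow_sub_le (hp : 1 < p) (hs : p * d < d + 8) (ht : 0 < t) (ht1 : t < 1)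
    (ha : 0 < a) (haA : a ≤ A) (hb : 0 < b) (h : b < t ^ d * a) :
    t ^ (d + 8) * a ^ p - b ^ p ≤ p * A ^ (p - 1) * t ^ 8 * (t ^ d * a - b) := by
  rw [pow_mul_rpow_eq ht ha]
  have h1 : t ^ ((d : ℝ) + 8 - p * d) < 1 := Real.rpow_lt_one ht.le ht1 (by linarith)
  have h0 : 0 < t ^ ((d : ℝ) + 8 - p * d) := by positivity
  have h2 := rpow_sub_rpow_le hp.le hb.le h.le
  have h3 : 0 < b ^ p := by positivity
  have h4 : t ^ ((d : ℝ) + 8 - p * d) * (t ^ d * a) ^ (p - 1) = t ^ 8 * a ^ (p - 1) := by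
    rw [Real.mul_rpow (by positivity) ha.le, ← Real.rpow_natCast, ← Real.rpow_natCast,
      ← Real.rpow_mul ht.le, ← mul_assoc, ← Real.rpow_add ht]
    push_cast
    ring_nf
  have h5 : a ^ (p - 1) ≤ A ^ (p - 1) := by
    gcongr
  have h6 : 0 < t ^ d * a - b := by linarith
  calc _ ≤ t ^ ((d : ℝ) + 8 - p * d) * ((t ^ d * a) ^ p - b ^ p) := by nlinarith
    _ ≤ t ^ ((d : ℝ) + 8 - p * d) * (p * (t ^ d * a) ^ (p - 1) * (t ^ d * a - b)) := by gcongr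
    _ = p * (t ^ 8 * a ^ (p - 1)) * (t ^ d * a - b) := by rw [← h4]; ring
    _ ≤ p * (t ^ 8 * A ^ (p - 1)) * (t ^ d * a - b) := by gcongr
    _ = _ := by ring

end Scalar

lemma measurableSet_lt_norm (l : ℝ) : MeasurableSet {z : E | l < ‖z‖} :=
  measurableSet_lt measurable_const measurable_norm

/-- The difference between the kernel and its reflection. -/
noncomputable def kerDiff (d : ℕ) (l : ℝ) (y z : E) : ℝ :=
  (‖y - z‖ ^ d)⁻¹ - (l / ‖z‖) ^ d * (‖y - invPt l z‖ ^ d)⁻¹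

lemma kerDiff_pos {d : ℕ} (hd : d ≠ 0) {l : ℝ} (hl : 0 < l) {y z : E} (hy : l < ‖y‖)
    (hz : l < ‖z‖) (hyz : y ≠ z) : 0 < kerDiff d l y z := by
  have h := norm_sub_lt_of_inversion hl hy hz
  have h0 : 0 < ‖y - z‖ := norm_pos_iff.mpr (sub_ne_zero.mpr hyz)
  have hz0 : 0 < ‖z‖ := hl.trans hz
  have h1 : 0 < ‖y - invPt l z‖ := by
    by_contra hc
    have : ‖y - invPt l z‖ = 0 := le_antisymm (not_lt.mp hc) (norm_nonneg _)
    rw [this] at h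
    nlinarith [mul_pos hl h0]
  rw [kerDiff, sub_pos, ← inv_pow, ← inv_pow, ← mul_pow]
  refine pow_lt_pow_left₀ ?_ (by positivity) hd
  rw [← div_eq_mul_inv, div_div, lt_inv_comm₀ (by positivity) h0, inv_div, lt_div_iff₀ hl]
  linarith

lemma kerDiff_le {d : ℕ} {l : ℝ} (hl : 0 < l) (y z : E) :
    kerDiff d l y z ≤ (‖y - z‖ ^ d)⁻¹ := by
  rw [kerDiff]
  have : 0 ≤ (l / ‖z‖) ^ d * (‖y - invPt l z‖ ^ d)⁻¹ := by positivity
  linarith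

namespace IsPotential

variable {d : ℕ} {p κ c : ℝ} {q : E} {U : E → ℝ}

lemma nontrivial (h : IsPotential d p κ c q U) : Nontrivial E :=
  Module.nontrivial_of_finrank_pos (R := ℝ) (by rw [h.finrank]; omega)

lemma measurable (h : IsPotential d p κ c q U) : Measurable U :=
  measurable_of_continuousOn_compl_singleton q h.cont

lemma invPt_ne {l : ℝ} (hl : 0 < l) (hlq : l < ‖q‖) {y : E} (hy : l < ‖y‖) : invPt l y ≠ q := by
  have hm : invPt l y ∈ invPt l '' {z : E | l < ‖z‖} := ⟨y, hy, rfl⟩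
  rw [invPt_image_compl_closedBall hl] at hm
  rintro rfl
  have := hm.1
  rw [mem_ball, dist_zero_right] at this
  linarith

lemma invPt_mem_ball {l : ℝ} (hl : 0 < l) {y : E} (hy : l < ‖y‖) : invPt l y ∈ ball (0 : E) l := by
  have hm : invPt l y ∈ invPt l '' {z : E | l < ‖z‖} := ⟨y, hy, rfl⟩
  rw [invPt_image_compl_closedBall hl] at hm
  exact hm.1

/-- The difference of `U` and its Kelvin transform as an integral over the exterior domain. -/
lemma sub_kelvin_eq (h : IsPotential d p κ c q U) {l : ℝ} (hl : 0 < l) (hlq : l < ‖q‖) {y : E}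
    (hy : l < ‖y‖) (hyq : y ≠ q) :
    IntegrableOn (fun z => kerDiff d l y z *
      (U z ^ p - (l / ‖z‖) ^ (d + 8) * U (invPt l z) ^ p)) {z : E | l < ‖z‖} ∧
    U y - kelvin d U l y = κ * (∫ z in {z : E | l < ‖z‖}, kerDiff d l y z *
      (U z ^ p - (l / ‖z‖) ^ (d + 8) * U (invPt l z) ^ p)) + c * (1 - (l / ‖y‖) ^ d) := by
  have := h.nontrivial
  have hm := measurableSet_lt_norm (E := E) l
  have hy0 : 0 < ‖y‖ := hl.trans hy
  have hyne : y ≠ 0 := norm_ne_zero_iff.mp hy0.ne'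
  have i1 := h.int y hyq
  have i2 := (h.int _ (invPt_ne hl hlq hy)).const_mul ((l / ‖y‖) ^ d)
  obtain ⟨j1, e1⟩ := integral_eq_setIntegral_add_inversion hl i1
  obtain ⟨j2, e2⟩ := integral_eq_setIntegral_add_inversion hl i2
  rw [h.finrank] at j1 j2 e1 e2
  have c1 : Set.EqOn (fun z => (l / ‖z‖) ^ (2 * (d + 4)) *
      ((‖y - invPt l z‖ ^ d)⁻¹ * U (invPt l z) ^ p))
      (fun z => ((l / ‖z‖) ^ d * (‖y - invPt l z‖ ^ d)⁻¹) *
        ((l / ‖z‖) ^ (d + 8) * U (invPt l z) ^ p)) {z : E | l < ‖z‖} := by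
    intro z hz
    simp only
    ring
  have c2 : Set.EqOn (fun z => (l / ‖y‖) ^ d * ((‖invPt l y - z‖ ^ d)⁻¹ * U z ^ p))
      (fun z => ((l / ‖z‖) ^ d * (‖y - invPt l z‖ ^ d)⁻¹) * U z ^ p) {z : E | l < ‖z‖} := by
    intro z hz
    have hz0 : 0 < ‖z‖ := hl.trans hz
    have := norm_mul_norm_invPt_sub l hyne (norm_ne_zero_iff.mp hz0.ne')
    simp only
    rw [← mul_assoc, ← inv_pow, ← inv_pow, ← mul_pow, ← mul_pow, ← div_eq_mul_inv,
      ← div_eq_mul_inv, div_div, div_div, this]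
  have c3 : Set.EqOn (fun z => (l / ‖z‖) ^ (2 * (d + 4)) *
      ((l / ‖y‖) ^ d * ((‖invPt l y - invPt l z‖ ^ d)⁻¹ * U (invPt l z) ^ p)))
      (fun z => (‖y - z‖ ^ d)⁻¹ * ((l / ‖z‖) ^ (d + 8) * U (invPt l z) ^ p))
      {z : E | l < ‖z‖} := by
    intro z hz
    have hz0 : 0 < ‖z‖ := hl.trans hz
    simp only
    rw [norm_invPt_sub_invPt l hyne (norm_ne_zero_iff.mp hz0.ne'), mul_pow, mul_inv]
    have e : (l / ‖z‖) ^ d * (l / ‖y‖) ^ d * ((l ^ 2 / (‖y‖ * ‖z‖)) ^ d)⁻¹ = 1 := by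
      rw [← mul_pow, ← inv_pow, ← mul_pow]
      convert one_pow d
      field_simp
    calc _ = ((l / ‖z‖) ^ d * (l / ‖y‖) ^ d * ((l ^ 2 / (‖y‖ * ‖z‖)) ^ d)⁻¹) *
        ((‖y - z‖ ^ d)⁻¹ * ((l / ‖z‖) ^ (d + 8) * U (invPt l z) ^ p)) := by ring
      _ = _ := by rw [e, one_mul]
  have i2' := i2.integrableOn (s := {z : E | l < ‖z‖})
  rw [integrableOn_congr_fun c1 hm] at j1
  rw [integrableOn_congr_fun c3 hm] at j2
  rw [integrableOn_congr_fun c2 hm] at i2'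
  rw [setIntegral_congr_fun hm c1] at e1
  rw [setIntegral_congr_fun hm c2, setIntegral_congr_fun hm c3] at e2
  have key : (fun z => kerDiff d l y z *
      (U z ^ p - (l / ‖z‖) ^ (d + 8) * U (invPt l z) ^ p)) =
      fun z => ((‖y - z‖ ^ d)⁻¹ * U z ^ p + ((l / ‖z‖) ^ d * (‖y - invPt l z‖ ^ d)⁻¹) *
        ((l / ‖z‖) ^ (d + 8) * U (invPt l z) ^ p)) -
        (((l / ‖z‖) ^ d * (‖y - invPt l z‖ ^ d)⁻¹) * U z ^ p +
        (‖y - z‖ ^ d)⁻¹ * ((l / ‖z‖) ^ (d + 8) * U (invPt l z) ^ p)) := by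
    ext z; rw [kerDiff]; ring
  rw [key]
  have s1 : IntegrableOn (fun z => (‖y - z‖ ^ d)⁻¹ * U z ^ p +
      ((l / ‖z‖) ^ d * (‖y - invPt l z‖ ^ d)⁻¹) *
        ((l / ‖z‖) ^ (d + 8) * U (invPt l z) ^ p)) {z : E | l < ‖z‖} := i1.integrableOn.add j1
  have s2 : IntegrableOn (fun z => ((l / ‖z‖) ^ d * (‖y - invPt l z‖ ^ d)⁻¹) * U z ^ p +
        (‖y - z‖ ^ d)⁻¹ * ((l / ‖z‖) ^ (d + 8) * U (invPt l z) ^ p)) {z : E | l < ‖z‖} :=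
    i2'.add j2
  refine ⟨s1.sub s2, ?_⟩
  rw [integral_sub s1 s2, integral_add i1.integrableOn j1, integral_add i2' j2, ← e1, ← e2,
    integral_const_mul, kelvin, h.eq y hyq, h.eq _ (invPt_ne hl hlq hy)]
  ring

end IsPotential

end MovingSpheres

section MovingSpheres

variable {E : Type*} [NormedAddCommGroup E] [InnerProductSpace ℝ E] [FiniteDimensional ℝ E]
  [MeasurableSpace E] [BorelSpace E]

/-- The exterior set where the Kelvin transform exceeds the function. -/
def kelvinExcess (d : ℕ) (U : E → ℝ) (l : ℝ) : Set E := {z | l < ‖z‖ ∧ U z < kelvin d U l z}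

namespace IsPotential

variable {d : ℕ} {p κ c : ℝ} {q : E} {U : E → ℝ}

lemma measurableSet_kelvinExcess (h : IsPotential d p κ c q U) (l : ℝ) :
    MeasurableSet (kelvinExcess d U l) := by
  refine (measurableSet_lt_norm l).inter (measurableSet_lt h.measurable ?_)
  have h1 := h.measurable.comp (measurable_invPt (E := E) l)
  have h2 : Measurable fun z : E => (l / ‖z‖) ^ d := by fun_prop
  exact h2.mul h1

lemma kelvin_sub_le_of_le (h : IsPotential d p κ c q U) {l A N I : ℝ} (hd : d ≠ 0) (hl : 0 < l)
    (hlq : l < ‖q‖) (hA : ∀ z ∈ ball (0 : E) l, U z ≤ A) (hN0 : 0 ≤ N)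
    (hN : ∀ y : E, l < ‖y‖ → y ≠ q → kelvin d U l y - U y ≤ N)
    (hint : ∀ y : E, IntegrableOn (fun z => (‖y - z‖ ^ d)⁻¹ * (‖z‖ ^ 8)⁻¹) (kelvinExcess d U l))
    (hI : ∀ y : E, ∫ z in kelvinExcess d U l, (‖y - z‖ ^ d)⁻¹ * (‖z‖ ^ 8)⁻¹ ≤ I)
    {y : E} (hy : l < ‖y‖) (hyq : y ≠ q) :
    kelvin d U l y - U y ≤ κ * (p * A ^ (p - 1) * l ^ 8 * I) * N := by
  have := h.nontrivial
  have hp := h.one_lt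
  have hκ := h.kappa_pos
  have hc := h.nonneg
  obtain ⟨i1, e1⟩ := h.sub_kelvin_eq hl hlq hy hyq
  set F : E → ℝ := fun z => kerDiff d l y z *
      (U z ^ p - (l / ‖z‖) ^ (d + 8) * U (invPt l z) ^ p) with hF
  have hA0 : 0 ≤ A := by
    have h0 : (0 : E) ≠ q := by rintro rfl; simp at hlq; linarith
    exact (h.pos 0 h0).le.trans (hA 0 (by simpa using hl))
  set B : ℝ := p * A ^ (p - 1) * l ^ 8 * N with hB
  have hB0 : 0 ≤ B := by positivity
  have hSm := h.measurableSet_kelvinExcess l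
  have hpt : ∀ᵐ z ∂(volume.restrict {z : E | l < ‖z‖}), - F z ≤
      (kelvinExcess d U l).indicator (fun z => B * ((‖y - z‖ ^ d)⁻¹ * (‖z‖ ^ 8)⁻¹)) z := by
    have hy' : ∀ᵐ z ∂(volume : Measure E), z ≠ y := Measure.ae_ne _ _
    have hq' : ∀ᵐ z ∂(volume : Measure E), z ≠ q := Measure.ae_ne _ _
    filter_upwards [ae_restrict_mem (measurableSet_lt_norm l), ae_restrict_of_ae hy',
      ae_restrict_of_ae hq'] with z hz hzy hzq
    have hz : l < ‖z‖ := hz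
    have hz0 : 0 < ‖z‖ := hl.trans hz
    have ht0 : 0 < l / ‖z‖ := by positivity
    have ht1 : l / ‖z‖ < 1 := (div_lt_one hz0).mpr hz
    have ha : 0 < U (invPt l z) := h.pos _ (invPt_ne hl hlq hz)
    have hb : 0 < U z := h.pos _ hzq
    have hk : 0 < kerDiff d l y z := kerDiff_pos hd hl hy hz hzy.symm
    by_cases hzS : z ∈ kelvinExcess d U l
    · rw [Set.indicator_of_mem hzS]
      have h1 := pow_mul_rpow_sub_le hp h.subcrit ht0 ht1 ha (hA _ (invPt_mem_ball hl hz)) hb hzS.2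
      have h2 : (l / ‖z‖) ^ d * U (invPt l z) - U z ≤ N := hN z hz hzq
      have h3 : (l / ‖z‖) ^ (d + 8) * U (invPt l z) ^ p - U z ^ p ≤ B * (‖z‖ ^ 8)⁻¹ := by
        calc _ ≤ p * A ^ (p - 1) * (l / ‖z‖) ^ 8 * ((l / ‖z‖) ^ d * U (invPt l z) - U z) := h1
          _ ≤ p * A ^ (p - 1) * (l / ‖z‖) ^ 8 * N := by gcongr
          _ = _ := by rw [hB, div_pow]; ring
      calc - F z = kerDiff d l y z * ((l / ‖z‖) ^ (d + 8) * U (invPt l z) ^ p - U z ^ p) := by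
            rw [hF]; ring
        _ ≤ kerDiff d l y z * (B * (‖z‖ ^ 8)⁻¹) := by gcongr
        _ ≤ (‖y - z‖ ^ d)⁻¹ * (B * (‖z‖ ^ 8)⁻¹) := by
          gcongr
          exact kerDiff_le hl y z
        _ = _ := by ring
    · rw [Set.indicator_of_notMem hzS]
      have h1 : (l / ‖z‖) ^ d * U (invPt l z) ≤ U z := by
        by_contra hc
        exact hzS ⟨hz, not_le.mp hc⟩
      have h2 := pow_mul_rpow_lt hp h.subcrit ht0 ht1 ha h1
      have : 0 ≤ F z := mul_nonneg hk.le (by linarith)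
      linarith
  have hle : ∫ z in {z : E | l < ‖z‖}, - F z ≤ B * I := by
    have hi := ((hint y).const_mul B)
    calc _ ≤ ∫ z in {z : E | l < ‖z‖},
          (kelvinExcess d U l).indicator (fun z => B * ((‖y - z‖ ^ d)⁻¹ * (‖z‖ ^ 8)⁻¹)) z :=
          integral_mono_ae i1.neg ((integrable_indicator_iff hSm).mpr hi).integrableOn hpt
      _ = ∫ z in kelvinExcess d U l, B * ((‖y - z‖ ^ d)⁻¹ * (‖z‖ ^ 8)⁻¹) := by
          rw [setIntegral_indicator hSm, Set.inter_eq_right.mpr fun z hz => hz.1]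
      _ ≤ B * I := by rw [integral_const_mul]; gcongr; exact hI y
  rw [integral_neg] at hle
  have ht1 : (l / ‖y‖) ^ d ≤ 1 :=
    pow_le_one₀ (by positivity) ((div_lt_one (hl.trans hy)).mpr hy).le
  have : 0 ≤ c * (1 - (l / ‖y‖) ^ d) := mul_nonneg hc (by linarith)
  calc kelvin d U l y - U y ≤ κ * (- ∫ z in {z : E | l < ‖z‖}, F z) := by linarith
    _ ≤ κ * (B * I) := by gcongr
    _ = _ := by rw [hB]; ring

lemma kelvin_le_of_integral_small (h : IsPotential d p κ c q U) {l A I : ℝ} (hd : d ≠ 0)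
    (hl : 0 < l) (hlq : l < ‖q‖) (hA : ∀ z ∈ ball (0 : E) l, U z ≤ A)
    (hint : ∀ y : E, IntegrableOn (fun z => (‖y - z‖ ^ d)⁻¹ * (‖z‖ ^ 8)⁻¹) (kelvinExcess d U l))
    (hI : ∀ y : E, ∫ z in kelvinExcess d U l, (‖y - z‖ ^ d)⁻¹ * (‖z‖ ^ 8)⁻¹ ≤ I)
    (hsmall : κ * (p * A ^ (p - 1) * l ^ 8 * I) < 1) {y : E} (hy : l < ‖y‖) (hyq : y ≠ q) :
    kelvin d U l y ≤ U y := by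
  have hκ := h.kappa_pos
  have hp := h.one_lt
  have hA0 : 0 ≤ A := by
    have h0 : (0 : E) ≠ q := by rintro rfl; simp at hlq; linarith
    exact (h.pos 0 h0).le.trans (hA 0 (by simpa using hl))
  have hI0 : 0 ≤ I := le_trans (integral_nonneg fun z => by positivity) (hI 0)
  set B := κ * (p * A ^ (p - 1) * l ^ 8 * I) with hB
  have hB0 : 0 ≤ B := by positivity
  have key : ∀ j : ℕ, ∀ y : E, l < ‖y‖ → y ≠ q → kelvin d U l y - U y ≤ B ^ j * A := by
    intro j
    induction j with
    | zero =>
      intro y hy hyq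
      have ht1 : (l / ‖y‖) ^ d ≤ 1 :=
        pow_le_one₀ (div_nonneg hl.le (norm_nonneg _)) ((div_lt_one (hl.trans hy)).mpr hy).le
      have h1 := hA _ (invPt_mem_ball hl hy)
      have h2 := h.pos y hyq
      have h3 : kelvin d U l y ≤ 1 * A := by
        rw [kelvin]
        gcongr
        exact (h.pos _ (invPt_ne hl hlq hy)).le
      simpa using by linarith
    | succ j ih =>
      intro y hy hyq
      have := h.kelvin_sub_le_of_le hd hl hlq hA (N := B ^ j * A) (by positivity) ih hint hI hy hyq
      rw [pow_succ]
      linarith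
  have hlim : Tendsto (fun j : ℕ => B ^ j * A) atTop (nhds 0) := by
    simpa using (tendsto_pow_atTop_nhds_zero_of_lt_one hB0 hsmall).mul_const A
  have := ge_of_tendsto' hlim fun j => key j y hy hyq
  linarith

lemma kelvin_lt (h : IsPotential d p κ c q U) {l : ℝ} (hd : d ≠ 0) (hl : 0 < l) (hlq : l < ‖q‖)
    (hle : ∀ y : E, l < ‖y‖ → y ≠ q → kelvin d U l y ≤ U y) {y : E} (hy : l < ‖y‖)
    (hyq : y ≠ q) : kelvin d U l y < U y := by
  have := h.nontrivial
  have hκ := h.kappa_pos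
  obtain ⟨i1, e1⟩ := h.sub_kelvin_eq hl hlq hy hyq
  set F : E → ℝ := fun z => kerDiff d l y z *
      (U z ^ p - (l / ‖z‖) ^ (d + 8) * U (invPt l z) ^ p) with hF
  have hpt : ∀ᵐ z ∂(volume.restrict {z : E | l < ‖z‖}), 0 < F z := by
    have hy' : ∀ᵐ z ∂(volume : Measure E), z ≠ y := Measure.ae_ne _ _
    have hq' : ∀ᵐ z ∂(volume : Measure E), z ≠ q := Measure.ae_ne _ _
    filter_upwards [ae_restrict_mem (measurableSet_lt_norm l), ae_restrict_of_ae hy',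
      ae_restrict_of_ae hq'] with z hz hzy hzq
    have hz : l < ‖z‖ := hz
    have hz0 : 0 < ‖z‖ := hl.trans hz
    have ht0 : 0 < l / ‖z‖ := by positivity
    have ht1 : l / ‖z‖ < 1 := (div_lt_one hz0).mpr hz
    have h1 := pow_mul_rpow_lt h.one_lt h.subcrit ht0 ht1 (h.pos _ (invPt_ne hl hlq hz))
      (hle z hz hzq)
    exact mul_pos (kerDiff_pos hd hl hy hz hzy.symm) (by linarith)
  have hpos : 0 < ∫ z in {z : E | l < ‖z‖}, F z := by
    rw [integral_pos_iff_support_of_nonneg_ae (hpt.mono fun z hz => hz.le) i1]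
    have hv : volume.restrict {z : E | l < ‖z‖} (Function.support F)ᶜ = 0 := by
      refine measure_mono_null (fun z hz => ?_) (ae_iff.mp hpt)
      simp only [Set.mem_compl_iff, Function.mem_support, not_not] at hz
      show ¬ (0 < F z)
      rw [hz]; exact lt_irrefl 0
    rw [pos_iff_ne_zero]
    intro h0
    have huniv : volume.restrict {z : E | l < ‖z‖} Set.univ = 0 := by
      rw [← Set.union_compl_self (Function.support F)]
      exact measure_union_null h0 hv
    rw [Measure.restrict_apply_univ] at huniv
    have hopen : IsOpen {z : E | l < ‖z‖} := isOpen_lt continuous_const continuous_norm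
    exact (hopen.measure_pos volume ⟨y, hy⟩).ne' huniv
  have ht1 : (l / ‖y‖) ^ d ≤ 1 :=
    pow_le_one₀ (div_nonneg hl.le (norm_nonneg _)) ((div_lt_one (hl.trans hy)).mpr hy).le
  have h2 : 0 ≤ c * (1 - (l / ‖y‖) ^ d) := mul_nonneg h.nonneg (by linarith)
  have h3 : 0 < κ * ∫ z in {z : E | l < ‖z‖}, F z := mul_pos hκ hpos
  linarith

lemma exists_bound_of_lt (h : IsPotential d p κ c q U) {L : ℝ} (hL : L < ‖q‖) :
    ∃ A : ℝ, 0 < A ∧ ∀ z ∈ closedBall (0 : E) L, U z ≤ A := by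
  have hsub : closedBall (0 : E) L ⊆ {q}ᶜ := by
    rintro z hz rfl
    rw [mem_closedBall, dist_zero_right] at hz
    linarith
  obtain ⟨A, hA⟩ := ((isCompact_closedBall (0 : E) L).bddAbove_image
    (h.cont.mono hsub)).imp fun A hA => hA
  exact ⟨max A 1, by positivity, fun z hz => le_max_of_le_left (hA ⟨z, hz, rfl⟩)⟩

lemma eventually_kelvin_le (h : IsPotential d p κ c q U) (hd : d ≠ 0) (hq : q ≠ 0) :
    ∀ᶠ l in nhdsWithin (0 : ℝ) (Set.Ioi 0), ∀ y : E, l < ‖y‖ → y ≠ q → kelvin d U l y ≤ U y := by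
  have hq0 : 0 < ‖q‖ := norm_pos_iff.mpr hq
  obtain ⟨A, hA0, hA⟩ := h.exists_bound_of_lt (L := ‖q‖ / 2) (by linarith)
  obtain ⟨C, hC, hest⟩ := exists_setIntegral_inv_pow_mul_le h.finrank
  have hlim : Tendsto (fun l : ℝ => κ * (p * A ^ (p - 1) * (3 * C)) * l ^ 4)
      (nhdsWithin (0 : ℝ) (Set.Ioi 0)) (nhds 0) := by
    have : Continuous fun l : ℝ => κ * (p * A ^ (p - 1) * (3 * C)) * l ^ 4 := by fun_prop
    simpa using (this.tendsto 0).mono_left nhdsWithin_le_nhds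
  filter_upwards [hlim.eventually_lt_const (zero_lt_one' ℝ), self_mem_nhdsWithin,
    nhdsWithin_le_nhds (Iio_mem_nhds (show (0 : ℝ) < ‖q‖ / 2 by positivity))]
    with l hsm hl hlq y hy hyq
  have hl : 0 < l := hl
  have hlq : l < ‖q‖ / 2 := hlq
  have hS := h.measurableSet_kelvinExcess l
  have hSl : ∀ z ∈ kelvinExcess d U l, l ≤ ‖z‖ := fun z hz => hz.1.le
  have hempty : kelvinExcess d U l ∩ ball 0 l = ∅ := by
    ext z
    simp only [Set.mem_inter_iff, mem_ball, dist_zero_right, Set.mem_empty_iff_false, iff_false,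
      not_and, not_lt]
    exact fun hz => hz.1.le
  refine h.kelvin_le_of_integral_small (A := A) (I := 3 * C * (l ^ 4)⁻¹) hd hl (by linarith)
    (fun z hz => hA z ?_) (fun y => (hest l l l _ y hl hl hl hS hSl).1)
    (fun y => (hest l l l _ y hl hl hl hS hSl).2.trans ?_) ?_ hy hyq
  · rw [mem_ball, dist_zero_right] at hz
    rw [mem_closedBall, dist_zero_right]
    linarith
  · rw [hempty]
    simp only [measureReal_empty, mul_zero, add_zero]
    apply le_of_eq
    field_simp
    ring
  · have e : κ * (p * A ^ (p - 1) * l ^ 8 * (3 * C * (l ^ 4)⁻¹)) =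
        κ * (p * A ^ (p - 1) * (3 * C)) * l ^ 4 := by
      have : l ^ 8 * (l ^ 4)⁻¹ = l ^ 4 := by field_simp
      calc _ = κ * (p * A ^ (p - 1) * (3 * C)) * (l ^ 8 * (l ^ 4)⁻¹) := by ring
        _ = _ := by rw [this]
    rw [e]; exact hsm

end IsPotential

end MovingSpheres

section MovingSpheres

variable {E : Type*} [NormedAddCommGroup E] [InnerProductSpace ℝ E] [FiniteDimensional ℝ E]
  [MeasurableSpace E] [BorelSpace E]

namespace IsPotential

variable {d : ℕ} {p κ c : ℝ} {q : E} {U : E → ℝ}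

lemma continuousAt_kelvin (h : IsPotential d p κ c q U) {l : ℝ} (hl : 0 < l) (hlq : l < ‖q‖)
    {y : E} (hy : l < ‖y‖) : ContinuousAt (fun l => kelvin d U l y) l := by
  have h1 : ContinuousAt U (invPt l y) :=
    h.cont.continuousAt (isOpen_compl_singleton.mem_nhds (invPt_ne hl hlq hy))
  have h2 : ContinuousAt (fun l : ℝ => invPt l y) l := by
    unfold invPt
    fun_prop
  have h3 : ContinuousAt (fun l : ℝ => U (invPt l y)) l :=
    ContinuousAt.comp (f := fun l : ℝ => invPt l y) h1 h2
  have h4 : ContinuousAt (fun l : ℝ => (l / ‖y‖) ^ d) l := by fun_prop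
  exact h4.mul h3

lemma tendsto_measure_kelvinExcess (h : IsPotential d p κ c q U) (hd : d ≠ 0) {l : ℝ} (hl : 0 < l)
    (hlq : l < ‖q‖) (hle : ∀ y : E, l < ‖y‖ → y ≠ q → kelvin d U l y ≤ U y) (R : ℝ) :
    Tendsto (fun s => volume.real (kelvinExcess d U s ∩ ball 0 R))
      (nhdsWithin l (Set.Ioi l)) (nhds 0) := by
  have := h.nontrivial
  have hq' : ∀ᵐ z ∂(volume : Measure E), z ≠ q := Measure.ae_ne _ _
  have key := tendsto_measure_of_ae_tendsto_indicator (μ := (volume : Measure E)) (A := ∅)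
    (nhdsWithin l (Set.Ioi l)) MeasurableSet.empty
    (As := fun s => kelvinExcess d U s ∩ ball 0 R)
    (fun s => (h.measurableSet_kelvinExcess s).inter measurableSet_ball)
    measurableSet_ball (measure_ball_lt_top (x := (0 : E)) (r := R)).ne
    (Eventually.of_forall fun s => Set.inter_subset_right) (by
      filter_upwards [hq'] with z hzq
      rcases lt_or_ge l ‖z‖ with hz | hz
      · have h1 := (h.continuousAt_kelvin hl hlq hz).eventually_lt_const
          (h.kelvin_lt hd hl hlq hle hz hzq)
        filter_upwards [nhdsWithin_le_nhds h1] with s hs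
        simp only [Set.mem_empty_iff_false, iff_false]
        exact fun hc => absurd hc.1.2 (not_lt.mpr hs.le)
      · filter_upwards [self_mem_nhdsWithin] with s hs
        simp only [Set.mem_empty_iff_false, iff_false]
        have hs : l < s := hs
        exact fun hc => absurd hc.1.1 (not_lt.mpr (hz.trans hs.le)))
  rw [measure_empty] at key
  have := (ENNReal.tendsto_toReal ENNReal.zero_ne_top).comp key
  rwa [ENNReal.toReal_zero] at this

lemma kelvin_le_nhdsGT (h : IsPotential d p κ c q U) (hd : d ≠ 0) {l : ℝ} (hl : 0 < l)
    (hlq : l < ‖q‖) (hle : ∀ y : E, l < ‖y‖ → y ≠ q → kelvin d U l y ≤ U y) :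
    ∀ᶠ s in nhdsWithin l (Set.Ioi l), ∀ y : E, s < ‖y‖ → y ≠ q → kelvin d U s y ≤ U y := by
  set L := (l + ‖q‖) / 2 with hL
  have hlL : l < L := by rw [hL]; linarith
  have hLq : L < ‖q‖ := by rw [hL]; linarith
  have hκ := h.kappa_pos
  have hp := h.one_lt
  obtain ⟨A, hA0, hA⟩ := h.exists_bound_of_lt hLq
  obtain ⟨C, hC, hest⟩ := exists_setIntegral_inv_pow_mul_le h.finrank
  set B := κ * (p * A ^ (p - 1) * L ^ 8) with hB
  have hB0 : 0 < B := by positivity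
  obtain ⟨δ, hδ, hδB⟩ : ∃ δ : ℝ, 0 < δ ∧ B * ((l ^ 8)⁻¹ * (C * δ ^ 4)) < 1 / 3 := by
    have hlim : Tendsto (fun δ : ℝ => B * ((l ^ 8)⁻¹ * (C * δ ^ 4)))
        (nhdsWithin (0 : ℝ) (Set.Ioi 0)) (nhds 0) := by
      have : Continuous fun δ : ℝ => B * ((l ^ 8)⁻¹ * (C * δ ^ 4)) := by fun_prop
      simpa using (this.tendsto 0).mono_left nhdsWithin_le_nhds
    obtain ⟨δ, h1, h2⟩ := ((hlim.eventually_lt_const (by norm_num : (0 : ℝ) < 1 / 3)).and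
      self_mem_nhdsWithin).exists
    exact ⟨δ, h2, h1⟩
  obtain ⟨R, hR, hRB⟩ : ∃ R : ℝ, 0 < R ∧
      B * ((R ^ 2)⁻¹ * (C * (δ ^ 2)⁻¹ + C * (R ^ 2)⁻¹)) < 1 / 3 := by
    have h2 : Tendsto (fun R : ℝ => (R ^ 2)⁻¹) atTop (nhds 0) :=
      (tendsto_pow_atTop two_ne_zero).inv_tendsto_atTop
    have hlim : Tendsto (fun R : ℝ => B * ((R ^ 2)⁻¹ * (C * (δ ^ 2)⁻¹ + C * (R ^ 2)⁻¹)))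
        atTop (nhds 0) := by
      simpa using (h2.mul ((h2.const_mul C).const_add (C * (δ ^ 2)⁻¹))).const_mul B
    obtain ⟨R, h1, h2⟩ := ((hlim.eventually_lt_const (by norm_num : (0 : ℝ) < 1 / 3)).and
      (eventually_gt_atTop 0)).exists
    exact ⟨R, h2, h1⟩
  have hlim := ((h.tendsto_measure_kelvinExcess hd hl hlq hle R).const_mul
    (B * ((δ ^ d)⁻¹ * (l ^ 8)⁻¹))).eventually_lt_const
    (show B * ((δ ^ d)⁻¹ * (l ^ 8)⁻¹) * 0 < 1 / 3 by norm_num)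
  filter_upwards [hlim, self_mem_nhdsWithin, nhdsWithin_le_nhds (Iio_mem_nhds hlL)]
    with s hs hls hsL y hy hyq
  have hls : l < s := hls
  have hsL : s < L := hsL
  have hs0 : 0 < s := hl.trans hls
  have hS := h.measurableSet_kelvinExcess s
  have hSl : ∀ z ∈ kelvinExcess d U s, l ≤ ‖z‖ := fun z hz => hls.le.trans hz.1.le
  refine h.kelvin_le_of_integral_small (A := A) hd hs0 (hsL.trans hLq)
    (fun z hz => hA z ?_) (fun y => (hest l δ R _ y hl hδ hR hS hSl).1)
    (fun y => (hest l δ R _ y hl hδ hR hS hSl).2) ?_ hy hyq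
  · rw [mem_ball, dist_zero_right] at hz
    rw [mem_closedBall, dist_zero_right]
    linarith
  · set I := (l ^ 8)⁻¹ * (C * δ ^ 4) +
          (δ ^ d)⁻¹ * (l ^ 8)⁻¹ * volume.real (kelvinExcess d U s ∩ ball 0 R) +
          (R ^ 2)⁻¹ * (C * (δ ^ 2)⁻¹ + C * (R ^ 2)⁻¹) with hI
    have hI0 : 0 ≤ I := by positivity
    calc κ * (p * A ^ (p - 1) * s ^ 8 * I) ≤ κ * (p * A ^ (p - 1) * L ^ 8 * I) := by gcongr
      _ = B * ((l ^ 8)⁻¹ * (C * δ ^ 4)) + B * ((δ ^ d)⁻¹ * (l ^ 8)⁻¹) *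
          volume.real (kelvinExcess d U s ∩ ball 0 R) +
          B * ((R ^ 2)⁻¹ * (C * (δ ^ 2)⁻¹ + C * (R ^ 2)⁻¹)) := by rw [hB, hI]; ring
      _ < 1 := by linarith

/-- The moving spheres inequality: `U` dominates its Kelvin transform in every sphere about the
origin whose closed ball does not contain the singular point. -/
theorem kelvin_le (h : IsPotential d p κ c q U) (hd : d ≠ 0) {l : ℝ} (hl : 0 < l)
    (hlq : l < ‖q‖) {y : E} (hy : l < ‖y‖) (hyq : y ≠ q) : kelvin d U l y ≤ U y := by
  have hq : q ≠ 0 := norm_pos_iff.mp (hl.trans hlq)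
  obtain ⟨a, ⟨haS, hal⟩, ha0⟩ := (((h.eventually_kelvin_le hd hq).and
    (nhdsWithin_le_nhds (Iio_mem_nhds hl))).and self_mem_nhdsWithin).exists
  have ha0 : 0 < a := ha0
  have hal : a < l := hal
  set S : Set ℝ := {s | ∀ y : E, s < ‖y‖ → y ≠ q → kelvin d U s y ≤ U y} with hS
  have hclosed : IsClosed (S ∩ Set.Icc a l) := by
    refine isClosed_of_closure_subset fun s hs => ?_
    have hsI : s ∈ Set.Icc a l := isClosed_Icc.closure_subset_iff.mpr Set.inter_subset_right hs
    refine ⟨fun y hy hyq => ?_, hsI⟩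
    by_contra hc
    rw [not_le] at hc
    have h1 := (h.continuousAt_kelvin (ha0.trans_le hsI.1) (hsI.2.trans_lt hlq)
      hy).eventually_const_lt hc
    obtain ⟨r, hrS, hr1, hr2⟩ :=
      ((mem_closure_iff_frequently.mp hs).and_eventually (h1.and (Iio_mem_nhds hy))).exists
    exact absurd (hrS.1 y hr2 hyq) (not_le.mpr hr1)
  have hsub := hclosed.Icc_subset_of_forall_mem_nhdsWithin haS fun s hs =>
    h.kelvin_le_nhdsGT hd (ha0.trans_le hs.2.1) (hs.2.2.trans hlq) hs.1
  exact hsub (Set.right_mem_Icc.mpr hal.le) y hy hyq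

end IsPotential

end MovingSpheres

section Liouville

variable {E : Type*} [NormedAddCommGroup E] [InnerProductSpace ℝ E] [FiniteDimensional ℝ E]
  [MeasurableSpace E] [BorelSpace E]

namespace IsPotential

variable {d : ℕ} {p κ c : ℝ} {q : E} {U : E → ℝ}

lemma translate (h : IsPotential d p κ c q U) (x : E) :
    IsPotential d p κ c (q - x) (fun y => U (y + x)) where
  finrank := h.finrank
  one_lt := h.one_lt
  subcrit := h.subcrit
  kappa_pos := h.kappa_pos
  nonneg := h.nonneg
  cont := by
    refine h.cont.comp (by fun_prop) fun y hy hyq => hy ?_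
    simp only [Set.mem_singleton_iff] at hyq ⊢
    rw [← hyq]; simp
  pos y hy := h.pos _ fun hc => hy (by rw [← hc]; simp)
  int y hy := by
    have h1 := (h.int (y + x) fun hc => hy (by rw [← hc]; simp)).comp_add_right x
    simpa using h1
  eq y hy := by
    have h1 := h.eq (y + x) fun hc => hy (by rw [← hc]; simp)
    rw [h1, ← integral_add_right_eq_self _ x]
    simp

lemma exists_rpow_lower_bound_succ {α : ℝ} (h : IsPotential d p κ c q U) (hq : ‖q‖ < 1)
    (hα : ∃ C > 0, ∀ y : E, 1 ≤ ‖y‖ → C * ‖y‖ ^ (-α) ≤ U y) :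
    ∃ C > 0, ∀ y : E, 1 ≤ ‖y‖ → C * ‖y‖ ^ (-(p * α - 4)) ≤ U y := by
  obtain ⟨C, hC, hle⟩ := hα
  have hκ := h.kappa_pos
  have hp := h.one_lt
  have := h.nontrivial
  set m : ℝ := min ((2 : ℝ) ^ (-(α * p))) ((4 : ℝ) ^ (-(α * p))) with hm
  have hm0 : 0 < m := by positivity
  set ω : ℝ := volume.real (ball (0 : E) 1) with hω
  have hω0 : 0 < ω := ENNReal.toReal_pos (measure_ball_pos _ _ one_pos).ne' measure_ball_lt_top.ne
  refine ⟨κ * ((3 ^ d)⁻¹ * (C ^ p * m) * ω), by positivity, fun y hy => ?_⟩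
  have hy0 : 0 < ‖y‖ := by linarith
  have hyq : y ≠ q := by rintro rfl; linarith
  rw [h.eq y hyq]
  have hint := h.int y hyq
  have hUnn : ∀ z : E, 1 ≤ ‖z‖ → 0 ≤ U z := fun z hz => (h.pos z (by rintro rfl; linarith)).le
  have hlow : ∀ z ∈ ball ((3 : ℝ) • y) ‖y‖,
      ((3 ^ d)⁻¹ * (C ^ p * m)) * ((‖y‖ ^ d)⁻¹ * ‖y‖ ^ (-(α * p))) ≤
        (‖y - z‖ ^ d)⁻¹ * U z ^ p := by
    intro z hz
    rw [mem_ball, dist_eq_norm] at hz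
    have n3 : ‖(3 : ℝ) • y‖ = 3 * ‖y‖ := by rw [norm_smul]; norm_num
    have n2 : ‖y - (3 : ℝ) • y‖ = 2 * ‖y‖ := by
      rw [show y - (3 : ℝ) • y = (-2 : ℝ) • y by module, norm_smul]; norm_num
    have hz1 : 2 * ‖y‖ ≤ ‖z‖ := by
      have := norm_sub_norm_le ((3 : ℝ) • y) z
      rw [norm_sub_rev] at this; linarith
    have hz2 : ‖z‖ ≤ 4 * ‖y‖ := by
      have := norm_sub_norm_le z ((3 : ℝ) • y); linarith
    have hyz1 : ‖y - z‖ ≤ 3 * ‖y‖ := by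
      have := norm_add_le (y - (3 : ℝ) • y) ((3 : ℝ) • y - z)
      rw [sub_add_sub_cancel, norm_sub_rev ((3 : ℝ) • y) z] at this; linarith
    have hyz0 : 0 < ‖y - z‖ := by
      have := norm_sub_norm_le z y
      rw [norm_sub_rev] at this; linarith
    have hz0 : 0 < ‖z‖ := by linarith
    have h1 : (3 ^ d)⁻¹ * (‖y‖ ^ d)⁻¹ ≤ (‖y - z‖ ^ d)⁻¹ := by
      rw [← mul_inv, ← mul_pow]; gcongr
    have h2 : m * ‖y‖ ^ (-(α * p)) ≤ ‖z‖ ^ (-(α * p)) := by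
      rcases le_total 0 (-(α * p)) with hs | hs
      · calc _ ≤ (2 : ℝ) ^ (-(α * p)) * ‖y‖ ^ (-(α * p)) := by
              gcongr; exact min_le_left _ _
          _ = (2 * ‖y‖) ^ (-(α * p)) := by rw [Real.mul_rpow (by norm_num) hy0.le]
          _ ≤ _ := Real.rpow_le_rpow (by positivity) hz1 hs
      · calc _ ≤ (4 : ℝ) ^ (-(α * p)) * ‖y‖ ^ (-(α * p)) := by
              gcongr; exact min_le_right _ _
          _ = (4 * ‖y‖) ^ (-(α * p)) := by rw [Real.mul_rpow (by norm_num) hy0.le]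
          _ ≤ _ := Real.rpow_le_rpow_of_nonpos hz0 hz2 hs
    have h3 : C ^ p * ‖z‖ ^ (-(α * p)) ≤ U z ^ p := by
      have := Real.rpow_le_rpow (by positivity) (hle z (by linarith)) (by linarith : 0 ≤ p)
      rw [Real.mul_rpow hC.le (by positivity), ← Real.rpow_mul hz0.le] at this
      rwa [neg_mul] at this
    calc _ = ((3 ^ d)⁻¹ * (‖y‖ ^ d)⁻¹) * (C ^ p * (m * ‖y‖ ^ (-(α * p)))) := by ring
      _ ≤ (‖y - z‖ ^ d)⁻¹ * (C ^ p * ‖z‖ ^ (-(α * p))) := by gcongr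
      _ ≤ _ := by gcongr
  have hge : ((3 ^ d)⁻¹ * (C ^ p * m)) * ((‖y‖ ^ d)⁻¹ * ‖y‖ ^ (-(α * p))) *
      (‖y‖ ^ (d + 4) * ω) ≤ ∫ z, (‖y - z‖ ^ d)⁻¹ * U z ^ p := by
    have hv : volume.real (ball ((3 : ℝ) • y) ‖y‖) = ‖y‖ ^ (d + 4) * ω := by
      rw [Measure.real, Measure.addHaar_ball_of_pos _ _ hy0, ENNReal.toReal_mul,
        ENNReal.toReal_ofReal (by positivity), h.finrank, hω, Measure.real]
    rw [← hv]
    have h1 := setIntegral_ge_of_const_le_real measurableSet_ball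
      (measure_ball_lt_top (x := (3 : ℝ) • y) (r := ‖y‖)).ne hlow hint.integrableOn
    refine h1.trans (setIntegral_le_integral hint ?_)
    have hq' : ∀ᵐ z ∂(volume : Measure E), z ≠ q := Measure.ae_ne _ _
    filter_upwards [hq'] with z hz
    have := (h.pos z hz).le
    simp only [Pi.zero_apply]
    positivity
  have e : κ * ((3 ^ d)⁻¹ * (C ^ p * m) * ω) * ‖y‖ ^ (-(p * α - 4)) =
      κ * (((3 ^ d)⁻¹ * (C ^ p * m)) * ((‖y‖ ^ d)⁻¹ * ‖y‖ ^ (-(α * p))) *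
      (‖y‖ ^ (d + 4) * ω)) := by
    have e1 : ‖y‖ ^ (-(p * α - 4)) = ‖y‖ ^ (-(α * p)) * ‖y‖ ^ 4 := by
      rw [← Real.rpow_natCast, ← Real.rpow_add hy0]; push_cast; ring_nf
    have e2 : (‖y‖ ^ d)⁻¹ * ‖y‖ ^ (d + 4) = ‖y‖ ^ 4 := by
      rw [pow_add]; field_simp
    rw [e1, ← e2]; ring
  rw [e]
  have := h.nonneg
  nlinarith

/-- There is no bounded positive entire solution of the subcritical integral equation. -/
theorem not_bounded (hd : d ≠ 0) (h : ∀ q : E, IsPotential d p κ c q U) {M : ℝ}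
    (hM : ∀ y, U y ≤ M) : False := by
  have h0 := h 0
  have := h0.nontrivial
  have hp := h0.one_lt
  have hdpos : (0 : ℝ) < d := by exact_mod_cast Nat.pos_of_ne_zero hd
  have hUpos : ∀ y, 0 < U y := fun y => by
    obtain ⟨q, hq⟩ := exists_ne y
    exact (h q).pos y hq.symm
  have hcont : ContinuousOn U (sphere 0 1) := h0.cont.mono fun y hy => by
    rintro rfl; simp at hy
  obtain ⟨y0, -, hy0⟩ := (isCompact_sphere (0 : E) 1).exists_isMinOn
    ((NormedSpace.sphere_nonempty (E := E)).mpr zero_le_one) hcont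
  have hstart : ∃ C > 0, ∀ y : E, 1 ≤ ‖y‖ → C * ‖y‖ ^ (-((d : ℝ) / 2)) ≤ U y := by
    refine ⟨U y0, hUpos _, fun y hy => ?_⟩
    have hyp : 0 < ‖y‖ := by linarith
    have hsph : ∀ z : E, ‖z‖ = 1 → U y0 ≤ U z := fun z hz => hy0 (by simpa using hz)
    rcases hy.eq_or_lt with hy1 | hy1
    · rw [← hy1]; simpa using hsph y hy1.symm
    · have hs : (Real.sqrt ‖y‖) ^ 2 = ‖y‖ := Real.sq_sqrt hyp.le
      have hs0 : 0 < Real.sqrt ‖y‖ := Real.sqrt_pos.mpr hyp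
      have hlt : Real.sqrt ‖y‖ < ‖y‖ := by
        by_contra hc
        nlinarith
      obtain ⟨q, hq⟩ := NormedSpace.exists_lt_norm ℝ E ‖y‖
      have key := (h q).kelvin_le hd hs0 (hlt.trans hq) hlt (by rintro rfl; exact lt_irrefl _ hq)
      have hn : ‖invPt (Real.sqrt ‖y‖) y‖ = 1 := by
        rw [norm_invPt _ (norm_pos_iff.mp hyp), hs, div_self hyp.ne']
      have e : (Real.sqrt ‖y‖ / ‖y‖) ^ d = ‖y‖ ^ (-((d : ℝ) / 2)) := by
        rw [Real.sqrt_eq_rpow]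
        nth_rewrite 2 [← Real.rpow_one ‖y‖]
        rw [← Real.rpow_sub hyp, ← Real.rpow_natCast, ← Real.rpow_mul hyp.le]
        ring_nf
      rw [kelvin, e] at key
      refine le_trans ?_ key
      rw [mul_comm]
      gcongr
      exact hsph _ hn
  have hiter : ∀ k : ℕ, ∃ C > 0, ∀ y : E, 1 ≤ ‖y‖ →
      C * ‖y‖ ^ (-(4 / (p - 1) - p ^ k * (4 / (p - 1) - (d : ℝ) / 2))) ≤ U y := by
    intro k
    induction k with
    | zero => simpa using hstart
    | succ k ih =>
      have := h0.exists_rpow_lower_bound_succ (by simp) ih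
      have e : p * (4 / (p - 1) - p ^ k * (4 / (p - 1) - (d : ℝ) / 2)) - 4 =
          4 / (p - 1) - p ^ (k + 1) * (4 / (p - 1) - (d : ℝ) / 2) := by
        have : p - 1 ≠ 0 := by linarith
        field_simp
        ring
      rwa [e] at this
  have hgap : 0 < 4 / (p - 1) - (d : ℝ) / 2 := by
    have hs := h0.subcrit
    rw [sub_pos, lt_div_iff₀ (by linarith)]
    nlinarith
  have hlim : Tendsto (fun k : ℕ => p ^ k * (4 / (p - 1) - (d : ℝ) / 2)) atTop atTop :=
    (tendsto_pow_atTop_atTop_of_one_lt hp).atTop_mul_const hgap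
  obtain ⟨k, hk⟩ := (hlim.eventually_gt_atTop (4 / (p - 1))).exists
  obtain ⟨C, hC, hle⟩ := hiter k
  set s := -(4 / (p - 1) - p ^ k * (4 / (p - 1) - (d : ℝ) / 2)) with hs
  have hs0 : 0 < s := by rw [hs]; linarith
  have hlim2 : Tendsto (fun r : ℝ => C * r ^ s) atTop atTop :=
    (tendsto_rpow_atTop hs0).const_mul_atTop hC
  obtain ⟨r, hr, hr1⟩ := ((hlim2.eventually_gt_atTop M).and (eventually_ge_atTop 1)).exists
  obtain ⟨y, hy⟩ := NormedSpace.exists_lt_norm ℝ E r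
  have h1 := hle y (hr1.trans hy.le)
  have h2 : C * r ^ s ≤ C * ‖y‖ ^ s := by gcongr
  linarith [hM y]

/-- A positive solution with an isolated singularity at the origin is radially symmetric. -/
theorem radial (hd : d ≠ 0) (h : IsPotential d p κ c (0 : E) U) {z z' : E} (hz : z ≠ 0)
    (hzz : ‖z‖ = ‖z'‖) : U z = U z' := by
  suffices H : ∀ z z' : E, z ≠ 0 → ‖z‖ = ‖z'‖ → U z ≤ U z' by
    have hz' : z' ≠ 0 := norm_ne_zero_iff.mp (hzz ▸ norm_ne_zero_iff.mpr hz)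
    exact le_antisymm (H z z' hz hzz) (H z' z hz' hzz.symm)
  intro z z' hz hzz
  rcases eq_or_ne z z' with rfl | hne
  · rfl
  have hz0 : 0 < ‖z‖ := norm_pos_iff.mpr hz
  have hz'0 : z' ≠ 0 := norm_ne_zero_iff.mp (hzz ▸ norm_ne_zero_iff.mpr hz)
  set D := ‖z' - z‖ with hD
  have hD0 : 0 < D := norm_pos_iff.mpr (sub_ne_zero.mpr hne.symm)
  set θ : E := D⁻¹ • (z' - z) with hθ
  have hθ1 : ‖θ‖ = 1 := by
    rw [hθ, norm_smul, norm_inv, Real.norm_of_nonneg hD0.le, ← hD, inv_mul_cancel₀ hD0.ne']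
  have hinner : inner ℝ z θ = - D / 2 := by
    have : D ^ 2 = ‖z'‖ ^ 2 - 2 * inner ℝ z' z + ‖z‖ ^ 2 := by rw [hD, @norm_sub_sq_real]
    rw [hθ, real_inner_smul_right, inner_sub_right, real_inner_self_eq_norm_sq,
      real_inner_comm]
    rw [← hzz] at this
    field_simp
    linarith
  have hDθ : D • θ = z' - z := by rw [hθ, smul_smul, mul_inv_cancel₀ hD0.ne', one_smul]
  have key : ∀ a : ℝ, 0 < a → (a / (a + D)) ^ d * U z ≤ U z' := by
    intro a ha
    have hx := h.translate (z - a • θ)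
    have hnx : ‖(0 : E) - (z - a • θ)‖ ^ 2 = ‖z‖ ^ 2 + a * D + a ^ 2 := by
      rw [zero_sub, norm_neg, @norm_sub_sq_real, real_inner_smul_right, hinner, norm_smul, hθ1,
        Real.norm_of_nonneg ha.le]
      ring
    have hs : (Real.sqrt (a * (a + D))) ^ 2 = a * (a + D) := Real.sq_sqrt (by positivity)
    have hs0 : 0 < Real.sqrt (a * (a + D)) := Real.sqrt_pos.mpr (by positivity)
    have hny : ‖(a + D) • θ‖ = a + D := by
      rw [norm_smul, hθ1, Real.norm_of_nonneg (by positivity), mul_one]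
    have hyx : (a + D) • θ + (z - a • θ) = z' := by
      rw [add_smul, hDθ]; abel
    have h1 := hx.kelvin_le hd hs0 (y := (a + D) • θ)
      (by
        rw [← sq_lt_sq₀ hs0.le (norm_nonneg _), hs, hnx]
        nlinarith)
      (by
        rw [hny, ← sq_lt_sq₀ hs0.le (by positivity), hs]
        nlinarith)
      (by
        rw [Ne, eq_sub_iff_add_eq, hyx]
        exact hz'0)
    have hinv : invPt (Real.sqrt (a * (a + D))) ((a + D) • θ) + (z - a • θ) = z := by
      rw [invPt, hny, div_pow, hs, smul_smul]
      have : a * (a + D) / (a + D) ^ 2 * (a + D) = a := by field_simp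
      rw [this]; abel
    rw [kelvin, hinv, hyx, hny] at h1
    refine le_trans ?_ h1
    have hUz := (h.pos z hz).le
    have : a ≤ Real.sqrt (a * (a + D)) := Real.le_sqrt_of_sq_le (by nlinarith)
    gcongr
  have hlim : Tendsto (fun a : ℝ => (a / (a + D)) ^ d * U z) atTop (nhds (U z)) := by
    have h1 : Tendsto (fun a : ℝ => 1 - D / (a + D)) atTop (nhds (1 - 0)) :=
      tendsto_const_nhds.sub ((tendsto_atTop_add_const_right atTop D tendsto_id).const_div_atTop D)
    have h2 : Tendsto (fun a : ℝ => a / (a + D)) atTop (nhds 1) := by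
      rw [sub_zero] at h1
      refine h1.congr' ?_
      filter_upwards [eventually_gt_atTop 0] with a ha
      have : a + D ≠ 0 := by positivity
      field_simp
      ring
    simpa using (h2.pow d).mul_const (U z)
  exact le_of_tendsto hlim ((eventually_gt_atTop 0).mono key)

end IsPotential

end Liouville

section LimitLemma

variable {E : Type*} [NormedAddCommGroup E] [InnerProductSpace ℝ E] [FiniteDimensional ℝ E]
  [MeasurableSpace E] [BorelSpace E]

lemma abs_inv_pow_sub_inv_pow_le (d : ℕ) {a b : ℝ} (ha : 0 ≤ a) (hb : 0 ≤ b) :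
    |(a ^ d)⁻¹ - (b ^ d)⁻¹| ≤ d * |a - b| * ((a ^ (d + 1))⁻¹ + (b ^ (d + 1))⁻¹) := by
  wlog hab : a ≤ b generalizing a b
  · have := this hb ha (by linarith)
    rw [abs_sub_comm, abs_sub_comm a b, add_comm]; exact this
  rcases Nat.eq_zero_or_pos d with rfl | hd
  · simp
  have hd1 : (1 : ℝ) ≤ d := by exact_mod_cast hd
  rcases ha.eq_or_lt with rfl | ha
  · rcases hb.eq_or_lt with rfl | hb
    · simp
    rw [zero_pow hd.ne', zero_pow (Nat.succ_ne_zero d), inv_zero, zero_sub, zero_sub, abs_neg,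
      abs_neg, abs_of_pos hb, abs_of_pos (by positivity), zero_add, pow_succ, mul_inv]
    field_simp
    exact hd1
  have hb : 0 < b := ha.trans_le hab
  have h1 : b ^ d - a ^ d ≤ (b - a) * d * b ^ (d - 1) := by
    have := abs_pow_sub_pow_le b a d
    rw [abs_of_nonneg (by linarith : 0 ≤ b - a), abs_of_pos ha, abs_of_pos hb,
      max_eq_left hab] at this
    exact (le_abs_self _).trans this
  have h0 : (b ^ d)⁻¹ ≤ (a ^ d)⁻¹ := by gcongr
  rw [abs_of_nonneg (by linarith), abs_of_nonpos (by linarith : a - b ≤ 0)]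
  have h2 : (a ^ d)⁻¹ - (b ^ d)⁻¹ = (b ^ d - a ^ d) * ((a ^ d)⁻¹ * (b ^ d)⁻¹) := by
    field_simp
  calc (a ^ d)⁻¹ - (b ^ d)⁻¹ ≤ ((b - a) * d * b ^ (d - 1)) * ((a ^ d)⁻¹ * (b ^ d)⁻¹) := by
        rw [h2]; gcongr
    _ = (b - a) * d * ((a ^ d)⁻¹ * b⁻¹) := by
        obtain ⟨m, rfl⟩ : ∃ m, d = m + 1 := ⟨d - 1, by omega⟩
        rw [Nat.add_sub_cancel]
        field_simp
        ring
    _ ≤ (b - a) * d * ((a ^ d)⁻¹ * a⁻¹) := by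
        have : 0 ≤ b - a := by linarith
        gcongr
    _ = d * -(a - b) * (a ^ (d + 1))⁻¹ := by rw [pow_succ, mul_inv]; ring
    _ ≤ _ := by
        have : 0 ≤ -(a - b) := by linarith
        gcongr
        exact le_add_of_nonneg_right (by positivity)

lemma abs_ker_sub_ker_le (d : ℕ) (y y' z : E) :
    |(‖y - z‖ ^ d)⁻¹ - (‖y' - z‖ ^ d)⁻¹| ≤
      d * ‖y - y'‖ * ((‖y - z‖ ^ (d + 1))⁻¹ + (‖y' - z‖ ^ (d + 1))⁻¹) := by
  refine (abs_inv_pow_sub_inv_pow_le d (norm_nonneg _) (norm_nonneg _)).trans ?_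
  have : |‖y - z‖ - ‖y' - z‖| ≤ ‖y - y'‖ := by
    simpa using abs_norm_sub_norm_le (y - z) (y' - z)
  gcongr

/-- Locally uniform bounds for Riesz potentials of densities that are locally integrable, and
bounded near the base point. -/
lemma exists_setIntegral_ker_mul_le {m j : ℕ} (hj : 0 < j) (hE : Module.finrank ℝ E = m + j)
    {g : E → ℝ} (hg0 : ∀ z, 0 ≤ g z) (hg : ∀ R, IntegrableOn g (ball 0 R)) {y0 : E} {r A : ℝ}
    (hr : 0 < r) (hA : ∀ z ∈ ball y0 (2 * r), g z ≤ A) (R : ℝ) :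
    ∃ M : ℝ, 0 ≤ M ∧ ∀ y ∈ ball y0 r, IntegrableOn (fun z => (‖y - z‖ ^ m)⁻¹ * g z) (ball 0 R) ∧
      ∫ z in ball 0 R, (‖y - z‖ ^ m)⁻¹ * g z ≤ M := by
  obtain ⟨C, hC, hCb⟩ := exists_integral_ball_inv_pow_le hj hE
  have hA0 : 0 ≤ A := (hg0 y0).trans (hA y0 (mem_ball_self (by linarith)))
  have hgR : 0 ≤ ∫ z in ball 0 R, g z := integral_nonneg hg0
  refine ⟨A * (C * r ^ j) + (r ^ m)⁻¹ * ∫ z in ball 0 R, g z, by positivity, fun y hy => ?_⟩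
  obtain ⟨hi, hb⟩ := hCb y r hr
  set G : E → ℝ := fun z => (ball y r).indicator (fun z => A * (‖y - z‖ ^ m)⁻¹) z +
    (r ^ m)⁻¹ * g z with hG
  have hle : ∀ z, (‖y - z‖ ^ m)⁻¹ * g z ≤ G z := by
    intro z
    by_cases hz : z ∈ ball y r
    · have hzA : g z ≤ A := hA z (by
        rw [mem_ball] at hz hy ⊢
        linarith [dist_triangle z y y0])
      simp only [hG, Set.indicator_of_mem hz]
      have h1 : (‖y - z‖ ^ m)⁻¹ * g z ≤ A * (‖y - z‖ ^ m)⁻¹ := by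
        rw [mul_comm]; gcongr
      have : 0 ≤ (r ^ m)⁻¹ * g z := mul_nonneg (by positivity) (hg0 z)
      linarith
    · simp only [hG, Set.indicator_of_notMem hz, zero_add]
      rw [mem_ball, dist_comm, dist_eq_norm, not_lt] at hz
      have := hg0 z
      gcongr
  have hi1 : Integrable ((ball y r).indicator (fun z => A * (‖y - z‖ ^ m)⁻¹)) :=
    (integrable_indicator_iff measurableSet_ball).mpr (hi.const_mul A)
  have hGi : IntegrableOn G (ball 0 R) := hi1.integrableOn.add ((hg R).const_mul _)
  have hmeas : AEStronglyMeasurable (fun z => (‖y - z‖ ^ m)⁻¹ * g z)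
      (volume.restrict (ball 0 R)) := by
    refine AEStronglyMeasurable.mul ?_ (hg R).aestronglyMeasurable
    exact (by fun_prop : Measurable fun z => (‖y - z‖ ^ m)⁻¹).aestronglyMeasurable
  have hI : IntegrableOn (fun z => (‖y - z‖ ^ m)⁻¹ * g z) (ball 0 R) := by
    refine Integrable.mono' hGi hmeas (Eventually.of_forall fun z => ?_)
    rw [Real.norm_of_nonneg (mul_nonneg (by positivity) (hg0 z))]
    exact hle z
  refine ⟨hI, (integral_mono hI hGi hle).trans ?_⟩
  rw [hG, integral_add hi1.integrableOn ((hg R).const_mul _), integral_const_mul]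
  gcongr
  calc _ ≤ ∫ z, (ball y r).indicator (fun z => A * (‖y - z‖ ^ m)⁻¹) z :=
        setIntegral_le_integral hi1 (Eventually.of_forall fun z =>
          Set.indicator_nonneg (fun z _ => by positivity) z)
    _ = A * ∫ z in ball y r, (‖y - z‖ ^ m)⁻¹ := by
        rw [integral_indicator measurableSet_ball, integral_const_mul]
    _ ≤ A * (C * r ^ j) := by gcongr

/-- The tail of a Riesz potential oscillates little. -/
lemma abs_tail_sub_tail_le (d : ℕ) {f : E → ℝ} (hf : ∀ z, 0 ≤ f z) {y y' : E} {R : ℝ} (hR : 0 < R)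
    (hy : ‖y‖ ≤ R / 2) (hy' : ‖y'‖ ≤ R / 2)
    (hi : Integrable fun z => (‖y - z‖ ^ d)⁻¹ * f z)
    (hi' : Integrable fun z => (‖y' - z‖ ^ d)⁻¹ * f z) :
    |(∫ z in (ball 0 R)ᶜ, (‖y - z‖ ^ d)⁻¹ * f z) - ∫ z in (ball 0 R)ᶜ, (‖y' - z‖ ^ d)⁻¹ * f z| ≤
      d * ‖y - y'‖ * (2 / R) *
        ((∫ z, (‖y - z‖ ^ d)⁻¹ * f z) + ∫ z, (‖y' - z‖ ^ d)⁻¹ * f z) := by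
  have key : ∀ x : E, ‖x‖ ≤ R / 2 → ∀ z ∈ (ball (0 : E) R)ᶜ,
      (‖x - z‖ ^ (d + 1))⁻¹ ≤ (2 / R) * (‖x - z‖ ^ d)⁻¹ := by
    intro x hx z hz
    rw [Set.mem_compl_iff, mem_ball_zero_iff, not_lt] at hz
    have : R / 2 ≤ ‖x - z‖ := by
      have := norm_sub_norm_le z x
      rw [norm_sub_rev] at this; linarith
    rw [pow_succ, mul_inv, mul_comm]
    gcongr
    rw [show 2 / R = (R / 2)⁻¹ by rw [inv_div]]
    gcongr
  have h0 : ∀ x : E, ∀ z, 0 ≤ (‖x - z‖ ^ d)⁻¹ * f z := fun x z =>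
    mul_nonneg (by positivity) (hf z)
  rw [← integral_sub hi.integrableOn hi'.integrableOn, ← Real.norm_eq_abs]
  calc _ ≤ ∫ z in (ball 0 R)ᶜ, d * ‖y - y'‖ * (2 / R) *
          ((‖y - z‖ ^ d)⁻¹ * f z + (‖y' - z‖ ^ d)⁻¹ * f z) := by
        refine norm_integral_le_of_norm_le ((hi.integrableOn.add hi'.integrableOn).const_mul _) ?_
        refine (ae_restrict_iff' measurableSet_ball.compl).mpr (Eventually.of_forall fun z hz => ?_)
        rw [← sub_mul, norm_mul, Real.norm_of_nonneg (hf z), Real.norm_eq_abs, ← add_mul,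
          ← mul_assoc]
        refine mul_le_mul_of_nonneg_right ?_ (hf z)
        refine (abs_ker_sub_ker_le d y y' z).trans ?_
        have h1 := key y hy z hz
        have h2 := key y' hy' z hz
        rw [mul_assoc (d * ‖y - y'‖), mul_add (2 / R)]
        gcongr
    _ ≤ ∫ z, d * ‖y - y'‖ * (2 / R) * ((‖y - z‖ ^ d)⁻¹ * f z + (‖y' - z‖ ^ d)⁻¹ * f z) := by
        refine setIntegral_le_integral ((hi.add hi').const_mul _) (Eventually.of_forall fun z => ?_)
        exact mul_nonneg (by positivity) (add_nonneg (h0 y z) (h0 y' z))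
    _ = _ := by rw [integral_const_mul, integral_add hi hi']

/-- Lipschitz estimate for a Riesz potential whose density is dominated by `g` on a ball. -/
lemma abs_potential_sub_potential_le (d : ℕ) {f g : E → ℝ} (hf : ∀ z, 0 ≤ f z) {y y' : E}
    {R M : ℝ} (hR : 0 < R) (hy : ‖y‖ ≤ R / 2) (hy' : ‖y'‖ ≤ R / 2)
    (hi : Integrable fun z => (‖y - z‖ ^ d)⁻¹ * f z)
    (hi' : Integrable fun z => (‖y' - z‖ ^ d)⁻¹ * f z)
    (hfg : ∀ᵐ z ∂(volume.restrict (ball 0 R)), f z ≤ g z)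
    (hg : IntegrableOn (fun z => (‖y - z‖ ^ (d + 1))⁻¹ * g z) (ball 0 R))
    (hg' : IntegrableOn (fun z => (‖y' - z‖ ^ (d + 1))⁻¹ * g z) (ball 0 R))
    (hM : ∫ z in ball 0 R, (‖y - z‖ ^ (d + 1))⁻¹ * g z ≤ M)
    (hM' : ∫ z in ball 0 R, (‖y' - z‖ ^ (d + 1))⁻¹ * g z ≤ M) :
    |(∫ z, (‖y - z‖ ^ d)⁻¹ * f z) - ∫ z, (‖y' - z‖ ^ d)⁻¹ * f z| ≤
      d * ‖y - y'‖ * (2 * M + (2 / R) *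
        ((∫ z, (‖y - z‖ ^ d)⁻¹ * f z) + ∫ z, (‖y' - z‖ ^ d)⁻¹ * f z)) := by
  have htail := abs_tail_sub_tail_le d hf hR hy hy' hi hi'
  have hnear : |(∫ z in ball 0 R, (‖y - z‖ ^ d)⁻¹ * f z) -
      ∫ z in ball 0 R, (‖y' - z‖ ^ d)⁻¹ * f z| ≤ d * ‖y - y'‖ * (2 * M) := by
    rw [← integral_sub hi.integrableOn hi'.integrableOn, ← Real.norm_eq_abs]
    calc _ ≤ ∫ z in ball 0 R, d * ‖y - y'‖ *
            ((‖y - z‖ ^ (d + 1))⁻¹ * g z + (‖y' - z‖ ^ (d + 1))⁻¹ * g z) := by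
          refine norm_integral_le_of_norm_le ((hg.add hg').const_mul _) ?_
          filter_upwards [hfg] with z hz
          rw [← sub_mul, norm_mul, Real.norm_of_nonneg (hf z), Real.norm_eq_abs, ← add_mul,
            ← mul_assoc]
          exact mul_le_mul (abs_ker_sub_ker_le d y y' z) hz (hf z) (by positivity)
      _ = d * ‖y - y'‖ * ((∫ z in ball 0 R, (‖y - z‖ ^ (d + 1))⁻¹ * g z) +
            ∫ z in ball 0 R, (‖y' - z‖ ^ (d + 1))⁻¹ * g z) := by
          rw [integral_const_mul, integral_add hg hg']
      _ ≤ _ := by gcongr; linarith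
  rw [← integral_add_compl (measurableSet_ball (x := (0 : E)) (ε := R)) hi,
    ← integral_add_compl (measurableSet_ball (x := (0 : E)) (ε := R)) hi'] at *
  rw [add_sub_add_comm]
  refine (abs_add_le _ _).trans ((add_le_add hnear htail).trans (le_of_eq ?_))
  ring

end LimitLemma

/-- Arzelà–Ascoli for asymptotically equi-Lipschitz sequences of functions. -/
lemma exists_subseq_tendsto_of_asymptotically_lipschitz {X : Type*} [PseudoMetricSpace X]
    [TopologicalSpace.SeparableSpace X] {Ω : Set X} {w : ℕ → X → ℝ} {e : ℕ → ℝ}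
    (he : Tendsto e atTop (nhds 0))
    (h : ∀ y0 ∈ Ω, ∃ r > 0, ∃ L, 0 ≤ L ∧ ∃ B, ∀ᶠ k in atTop,
      (∀ y ∈ ball y0 r ∩ Ω, |w k y| ≤ B) ∧
        ∀ y ∈ ball y0 r ∩ Ω, ∀ y' ∈ ball y0 r ∩ Ω, |w k y - w k y'| ≤ L * dist y y' + e k)
    (hΩ : IsOpen Ω) :
    ∃ φ : ℕ → ℕ, StrictMono φ ∧ ∃ v : X → ℝ, ContinuousOn v Ω ∧
      ∀ y ∈ Ω, ∀ ys : ℕ → X, Tendsto ys atTop (nhds y) →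
        Tendsto (fun k => w (φ k) (ys k)) atTop (nhds (v y)) := by
  rcases isEmpty_or_nonempty X with hX | hX
  · exact ⟨id, strictMono_id, fun _ => 0, continuousOn_const, fun y => hX.elim y⟩
  choose! r hr L hL B hB using h
  set q := TopologicalSpace.denseSeq X
  set S : Set (ℕ → ℝ) := Set.pi Set.univ fun i => Set.Icc (-|B (q i)|) |B (q i)|
  have hS : IsSeqCompact S := (isCompact_univ_pi fun i => isCompact_Icc).isSeqCompact
  obtain ⟨a, -, φ, hφ, ha⟩ := hS (x := fun k i =>
      max (-|B (q i)|) (min (w k (q i)) |B (q i)|)) fun k i _ =>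
    ⟨le_max_left _ _, max_le (by linarith [abs_nonneg (B (q i))]) (min_le_right _ _)⟩
  have hq : ∀ i, q i ∈ Ω → Tendsto (fun k => w (φ k) (q i)) atTop (nhds (a i)) := by
    intro i hi
    refine ((tendsto_pi_nhds.mp ha) i).congr' ?_
    filter_upwards [hφ.tendsto_atTop.eventually (hB (q i) hi)] with k hk
    have h1 := (hk.1 (q i) ⟨mem_ball_self (hr _ hi), hi⟩).trans (le_abs_self _)
    rw [abs_le] at h1
    simp only [Function.comp]
    rw [min_eq_left h1.2, max_eq_right h1.1]
  have heφ : Tendsto (fun k => e (φ k)) atTop (nhds 0) := he.comp hφ.tendsto_atTop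
  have hcau : ∀ y ∈ Ω, CauchySeq fun k => w (φ k) y := by
    intro y hy
    rw [Metric.cauchySeq_iff']
    intro ε hε
    obtain ⟨s, hs, hsΩ⟩ := Metric.isOpen_iff.mp hΩ y hy
    set ρ := min (min (r y) s) (ε / (8 * (L y + 1)))
    have hLy := hL y hy
    have hρ : 0 < ρ := lt_min (lt_min (hr y hy) hs) (by positivity)
    obtain ⟨i, hi⟩ := (TopologicalSpace.denseRange_denseSeq X).exists_dist_lt y hρ
    have hi' : dist (q i) y < ρ := by rw [dist_comm]; exact hi
    have hiΩ : q i ∈ Ω := hsΩ (hi'.trans_le ((min_le_left _ _).trans (min_le_right _ _)))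
    have hir : q i ∈ ball y (r y) := hi'.trans_le ((min_le_left _ _).trans (min_le_left _ _))
    have hLd : L y * dist y (q i) ≤ ε / 8 := by
      have h1 : dist y (q i) ≤ ε / (8 * (L y + 1)) := hi.le.trans (min_le_right _ _)
      calc _ ≤ (L y + 1) * (ε / (8 * (L y + 1))) := by gcongr; linarith
        _ = ε / 8 := by field_simp
    have hev : ∀ᶠ k in atTop, |w (φ k) y - a i| < ε / 2 := by
      filter_upwards [hφ.tendsto_atTop.eventually (hB y hy), heφ.eventually_lt_const
        (show 0 < ε / 8 by positivity),
        (Metric.tendsto_nhds.mp (hq i hiΩ)) (ε / 8) (by positivity)] with k h1 h2 h3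
      have h4 := h1.2 y ⟨mem_ball_self (hr y hy), hy⟩ (q i) ⟨hir, hiΩ⟩
      rw [Real.dist_eq] at h3
      have := abs_sub_le (w (φ k) y) (w (φ k) (q i)) (a i)
      linarith
    obtain ⟨N, hN⟩ := eventually_atTop.mp hev
    refine ⟨N, fun k hk => ?_⟩
    have h1 := hN k hk
    have h2 := hN N le_rfl
    rw [Real.dist_eq]
    have := abs_sub_le (w (φ k) y) (a i) (w (φ N) y)
    rw [abs_sub_comm (a i)] at this
    linarith
  have hlim : ∀ y, ∃ v, y ∈ Ω → Tendsto (fun k => w (φ k) y) atTop (nhds v) := by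
    intro y
    by_cases hy : y ∈ Ω
    · obtain ⟨v, hv⟩ := cauchySeq_tendsto_of_complete (hcau y hy)
      exact ⟨v, fun _ => hv⟩
    · exact ⟨0, fun h => absurd h hy⟩
  choose v hv using hlim
  refine ⟨φ, hφ, v, ?_, ?_⟩
  · intro y hy
    have hLy := hL y hy
    rw [ContinuousWithinAt, Metric.tendsto_nhdsWithin_nhds]
    intro ε hε
    refine ⟨min (r y) (ε / (L y + 1)), lt_min (hr y hy) (by positivity), fun x hx hxy => ?_⟩
    have hxr : x ∈ ball y (r y) := hxy.trans_le (min_le_left _ _)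
    have h1 : |v x - v y| ≤ L y * dist x y + 0 := by
      refine le_of_tendsto_of_tendsto (((hv x hx).sub (hv y hy)).abs)
        (tendsto_const_nhds.add heφ) ?_
      filter_upwards [hφ.tendsto_atTop.eventually (hB y hy)] with k hk
      exact hk.2 x ⟨hxr, hx⟩ y ⟨mem_ball_self (hr y hy), hy⟩
    have h2 := hxy.trans_le (min_le_right _ _)
    rw [lt_div_iff₀ (by positivity)] at h2
    rw [Real.dist_eq]
    nlinarith [dist_nonneg (x := x) (y := y)]
  · intro y hy ys hys
    have h1 : Tendsto (fun k => w (φ k) (ys k) - w (φ k) y) atTop (nhds 0) := by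
      have h3 : Tendsto (fun k => L y * dist (ys k) y + e (φ k)) atTop (nhds 0) := by
        have := ((tendsto_iff_dist_tendsto_zero.mp hys).const_mul (L y)).add heφ
        simpa using this
      refine squeeze_zero_norm' ?_ h3
      filter_upwards [hφ.tendsto_atTop.eventually (hB y hy), hys.eventually (hΩ.mem_nhds hy),
        hys.eventually (ball_mem_nhds y (hr y hy))] with k hk h4 h5
      exact hk.2 (ys k) ⟨h5, h4⟩ y ⟨mem_ball_self (hr y hy), hy⟩
    have := h1.add (hv y hy)
    simpa using this

section LimitLemma

variable {E : Type*} [NormedAddCommGroup E] [InnerProductSpace ℝ E] [FiniteDimensional ℝ E]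
  [MeasurableSpace E] [BorelSpace E]

/-- Locally bounded sequences of approximate Riesz potentials subconverge to a Riesz potential. -/
theorem exists_subseq_tendsto_potential {d : ℕ} (hE : Module.finrank ℝ E = d + 4) {p κ : ℝ}
    (hp : 1 < p) (hκ : 0 < κ) {Z : Set E} (hZ : IsClosed Z) (hZ0 : volume Z = 0) {W : E → ℝ}
    (hW0 : ∀ z, 0 ≤ W z) (hWi : ∀ R, IntegrableOn (fun z => W z ^ p) (ball 0 R))
    (hWb : ∀ y0, y0 ∉ Z → ∃ r > 0, ∃ A, ∀ z ∈ ball y0 r, W z ≤ A)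
    {w : ℕ → E → ℝ} (hw0 : ∀ k y, 0 ≤ w k y) (hwm : ∀ k, Measurable (w k))
    {e : ℕ → ℝ} (he : Tendsto e atTop (nhds 0))
    (hw : ∀ R, ∀ᶠ k in atTop, ∀ y ∈ ball (0 : E) R, y ∉ Z → w k y ≤ W y ∧
      Integrable (fun z => (‖y - z‖ ^ d)⁻¹ * w k z ^ p) ∧
      |w k y - κ * ∫ z, (‖y - z‖ ^ d)⁻¹ * w k z ^ p| ≤ e k) :
    ∃ φ : ℕ → ℕ, StrictMono φ ∧ ∃ (v : E → ℝ) (c : ℝ), 0 ≤ c ∧ (∀ y, 0 ≤ v y) ∧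
      ContinuousOn v Zᶜ ∧
      (∀ y, y ∉ Z → ∀ ys : ℕ → E, Tendsto ys atTop (nhds y) →
        Tendsto (fun k => w (φ k) (ys k)) atTop (nhds (v y))) ∧
      (∀ y, y ∉ Z → v y ≤ W y) ∧
      ∀ y, y ∉ Z → Integrable (fun z => (‖y - z‖ ^ d)⁻¹ * v z ^ p) ∧
        v y = κ * (∫ z, (‖y - z‖ ^ d)⁻¹ * v z ^ p) + c := by
  have hp0 : 0 < p := by linarith
  have hWp0 : ∀ z, 0 ≤ W z ^ p := fun z => Real.rpow_nonneg (hW0 z) p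
  have hwp0 : ∀ k z, 0 ≤ w k z ^ p := fun k z => Real.rpow_nonneg (hw0 k z) p
  have hloc : ∀ y0, y0 ∉ Z → ∃ r > 0, ∃ A, 0 ≤ A ∧ (∀ z ∈ ball y0 (2 * r), W z ≤ A) ∧
      ∀ z ∈ ball y0 (2 * r), W z ^ p ≤ A ^ p := by
    intro y0 hy0
    obtain ⟨r, hr, A, hA⟩ := hWb y0 hy0
    have hA' : ∀ z ∈ ball y0 (2 * (r / 2)), W z ≤ A := fun z hz => hA z (by
      rwa [show 2 * (r / 2) = r by ring] at hz)
    refine ⟨r / 2, by positivity, A, (hW0 y0).trans (hA y0 (mem_ball_self hr)), hA', ?_⟩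
    exact fun z hz => Real.rpow_le_rpow (hW0 z) (hA' z hz) hp0.le
  have hZae : ∀ᵐ z : E, z ∉ Z := measure_eq_zero_iff_ae_notMem.mp hZ0
  have hwW : ∀ R, ∀ᶠ k in atTop, ∀ᵐ z ∂(volume.restrict (ball (0 : E) R)), w k z ^ p ≤ W z ^ p := by
    intro R
    filter_upwards [hw R] with k hk
    filter_upwards [ae_restrict_mem measurableSet_ball, ae_restrict_of_ae hZae] with z hz hzZ
    exact Real.rpow_le_rpow (hw0 k z) (hk z hz hzZ).1 hp0.le
  have hlip : ∀ y0 ∈ Zᶜ, ∃ r > 0, ∃ L, 0 ≤ L ∧ ∃ B, ∀ᶠ k in atTop,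
      (∀ y ∈ ball y0 r ∩ Zᶜ, |w k y| ≤ B) ∧
        ∀ y ∈ ball y0 r ∩ Zᶜ, ∀ y' ∈ ball y0 r ∩ Zᶜ,
          |w k y - w k y'| ≤ L * dist y y' + 2 * e k := by
    intro y0 hy0
    obtain ⟨r, hr, A, hA0, hA, hAp⟩ := hloc y0 hy0
    set R := 2 * (‖y0‖ + r) with hR
    have hR0 : 0 < R := by positivity
    obtain ⟨M, hM0, hM⟩ := exists_setIntegral_ker_mul_le (m := d + 1) (j := 3) (by norm_num)
      (by omega) hWp0 hWi hr hAp R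
    refine ⟨r, hr, d * (κ * (2 * M) + 2 / R * (2 * A + 2)), by positivity, A, ?_⟩
    have hin : ∀ y ∈ ball y0 r, ‖y‖ ≤ R / 2 := by
      intro y hy
      rw [mem_ball, dist_eq_norm] at hy
      have := norm_sub_norm_le y y0
      rw [hR]; linarith
    filter_upwards [hw R, hwW R, he.eventually_lt_const one_pos] with k hk hk2 hk3
    have hA' : ∀ y ∈ ball y0 r, W y ≤ A := fun y hy => hA y (ball_subset_ball (by linarith) hy)
    have hR' : ∀ y ∈ ball y0 r, y ∈ ball (0 : E) R := fun y hy => by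
      rw [mem_ball_zero_iff]; linarith [hin y hy]
    refine ⟨fun y hy => ?_, fun y hy y' hy' => ?_⟩
    · rw [abs_of_nonneg (hw0 k y)]
      exact (hk y (hR' y hy.1) hy.2).1.trans (hA' y hy.1)
    · obtain ⟨a1, a2, a3⟩ := hk y (hR' y hy.1) hy.2
      obtain ⟨b1, b2, b3⟩ := hk y' (hR' y' hy'.1) hy'.2
      have a4 := a1.trans (hA' y hy.1)
      have b4 := b1.trans (hA' y' hy'.1)
      have key := abs_potential_sub_potential_le d (hwp0 k) hR0 (hin y hy.1) (hin y' hy'.1) a2 b2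
        hk2 (hM y hy.1).1 (hM y' hy'.1).1 (hM y hy.1).2 (hM y' hy'.1).2
      set I := ∫ z, (‖y - z‖ ^ d)⁻¹ * w k z ^ p
      set I' := ∫ z, (‖y' - z‖ ^ d)⁻¹ * w k z ^ p
      rw [abs_le] at a3 b3
      have hI : κ * I + κ * I' ≤ 2 * A + 2 := by linarith
      have h5 : |κ * I - κ * I'| ≤ d * dist y y' * (κ * (2 * M) + 2 / R * (2 * A + 2)) := by
        rw [← mul_sub, abs_mul, abs_of_pos hκ, dist_eq_norm]
        calc κ * |I - I'| ≤ κ * (d * ‖y - y'‖ * (2 * M + 2 / R * (I + I'))) := by gcongr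
          _ = d * ‖y - y'‖ * (κ * (2 * M) + 2 / R * (κ * I + κ * I')) := by ring
          _ ≤ _ := by gcongr
      have h6 : |w k y - w k y'| ≤ |κ * I - κ * I'| + 2 * e k := by
        rw [abs_le]
        constructor
        · linarith [neg_abs_le (κ * I - κ * I')]
        · linarith [le_abs_self (κ * I - κ * I')]
      linarith
  have he2 : Tendsto (fun k => 2 * e k) atTop (nhds 0) := by simpa using he.const_mul 2
  obtain ⟨φ, hφ, v0, hv0c, hv0t⟩ :=
    exists_subseq_tendsto_of_asymptotically_lipschitz he2 hlip hZ.isOpen_compl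
  set v : E → ℝ := Zᶜ.indicator v0 with hv
  have hvv : ∀ y, y ∉ Z → v y = v0 y := fun y hy => Set.indicator_of_mem hy _
  have hvc : ContinuousOn v Zᶜ := hv0c.congr fun y hy => hvv y hy
  have hvt : ∀ y, y ∉ Z → ∀ ys : ℕ → E, Tendsto ys atTop (nhds y) →
      Tendsto (fun k => w (φ k) (ys k)) atTop (nhds (v y)) := by
    intro y hy ys hys
    rw [hvv y hy]; exact hv0t y hy ys hys
  have hvt' : ∀ y, y ∉ Z → Tendsto (fun k => w (φ k) y) atTop (nhds (v y)) := fun y hy =>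
    hvt y hy _ tendsto_const_nhds
  have hvnn : ∀ y, 0 ≤ v y := by
    intro y
    by_cases hy : y ∈ Z
    · rw [hv, Set.indicator_of_notMem (by simpa using hy)]
    · exact ge_of_tendsto' (hvt' y hy) fun k => hw0 _ _
  have hwφ : ∀ R, ∀ᶠ k in atTop, ∀ y ∈ ball (0 : E) R, y ∉ Z → w (φ k) y ≤ W y ∧
      Integrable (fun z => (‖y - z‖ ^ d)⁻¹ * w (φ k) z ^ p) ∧
      |w (φ k) y - κ * ∫ z, (‖y - z‖ ^ d)⁻¹ * w (φ k) z ^ p| ≤ e (φ k) := fun R =>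
    hφ.tendsto_atTop.eventually (hw R)
  have heφ : Tendsto (fun k => e (φ k)) atTop (nhds 0) := he.comp hφ.tendsto_atTop
  have hmemb : ∀ y : E, y ∈ ball (0 : E) (‖y‖ + 1) := fun y => by simp
  have hvW : ∀ y, y ∉ Z → v y ≤ W y := by
    intro y hy
    refine le_of_tendsto (hvt' y hy) ?_
    filter_upwards [hwφ (‖y‖ + 1)] with k hk
    exact (hk y (hmemb y) hy).1
  have hker : ∀ y : E, Measurable fun z => (‖y - z‖ ^ d)⁻¹ := fun y => by fun_prop
  have hvp0 : ∀ z, 0 ≤ v z ^ p := fun z => Real.rpow_nonneg (hvnn z) p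
  have hkv0 : ∀ y z, 0 ≤ (‖y - z‖ ^ d)⁻¹ * v z ^ p := fun y z => mul_nonneg (by positivity) (hvp0 z)
  have hWk : ∀ y, y ∉ Z → ∀ R, IntegrableOn (fun z => (‖y - z‖ ^ d)⁻¹ * W z ^ p) (ball 0 R) := by
    intro y hy R
    obtain ⟨r, hr, A, hA0, hA, hAp⟩ := hloc y hy
    obtain ⟨M, hM0, hM⟩ := exists_setIntegral_ker_mul_le (m := d) (j := 4) (by norm_num)
      hE hWp0 hWi hr hAp R
    exact (hM y (mem_ball_self hr)).1
  have hvmeas : AEStronglyMeasurable v volume := by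
    refine aestronglyMeasurable_of_tendsto_ae atTop (f := fun k => w (φ k))
      (fun k => (hwm _).aestronglyMeasurable) ?_
    filter_upwards [hZae] with z hz using hvt' z hz
  have hvpmeas : AEStronglyMeasurable (fun z => v z ^ p) volume :=
    (hvmeas.aemeasurable.pow_const p).aestronglyMeasurable
  have hvi : ∀ y, y ∉ Z → ∀ R, IntegrableOn (fun z => (‖y - z‖ ^ d)⁻¹ * v z ^ p) (ball 0 R) := by
    intro y hy R
    refine Integrable.mono' (hWk y hy R)
      ((hker y).aestronglyMeasurable.mul hvpmeas).restrict ?_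
    filter_upwards [ae_restrict_of_ae hZae] with z hz
    rw [Real.norm_of_nonneg (hkv0 y z)]
    have := Real.rpow_le_rpow (hvnn z) (hvW z hz) hp0.le
    gcongr
  have hconv : ∀ y, y ∉ Z → ∀ R, Tendsto
      (fun k => ∫ z in ball 0 R, (‖y - z‖ ^ d)⁻¹ * w (φ k) z ^ p) atTop
      (nhds (∫ z in ball 0 R, (‖y - z‖ ^ d)⁻¹ * v z ^ p)) := by
    intro y hy R
    refine tendsto_integral_filter_of_dominated_convergence
      (fun z => (‖y - z‖ ^ d)⁻¹ * W z ^ p) ?_ ?_ (hWk y hy R) ?_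
    · exact Eventually.of_forall fun k =>
        ((hker y).mul ((hwm _).pow_const p)).aestronglyMeasurable
    · filter_upwards [hφ.tendsto_atTop.eventually (hwW R)] with k hk
      filter_upwards [hk] with z hz
      rw [Real.norm_of_nonneg (mul_nonneg (by positivity) (hwp0 _ z))]
      gcongr
    · filter_upwards [ae_restrict_of_ae hZae] with z hz
      exact ((hvt' z hz).rpow_const (Or.inr hp0.le)).const_mul _
  have hTconv : ∀ y, y ∉ Z → ∀ R, Tendsto
      (fun k => w (φ k) y - κ * ∫ z in ball 0 R, (‖y - z‖ ^ d)⁻¹ * w (φ k) z ^ p) atTop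
      (nhds (v y - κ * ∫ z in ball 0 R, (‖y - z‖ ^ d)⁻¹ * v z ^ p)) := fun y hy R =>
    (hvt' y hy).sub ((hconv y hy R).const_mul κ)
  have hkw0 : ∀ k y z, 0 ≤ (‖y - z‖ ^ d)⁻¹ * w k z ^ p := fun k y z =>
    mul_nonneg (by positivity) (hwp0 k z)
  have hT0 : ∀ y, y ∉ Z → ∀ R, 0 ≤ v y - κ * ∫ z in ball 0 R, (‖y - z‖ ^ d)⁻¹ * v z ^ p := by
    intro y hy R
    have h1 : Tendsto (fun k => - e (φ k)) atTop (nhds 0) := by simpa using heφ.neg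
    refine le_of_tendsto_of_tendsto h1 (hTconv y hy R) ?_
    filter_upwards [hwφ (‖y‖ + 1)] with k hk
    obtain ⟨-, h2, h3⟩ := hk y (hmemb y) hy
    have h4 : ∫ z in ball 0 R, (‖y - z‖ ^ d)⁻¹ * w (φ k) z ^ p ≤
        ∫ z, (‖y - z‖ ^ d)⁻¹ * w (φ k) z ^ p :=
      setIntegral_le_integral h2 (Eventually.of_forall (hkw0 _ y))
    have h5 := mul_le_mul_of_nonneg_left h4 hκ.le
    rw [abs_le] at h3
    linarith
  have hTosc : ∀ y, y ∉ Z → ∀ y', y' ∉ Z → ∀ R, 0 < R → ‖y‖ ≤ R / 2 → ‖y'‖ ≤ R / 2 →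
      |(v y - κ * ∫ z in ball 0 R, (‖y - z‖ ^ d)⁻¹ * v z ^ p) -
        (v y' - κ * ∫ z in ball 0 R, (‖y' - z‖ ^ d)⁻¹ * v z ^ p)| ≤
        d * ‖y - y'‖ * (v y + v y') * (2 / R) := by
    intro y hy y' hy' R hR hyR hyR'
    have h1 : Tendsto (fun k => 2 * e (φ k) + d * ‖y - y'‖ * (w (φ k) y + w (φ k) y' + 2 * e (φ k)) *
        (2 / R)) atTop (nhds (2 * 0 + d * ‖y - y'‖ * (v y + v y' + 2 * 0) * (2 / R))) :=
      (heφ.const_mul 2).add (((((hvt' y hy).add (hvt' y' hy')).add (heφ.const_mul 2)).const_mul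
        _).mul_const _)
    rw [mul_zero, zero_add, add_zero] at h1
    refine le_of_tendsto_of_tendsto ((hTconv y hy R).sub (hTconv y' hy' R)).abs h1 ?_
    filter_upwards [hwφ (‖y‖ + 1), hwφ (‖y'‖ + 1)] with k hk hk'
    obtain ⟨-, a2, a3⟩ := hk y (hmemb y) hy
    obtain ⟨-, b2, b3⟩ := hk' y' (hmemb y') hy'
    have key := abs_tail_sub_tail_le d (hwp0 (φ k)) hR hyR hyR' a2 b2
    rw [← integral_add_compl (measurableSet_ball (x := (0 : E)) (ε := R)) a2] at a3 key
    rw [← integral_add_compl (measurableSet_ball (x := (0 : E)) (ε := R)) b2] at b3 key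
    set I := ∫ z in ball 0 R, (‖y - z‖ ^ d)⁻¹ * w (φ k) z ^ p
    set J := ∫ z in (ball 0 R)ᶜ, (‖y - z‖ ^ d)⁻¹ * w (φ k) z ^ p
    set I' := ∫ z in ball 0 R, (‖y' - z‖ ^ d)⁻¹ * w (φ k) z ^ p
    set J' := ∫ z in (ball 0 R)ᶜ, (‖y' - z‖ ^ d)⁻¹ * w (φ k) z ^ p
    have key2 : |κ * J - κ * J'| ≤
        d * ‖y - y'‖ * (w (φ k) y + w (φ k) y' + 2 * e (φ k)) * (2 / R) := by
      rw [abs_le] at a3 b3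
      rw [← mul_sub, abs_mul, abs_of_pos hκ]
      calc κ * |J - J'| ≤ κ * (d * ‖y - y'‖ * (2 / R) * (I + J + (I' + J'))) := by gcongr
        _ = d * ‖y - y'‖ * (κ * (I + J) + κ * (I' + J')) * (2 / R) := by ring
        _ ≤ _ := by
          refine mul_le_mul_of_nonneg_right (mul_le_mul_of_nonneg_left ?_ (by positivity))
            (by positivity)
          linarith
    rw [abs_le] at a3 b3 key2 ⊢
    constructor <;> nlinarith
  have hcov : AECover (volume : Measure E) atTop (fun R : ℝ => ball (0 : E) R) :=
    aecover_ball tendsto_id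
  have hvint : ∀ y, y ∉ Z → Integrable (fun z => (‖y - z‖ ^ d)⁻¹ * v z ^ p) := by
    intro y hy
    refine hcov.integrable_of_integral_bounded_of_nonneg_ae (v y / κ) (hvi y hy)
      (Eventually.of_forall (hkv0 y)) (Eventually.of_forall fun R => ?_)
    rw [le_div_iff₀ hκ]
    linarith [hT0 y hy R]
  have hTlim : ∀ y, y ∉ Z → Tendsto
      (fun R => v y - κ * ∫ z in ball 0 R, (‖y - z‖ ^ d)⁻¹ * v z ^ p) atTop
      (nhds (v y - κ * ∫ z, (‖y - z‖ ^ d)⁻¹ * v z ^ p)) := fun y hy =>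
    tendsto_const_nhds.sub ((hcov.integral_tendsto_of_countably_generated (hvint y hy)).const_mul κ)
  have hconst : ∀ y, y ∉ Z → ∀ y', y' ∉ Z → v y - κ * ∫ z, (‖y - z‖ ^ d)⁻¹ * v z ^ p =
      v y' - κ * ∫ z, (‖y' - z‖ ^ d)⁻¹ * v z ^ p := by
    intro y hy y' hy'
    rw [← sub_eq_zero, ← abs_nonpos_iff]
    have h2 : Tendsto (fun R : ℝ => d * ‖y - y'‖ * (v y + v y') * (2 / R)) atTop (nhds 0) := by
      have : Tendsto (fun R : ℝ => 2 / R) atTop (nhds 0) := tendsto_const_nhds.div_atTop tendsto_id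
      simpa using this.const_mul (d * ‖y - y'‖ * (v y + v y'))
    refine le_of_tendsto_of_tendsto ((hTlim y hy).sub (hTlim y' hy')).abs h2 ?_
    filter_upwards [eventually_gt_atTop 0, eventually_ge_atTop (2 * ‖y‖),
      eventually_ge_atTop (2 * ‖y'‖)] with R h3 h4 h5
    exact hTosc y hy y' hy' R h3 (by linarith) (by linarith)
  rcases Set.eq_empty_or_nonempty Zᶜ with hne | ⟨y1, hy1⟩
  · have : ∀ y : E, y ∈ Z := fun y => by
      by_contra h
      exact (Set.eq_empty_iff_forall_notMem.mp hne) y h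
    exact ⟨φ, hφ, v, 0, le_rfl, hvnn, hvc, hvt, hvW, fun y hy => absurd (this y) hy⟩
  · refine ⟨φ, hφ, v, v y1 - κ * ∫ z, (‖y1 - z‖ ^ d)⁻¹ * v z ^ p, ?_, hvnn, hvc, hvt, hvW,
      fun y hy => ⟨hvint y hy, ?_⟩⟩
    · exact ge_of_tendsto' (hTlim y1 hy1) (hT0 y1 hy1)
    · rw [hconst y1 hy1 y hy]; ring

/-- A limit potential either vanishes or is positive. -/
lemma potential_eq_zero_or_pos {d : ℕ} {p κ c : ℝ} (hκ : 0 < κ) (hc : 0 ≤ c)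
    {Z : Set E} (hZ : IsClosed Z) {v : E → ℝ} (hv0 : ∀ y, 0 ≤ v y)
    (hvc : ContinuousOn v Zᶜ)
    (hv : ∀ y, y ∉ Z → Integrable (fun z => (‖y - z‖ ^ d)⁻¹ * v z ^ p) ∧
        v y = κ * (∫ z, (‖y - z‖ ^ d)⁻¹ * v z ^ p) + c) :
    (∀ y, y ∉ Z → v y = 0) ∨ ∀ y, y ∉ Z → 0 < v y := by
  by_contra! hcon
  obtain ⟨⟨y1, hy1, hvy1⟩, y2, hy2, hvy2⟩ := hcon
  have hnn : ∀ z, 0 ≤ (‖y2 - z‖ ^ d)⁻¹ * v z ^ p := fun z =>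
    mul_nonneg (by positivity) (Real.rpow_nonneg (hv0 z) p)
  obtain ⟨hi, heq⟩ := hv y2 hy2
  have hI : 0 ≤ ∫ z, (‖y2 - z‖ ^ d)⁻¹ * v z ^ p := integral_nonneg hnn
  have hI0 : ∫ z, (‖y2 - z‖ ^ d)⁻¹ * v z ^ p = 0 := by
    have : 0 ≤ κ * ∫ z, (‖y2 - z‖ ^ d)⁻¹ * v z ^ p := by positivity
    have h3 : κ * ∫ z, (‖y2 - z‖ ^ d)⁻¹ * v z ^ p = 0 := by linarith
    exact (mul_eq_zero.mp h3).resolve_left hκ.ne'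
  rw [integral_eq_zero_iff_of_nonneg hnn hi] at hI0
  have hopen : IsOpen (Zᶜ ∩ v ⁻¹' {0}ᶜ) :=
    hvc.isOpen_inter_preimage hZ.isOpen_compl isOpen_compl_singleton
  have h0 : volume (Zᶜ ∩ v ⁻¹' {0}ᶜ) = 0 := by
    rcases subsingleton_or_nontrivial E with hs | hs
    · rw [Subsingleton.elim y1 y2] at hvy1
      exact absurd (le_antisymm hvy2 (hv0 y2)) hvy1
    refine measure_mono_null (t := {y2} ∪ {z | ¬ (‖y2 - z‖ ^ d)⁻¹ * v z ^ p = 0}) ?_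
      (measure_union_null (measure_singleton y2) (ae_iff.mp hI0))
    intro z hz
    by_cases hzy : z = y2
    · exact Or.inl hzy
    · right
      have hz2 : v z ≠ 0 := hz.2
      have h4 : 0 < v z := lt_of_le_of_ne (hv0 z) (Ne.symm hz2)
      have h5 : 0 < ‖y2 - z‖ := norm_pos_iff.mpr (sub_ne_zero.mpr (Ne.symm hzy))
      have : 0 < (‖y2 - z‖ ^ d)⁻¹ * v z ^ p := by positivity
      exact this.ne'
  have := hopen.measure_pos volume ⟨y1, hy1, hvy1⟩
  exact this.ne' h0

end LimitLemma

section UpperBound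

variable {E : Type*} [NormedAddCommGroup E] [InnerProductSpace ℝ E] [FiniteDimensional ℝ E]
  [MeasurableSpace E] [BorelSpace E]

/-- `U` agrees, up to a bounded error and near an isolated singularity at the origin, with the
Riesz potential of `κ Uᵖ`, in the range `n / (n - 4) < p < (n + 4) / (n - 4)` for `n = d + 4`. -/
structure IsSingularPotential (d : ℕ) (p κ C ρ : ℝ) (U : E → ℝ) : Prop where
  finrank : Module.finrank ℝ E = d + 4
  d_ne_zero : d ≠ 0
  one_lt : 1 < p
  supercrit : d + 4 < p * d
  subcrit : p * d < d + 8
  kappa_pos : 0 < κ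
  rho_pos : 0 < ρ
  meas : Measurable U
  nonneg : ∀ x, 0 ≤ U x
  cont : ContinuousOn U (ball 0 ρ \ {0})
  approx : ∀ x ∈ ball (0 : E) ρ \ {0}, Integrable (fun z => (‖x - z‖ ^ d)⁻¹ * U z ^ p) ∧
    |U x - κ * ∫ z, (‖x - z‖ ^ d)⁻¹ * U z ^ p| ≤ C

/-- Scaling of Riesz potentials. -/
lemma rescale_potential {d : ℕ} (hE : Module.finrank ℝ E = d + 4) {p : ℝ} (hp : 1 < p)
    {U : E → ℝ} (hU : ∀ x, 0 ≤ U x) (a : E) {μ : ℝ} (hμ : 0 < μ) (y : E)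
    (hi : Integrable (fun z => (‖(a + μ • y) - z‖ ^ d)⁻¹ * U z ^ p)) :
    Integrable (fun z => (‖y - z‖ ^ d)⁻¹ * (μ ^ (4 / (p - 1)) * U (a + μ • z)) ^ p) ∧
      ∫ z, (‖y - z‖ ^ d)⁻¹ * (μ ^ (4 / (p - 1)) * U (a + μ • z)) ^ p =
        μ ^ (4 / (p - 1)) * ∫ z, (‖(a + μ • y) - z‖ ^ d)⁻¹ * U z ^ p := by
  set F : E → ℝ := fun z => (‖(a + μ • y) - z‖ ^ d)⁻¹ * U z ^ p with hF
  have hp1 : p - 1 ≠ 0 := by linarith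
  have hpt : ∀ z, (‖y - z‖ ^ d)⁻¹ * (μ ^ (4 / (p - 1)) * U (a + μ • z)) ^ p =
      (μ ^ (4 / (p - 1)) * μ ^ (d + 4)) * F (a + μ • z) := by
    intro z
    rw [hF]
    dsimp only
    rw [show a + μ • y - (a + μ • z) = μ • (y - z) by module, norm_smul, Real.norm_of_nonneg hμ.le,
      Real.mul_rpow (by positivity) (hU _), ← Real.rpow_mul hμ.le,
      show 4 / (p - 1) * p = 4 / (p - 1) + 4 by field_simp; ring, Real.rpow_add hμ,
      show μ ^ (4 : ℝ) = μ ^ 4 by norm_cast, mul_pow, mul_inv, pow_add]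
    field_simp
  have hFi : Integrable (fun z => F (a + μ • z)) :=
    (hi.comp_add_left a).comp_smul hμ.ne'
  simp_rw [hpt]
  refine ⟨hFi.const_mul _, ?_⟩
  rw [integral_const_mul, Measure.integral_comp_smul_of_nonneg volume (fun z => F (a + z)) μ
    (hR := hμ.le), integral_add_left_eq_self F a, hE, smul_eq_mul]
  field_simp

lemma IsSingularPotential.rescale {d : ℕ} {p κ C ρ : ℝ} {U : E → ℝ}
    (h : IsSingularPotential d p κ C ρ U) {a : E} {μ : ℝ} (hμ : 0 < μ) {y : E}
    (hy : a + μ • y ∈ ball (0 : E) ρ \ {0}) :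
    Integrable (fun z => (‖y - z‖ ^ d)⁻¹ * (μ ^ (4 / (p - 1)) * U (a + μ • z)) ^ p) ∧
      |μ ^ (4 / (p - 1)) * U (a + μ • y) -
        κ * ∫ z, (‖y - z‖ ^ d)⁻¹ * (μ ^ (4 / (p - 1)) * U (a + μ • z)) ^ p| ≤
          C * μ ^ (4 / (p - 1)) := by
  obtain ⟨h1, h2⟩ := h.approx _ hy
  obtain ⟨h3, h4⟩ := rescale_potential h.finrank h.one_lt h.nonneg a hμ y h1
  refine ⟨h3, ?_⟩
  rw [h4, mul_left_comm, ← mul_sub, abs_mul, abs_of_pos (by positivity), mul_comm C]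
  gcongr

lemma IsSingularPotential.exists_doubling {d : ℕ} {p κ C ρ : ℝ} {U : E → ℝ}
    (h : IsSingularPotential d p κ C ρ U) {x : E} (hx0 : x ≠ 0) (hx : ‖x‖ < ρ / 2) {N : ℝ}
    (hN : 0 < N) (hxN : N ^ (4 / (p - 1)) < U x * (‖x‖ / 2) ^ (4 / (p - 1))) :
    ∃ (a : E) (μ : ℝ), 0 < μ ∧ μ * N ≤ ‖x‖ ∧ μ ^ (4 / (p - 1)) * U a = 1 ∧
      ∀ y : E, ‖y‖ ≤ N / 2 → a + μ • y ∈ ball (0 : E) ρ \ {0} ∧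
        μ ^ (4 / (p - 1)) * U (a + μ • y) ≤ 2 ^ (4 / (p - 1)) := by
  have hp1 : 0 < p - 1 := by linarith [h.one_lt]
  set τ := 4 / (p - 1) with hτ
  have hτ0 : 0 < τ := by positivity
  have hxpos : 0 < ‖x‖ := norm_pos_iff.mpr hx0
  have hsub : ∀ z ∈ closedBall x (‖x‖ / 2), z ∈ ball (0 : E) ρ \ {0} := by
    intro z hz
    rw [mem_closedBall, dist_eq_norm] at hz
    refine ⟨?_, ?_⟩
    · rw [mem_ball_zero_iff]
      have := norm_sub_norm_le z x
      linarith
    · rintro rfl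
      rw [zero_sub, norm_neg] at hz; linarith
  have hgc : ContinuousOn (fun z => U z * (‖x‖ / 2 - ‖z - x‖) ^ τ) (closedBall x (‖x‖ / 2)) :=
    (h.cont.mono hsub).mul (ContinuousOn.rpow_const (by fun_prop) fun z _ => Or.inr hτ0.le)
  obtain ⟨a, ha, hmax⟩ := (isCompact_closedBall x (‖x‖ / 2)).exists_isMaxOn
    ⟨x, mem_closedBall_self (by positivity)⟩ hgc
  have hga : N ^ τ < U a * (‖x‖ / 2 - ‖a - x‖) ^ τ := by
    have := hmax (mem_closedBall_self (by positivity : 0 ≤ ‖x‖ / 2))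
    simp only [Set.mem_ofPred_eq, sub_self, norm_zero, sub_zero] at this
    linarith
  set σ := ‖x‖ / 2 - ‖a - x‖ with hσ
  have hσ0 : 0 ≤ σ := by
    rw [mem_closedBall, dist_eq_norm] at ha; linarith
  have hNτ : 0 < N ^ τ := by positivity
  have hσpos : 0 < σ := by
    rcases hσ0.eq_or_lt with h0 | h0
    · rw [← h0, Real.zero_rpow hτ0.ne', mul_zero] at hga; linarith
    · exact h0
  have hUa : 0 < U a := by
    rcases (h.nonneg a).eq_or_lt with h0 | h0
    · rw [← h0, zero_mul] at hga; linarith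
    · exact h0
  set μ := U a ^ (-τ⁻¹) with hμ
  have hμ0 : 0 < μ := by positivity
  have hμτ : μ ^ τ = (U a)⁻¹ := by
    rw [hμ, ← Real.rpow_mul hUa.le, neg_mul, inv_mul_cancel₀ hτ0.ne', Real.rpow_neg_one]
  have hμN : μ * N < σ := by
    rw [← Real.rpow_lt_rpow_iff (by positivity) hσ0 hτ0, Real.mul_rpow hμ0.le hN.le, hμτ,
      inv_mul_lt_iff₀ hUa]
    exact hga
  refine ⟨a, μ, hμ0, ?_, ?_, fun y hy => ?_⟩
  · have := norm_nonneg (a - x); linarith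
  · rw [hμτ, inv_mul_cancel₀ hUa.ne']
  · have h1 : ‖a + μ • y - x‖ ≤ ‖a - x‖ + σ / 2 := by
      calc _ = ‖(a - x) + μ • y‖ := by congr 1; abel
        _ ≤ ‖a - x‖ + ‖μ • y‖ := norm_add_le _ _
        _ ≤ _ := by
          rw [norm_smul, Real.norm_of_nonneg hμ0.le]
          nlinarith
    have hmem : a + μ • y ∈ closedBall x (‖x‖ / 2) := by
      rw [mem_closedBall, dist_eq_norm]; linarith
    refine ⟨hsub _ hmem, ?_⟩
    have h2 := hmax hmem
    simp only [Set.mem_ofPred_eq] at h2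
    rw [hμτ, inv_mul_le_iff₀ hUa]
    have h3 : U (a + μ • y) * (σ / 2) ^ τ ≤ U a * σ ^ τ := by
      refine le_trans ?_ h2
      have := h.nonneg (a + μ • y)
      gcongr
      linarith
    rw [Real.div_rpow hσ0 (by norm_num), ← mul_div_assoc, div_le_iff₀ (by positivity)] at h3
    have : 0 < σ ^ τ := by positivity
    nlinarith

/-- The a priori upper bound `U ≤ C' |x|^{-4/(p-1)}` near the singularity. -/
theorem IsSingularPotential.exists_upper_bound {d : ℕ} {p κ C ρ : ℝ} {U : E → ℝ}
    (h : IsSingularPotential d p κ C ρ U) :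
    ∃ (A r : ℝ), 0 < A ∧ 0 < r ∧ r ≤ ρ ∧
      ∀ x : E, x ≠ 0 → ‖x‖ < r → U x ≤ A * ‖x‖ ^ (-(4 / (p - 1))) := by
  have hp1 : 0 < p - 1 := by linarith [h.one_lt]
  set τ := 4 / (p - 1) with hτ
  have hτ0 : 0 < τ := by positivity
  by_contra! hcon
  have hstep : ∀ k : ℕ, ∃ (a : E) (μ : ℝ), 0 < μ ∧ μ * (k + 1) ≤ ρ ∧ μ ^ τ * U a = 1 ∧
      ∀ y : E, ‖y‖ ≤ ((k : ℝ) + 1) / 2 → a + μ • y ∈ ball (0 : E) ρ \ {0} ∧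
        μ ^ τ * U (a + μ • y) ≤ 2 ^ τ := by
    intro k
    obtain ⟨x, hx0, hx1, hx2⟩ := hcon ((2 * ((k : ℝ) + 1)) ^ τ) (ρ / 2) (by positivity)
      (by linarith [h.rho_pos]) (by linarith [h.rho_pos])
    have hxpos : 0 < ‖x‖ := norm_pos_iff.mpr hx0
    have hx3 : ((k : ℝ) + 1) ^ τ < U x * (‖x‖ / 2) ^ τ := by
      have h1 : (2 * ((k : ℝ) + 1)) ^ τ * ‖x‖ ^ (-τ) * (‖x‖ / 2) ^ τ = ((k : ℝ) + 1) ^ τ := by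
        rw [Real.rpow_neg hxpos.le, Real.div_rpow hxpos.le (by norm_num),
          Real.mul_rpow (by norm_num) (by positivity)]
        have : 0 < ‖x‖ ^ τ := by positivity
        have : 0 < (2 : ℝ) ^ τ := by positivity
        field_simp
      rw [← h1]
      gcongr
    obtain ⟨a, μ, h1, h2, h3, h4⟩ := h.exists_doubling hx0 hx1 (by positivity) hx3
    exact ⟨a, μ, h1, by linarith [h.rho_pos], h3, h4⟩
  choose a μ hμ hμk hone hball using hstep
  have hμlim : Tendsto (fun k => μ k) atTop (nhds 0) := by
    refine squeeze_zero (g := fun k : ℕ => ρ * (1 / ((k : ℝ) + 1))) (fun k => (hμ k).le)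
      (fun k => ?_) (by simpa using tendsto_one_div_add_atTop_nhds_zero_nat.const_mul ρ)
    rw [mul_one_div, le_div_iff₀ (by positivity)]
    exact hμk k
  have he : Tendsto (fun k => C * μ k ^ τ) atTop (nhds 0) := by
    have := (hμlim.rpow_const (p := τ) (Or.inr hτ0.le)).const_mul C
    rwa [Real.zero_rpow hτ0.ne', mul_zero] at this
  have h2τ : 0 < (2 : ℝ) ^ τ := by positivity
  obtain ⟨φ, hφ, v, c, hc, hv0, hvc, hvt, hvW, hveq⟩ := exists_subseq_tendsto_potential
    h.finrank h.one_lt h.kappa_pos (Z := ∅) isClosed_empty measure_empty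
    (W := fun _ => (2 : ℝ) ^ τ) (fun _ => h2τ.le)
    (fun R => integrableOn_const measure_ball_lt_top.ne)
    (fun y0 _ => ⟨1, one_pos, 2 ^ τ, fun z _ => le_rfl⟩)
    (w := fun k y => μ k ^ τ * U (a k + μ k • y))
    (fun k y => mul_nonneg (by have := hμ k; positivity) (h.nonneg _))
    (fun k => (h.meas.comp (by fun_prop)).const_mul _) he (by
      intro R
      filter_upwards [eventually_ge_atTop ⌈2 * R⌉₊] with k hk y hy _
      have h1 : ‖y‖ ≤ ((k : ℝ) + 1) / 2 := by
        rw [mem_ball_zero_iff] at hy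
        have := Nat.ceil_le.mp hk
        linarith
      obtain ⟨h2, h3⟩ := hball k y h1
      obtain ⟨h4, h5⟩ := h.rescale (hμ k) h2
      exact ⟨h3, h4, h5⟩)
  have hv1 : v 0 = 1 := by
    refine tendsto_nhds_unique (hvt 0 (by simp) (fun _ => 0) tendsto_const_nhds) ?_
    simp only [smul_zero, add_zero, hone]
    exact tendsto_const_nhds
  have hpos : ∀ y, 0 < v y := by
    rcases potential_eq_zero_or_pos h.kappa_pos hc isClosed_empty hv0 hvc hveq with h1 | h1
    · have := h1 0 (by simp); rw [hv1] at this; norm_num at this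
    · exact fun y => h1 y (by simp)
  refine IsPotential.not_bounded (d := d) (p := p) (κ := κ) (c := c) h.d_ne_zero
    (fun q => ⟨h.finrank, h.one_lt, h.subcrit, h.kappa_pos, hc, hvc.mono (by simp),
      fun y _ => hpos y, fun y _ => (hveq y (by simp)).1, fun y _ => (hveq y (by simp)).2⟩)
    (fun y => hvW y (by simp))

end UpperBound

section Oscillation

variable {E : Type*} [NormedAddCommGroup E] [InnerProductSpace ℝ E] [FiniteDimensional ℝ E]
  [MeasurableSpace E] [BorelSpace E]

/-- Sequences of points with asymptotically equal logarithms of norms see the same rescaled values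
of `U`. -/
lemma IsSingularPotential.exists_abs_sub_lt {d : ℕ} {p κ C ρ : ℝ} {U : E → ℝ}
    (h : IsSingularPotential d p κ C ρ U) {x x' : ℕ → E} (hx0 : ∀ k, x k ≠ 0)
    (hx : Tendsto x atTop (nhds 0))
    (hxx : Tendsto (fun k => ‖x' k‖ / ‖x k‖) atTop (nhds 1)) {ε : ℝ} (hε : 0 < ε) :
    ∃ k, |‖x k‖ ^ (4 / (p - 1)) * U (x k) - ‖x' k‖ ^ (4 / (p - 1)) * U (x' k)| < ε := by
  have hp1 : 0 < p - 1 := by linarith [h.one_lt]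
  have hp0 : 0 < p := by linarith
  obtain ⟨A, r, hA, hr, hrρ, hup⟩ := h.exists_upper_bound
  set τ := 4 / (p - 1) with hτ
  have hτ0 : 0 < τ := by positivity
  have hnx : ∀ k, 0 < ‖x k‖ := fun k => norm_pos_iff.mpr (hx0 k)
  set y : ℕ → E := fun k => ‖x k‖⁻¹ • x k with hy
  set y' : ℕ → E := fun k => ‖x k‖⁻¹ • x' k with hy'
  have hyn : ∀ k, ‖y k‖ = 1 := fun k => by
    rw [hy]; simp only [norm_smul, norm_inv, norm_norm, inv_mul_cancel₀ (hnx k).ne']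
  have hyn' : ∀ k, ‖y' k‖ = ‖x' k‖ / ‖x k‖ := fun k => by
    rw [hy']; simp only [norm_smul, norm_inv, norm_norm]; field_simp
  have hb : ∃ᶠ k in atTop, (y k, y' k) ∈ closedBall (0 : E × E) 2 := by
    refine Eventually.frequently ?_
    filter_upwards [hxx.eventually_le_const (show (1 : ℝ) < 2 by norm_num)] with k hk
    rw [mem_closedBall_zero_iff, Prod.norm_def, hyn, hyn']
    exact max_le (by norm_num) hk
  obtain ⟨⟨a, a'⟩, -, ψ, hψ, hlim⟩ := tendsto_subseq_of_frequently_bounded isBounded_closedBall hb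
  have hya : Tendsto (fun k => y (ψ k)) atTop (nhds a) := (continuous_fst.tendsto _).comp hlim
  have hya' : Tendsto (fun k => y' (ψ k)) atTop (nhds a') := (continuous_snd.tendsto _).comp hlim
  have hna : ‖a‖ = 1 := by
    refine tendsto_nhds_unique hya.norm ?_
    simp only [hyn]; exact tendsto_const_nhds
  have hna' : ‖a'‖ = 1 := by
    refine tendsto_nhds_unique hya'.norm ?_
    simp only [hyn']; exact hxx.comp hψ.tendsto_atTop
  have ha0 : a ≠ 0 := by rw [← norm_ne_zero_iff, hna]; norm_num
  have ha0' : a' ≠ 0 := by rw [← norm_ne_zero_iff, hna']; norm_num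
  set μ : ℕ → ℝ := fun k => ‖x (ψ k)‖ with hμ
  have hμ0 : ∀ k, 0 < μ k := fun k => hnx _
  have hμlim : Tendsto μ atTop (nhds 0) := by
    have := (hx.comp hψ.tendsto_atTop).norm
    simpa using this
  have he : Tendsto (fun k => C * μ k ^ τ) atTop (nhds 0) := by
    have := (hμlim.rpow_const (p := τ) (Or.inr hτ0.le)).const_mul C
    rwa [Real.zero_rpow hτ0.ne', mul_zero] at this
  have hfin : (Module.finrank ℝ E : ℝ) = d + 4 := by rw [h.finrank]; push_cast; ring
  have hd0 : (0 : ℝ) < d := by exact_mod_cast Nat.pos_of_ne_zero h.d_ne_zero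
  have hτp : τ * p < Module.finrank ℝ E := by
    rw [hfin, hτ, div_mul_eq_mul_div, div_lt_iff₀ hp1]
    have := h.supercrit
    nlinarith
  have hWp : ∀ z : E, (A * ‖z‖ ^ (-τ)) ^ p = A ^ p * ‖z‖ ^ (-(τ * p)) := fun z => by
    rw [Real.mul_rpow hA.le (by positivity), ← Real.rpow_mul (norm_nonneg z), neg_mul]
  have hvol : volume ({0} : Set E) = 0 := by
    have : Nontrivial E := nontrivial_of_ne a 0 ha0
    exact measure_singleton 0
  obtain ⟨φ, hφ, v, c, hc, hv0, hvc, hvt, hvW, hveq⟩ := exists_subseq_tendsto_potential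
    h.finrank h.one_lt h.kappa_pos (Z := {0}) isClosed_singleton hvol
    (W := fun z => A * ‖z‖ ^ (-τ)) (fun _ => by positivity)
    (fun R => by
      simp only [hWp]
      exact (integrableOn_ball_norm_rpow hτp R).const_mul _)
    (fun y0 hy0 => by
      have hy0' : 0 < ‖y0‖ := norm_pos_iff.mpr hy0
      refine ⟨‖y0‖ / 2, by positivity, A * (‖y0‖ / 2) ^ (-τ), fun z hz => ?_⟩
      have h1 : ‖y0‖ / 2 ≤ ‖z‖ := by
        rw [mem_ball, dist_eq_norm, norm_sub_rev] at hz
        have := norm_sub_norm_le y0 z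
        linarith
      have := Real.rpow_le_rpow_of_nonpos (by positivity) h1 (by linarith : -τ ≤ 0)
      gcongr)
    (w := fun k y => μ k ^ τ * U (0 + μ k • y))
    (fun k y => mul_nonneg (by have := hμ0 k; positivity) (h.nonneg _))
    (fun k => (h.meas.comp (by fun_prop)).const_mul _) he (by
      intro R
      have h1 : Tendsto (fun k => μ k * R) atTop (nhds 0) := by simpa using hμlim.mul_const R
      filter_upwards [h1.eventually_lt_const hr] with k hk z hz hz0
      rw [mem_ball_zero_iff] at hz
      have hz0' : 0 < ‖z‖ := norm_pos_iff.mpr hz0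
      have hn : ‖μ k • z‖ = μ k * ‖z‖ := by rw [norm_smul, Real.norm_of_nonneg (hμ0 k).le]
      have hn0 : μ k • z ≠ 0 := smul_ne_zero (hμ0 k).ne' hz0
      have hnr : ‖μ k • z‖ < r := by
        rw [hn]
        have := mul_le_mul_of_nonneg_left hz.le (hμ0 k).le
        linarith
      have h2 : (0 : E) + μ k • z ∈ ball (0 : E) ρ \ {0} := by
        rw [zero_add]
        exact ⟨by rw [mem_ball_zero_iff]; linarith, hn0⟩
      obtain ⟨h4, h5⟩ := h.rescale (hμ0 k) h2
      refine ⟨?_, h4, h5⟩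
      rw [zero_add]
      have h6 := hup _ hn0 hnr
      rw [hn, Real.mul_rpow (hμ0 k).le hz0'.le, Real.rpow_neg (hμ0 k).le] at h6
      have h7 : 0 < μ k ^ τ := Real.rpow_pos_of_pos (hμ0 k) _
      calc μ k ^ τ * U (μ k • z) ≤ μ k ^ τ * (A * ((μ k ^ τ)⁻¹ * ‖z‖ ^ (-τ))) := by gcongr
        _ = A * ‖z‖ ^ (-τ) := by field_simp)
  have hvaa : v a = v a' := by
    rcases potential_eq_zero_or_pos h.kappa_pos hc isClosed_singleton hv0 hvc hveq with h1 | h1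
    · rw [h1 a ha0, h1 a' ha0']
    · refine IsPotential.radial (d := d) (p := p) (κ := κ) (c := c) h.d_ne_zero
        ⟨h.finrank, h.one_lt, h.subcrit, h.kappa_pos, hc, hvc, fun y hy => h1 y hy,
          fun y hy => (hveq y hy).1, fun y hy => (hveq y hy).2⟩ ha0 (hna.trans hna'.symm)
  have l1 := hvt a ha0 _ (hya.comp hφ.tendsto_atTop)
  have l2 := hvt a' ha0' _ (hya'.comp hφ.tendsto_atTop)
  have l3 : Tendsto (fun k => ‖y' (ψ (φ k))‖ ^ τ) atTop (nhds 1) := by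
    have := ((hya'.comp hφ.tendsto_atTop).norm).rpow_const (p := τ) (Or.inr hτ0.le)
    rw [hna', Real.one_rpow] at this
    exact this
  have l4 := (l1.sub (l3.mul l2)).abs
  rw [hvaa, one_mul, sub_self, abs_zero] at l4
  obtain ⟨k, hk⟩ := (l4.eventually_lt_const hε).exists
  refine ⟨ψ (φ k), ?_⟩
  simp only [Function.comp, hμ, hy, hy', zero_add, smul_inv_smul₀ (hnx (ψ (φ k))).ne'] at hk
  rw [norm_smul, norm_inv, norm_norm, Real.mul_rpow (by positivity) (norm_nonneg _),
    Real.inv_rpow (norm_nonneg _)] at hk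
  have h7 : 0 < ‖x (ψ (φ k))‖ ^ τ := Real.rpow_pos_of_pos (hnx _) _
  rw [show (‖x (ψ (φ k))‖ ^ τ)⁻¹ * ‖x' (ψ (φ k))‖ ^ τ * (‖x (ψ (φ k))‖ ^ τ * U (x' (ψ (φ k)))) =
    ‖x' (ψ (φ k))‖ ^ τ * U (x' (ψ (φ k))) by field_simp] at hk
  exact hk

/-- The rescaled function `|x|^{4/(p-1)} U(x)` oscillates little on thin dyadic shells close to the
singularity. -/
theorem IsSingularPotential.exists_oscillation_le {d : ℕ} {p κ C ρ : ℝ} {U : E → ℝ}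
    (h : IsSingularPotential d p κ C ρ U) {ε : ℝ} (hε : 0 < ε) :
    ∃ δ > 0, ∃ r > 0, ∀ x x' : E, x ≠ 0 → x' ≠ 0 → ‖x‖ < r → ‖x'‖ < r →
      |Real.log ‖x‖ - Real.log ‖x'‖| ≤ δ →
      |‖x‖ ^ (4 / (p - 1)) * U x - ‖x'‖ ^ (4 / (p - 1)) * U x'| < ε := by
  by_contra! hcon
  have hstep : ∀ k : ℕ, ∃ x x' : E, x ≠ 0 ∧ x' ≠ 0 ∧ ‖x‖ < 1 / ((k : ℝ) + 1) ∧
      |Real.log ‖x‖ - Real.log ‖x'‖| ≤ 1 / ((k : ℝ) + 1) ∧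
      ε ≤ |‖x‖ ^ (4 / (p - 1)) * U x - ‖x'‖ ^ (4 / (p - 1)) * U x'| := by
    intro k
    obtain ⟨x, x', h1, h2, h3, h4, h5, h6⟩ := hcon (1 / ((k : ℝ) + 1)) (by positivity)
      (1 / ((k : ℝ) + 1)) (by positivity)
    exact ⟨x, x', h1, h2, h3, h5, h6⟩
  choose x x' hx0 hx0' hx hlog hge using hstep
  have hlim : Tendsto x atTop (nhds 0) := by
    rw [tendsto_zero_iff_norm_tendsto_zero]
    exact squeeze_zero (fun k => norm_nonneg _) (fun k => (hx k).le)
      tendsto_one_div_add_atTop_nhds_zero_nat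
  have hl0 : Tendsto (fun k => Real.log ‖x' k‖ - Real.log ‖x k‖) atTop (nhds 0) := by
    refine squeeze_zero_norm (fun k => ?_) tendsto_one_div_add_atTop_nhds_zero_nat
    rw [Real.norm_eq_abs, abs_sub_comm]; exact hlog k
  have hxx : Tendsto (fun k => ‖x' k‖ / ‖x k‖) atTop (nhds 1) := by
    have := (Real.continuous_exp.tendsto 0).comp hl0
    rw [Real.exp_zero] at this
    refine this.congr fun k => ?_
    have h1 : 0 < ‖x k‖ := norm_pos_iff.mpr (hx0 k)
    have h2 : 0 < ‖x' k‖ := norm_pos_iff.mpr (hx0' k)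
    rw [Function.comp, Real.exp_sub, Real.exp_log h1, Real.exp_log h2]
  obtain ⟨k, hk⟩ := h.exists_abs_sub_lt hx0 hlim hxx hε
  exact absurd hk (not_lt.mpr (hge k))

end Oscillation

section Interpolation

lemma abs_deriv_le_of_abs_le {f f1 f2 : ℝ → ℝ} {T A B h : ℝ} (hf : ∀ t > T, HasDerivAt f (f1 t) t)
    (hf1 : ∀ t > T, HasDerivAt f1 (f2 t) t) (hA : ∀ t > T, |f t| ≤ A) (hB : ∀ t > T, |f2 t| ≤ B)
    (hh : 0 < h) {t : ℝ} (ht : T < t) : |f1 t| ≤ 2 * A / h + h * B := by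
  have hB0 : 0 ≤ B := (abs_nonneg _).trans (hB t ht)
  obtain ⟨ξ, hξ, hs⟩ := exists_hasDerivAt_eq_slope f f1 (show t < t + h by linarith)
    (fun s hs => (hf s (ht.trans_le hs.1)).continuousAt.continuousWithinAt)
    (fun s hs => hf s (ht.trans hs.1))
  have h1 : |f1 ξ| ≤ 2 * A / h := by
    rw [hs, abs_div, show t + h - t = h by ring, abs_of_pos hh]
    gcongr
    have := abs_sub (f (t + h)) (f t)
    linarith [hA (t + h) (by linarith), hA t ht]
  have h2 : |f1 t - f1 ξ| ≤ B * |t - ξ| := by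
    have := Convex.norm_image_sub_le_of_norm_hasDerivWithin_le (f := f1) (f' := f2) (s := Set.Ioi T)
      (C := B) (x := ξ) (y := t) (fun s hs => (hf1 s hs).hasDerivWithinAt) (fun s hs => hB s hs)
      (convex_Ioi T) (ht.trans hξ.1) ht
    simpa [Real.norm_eq_abs] using this
  have h3 : |t - ξ| ≤ h := by
    rw [abs_le]; constructor <;> linarith [hξ.1, hξ.2]
  have h4 : B * |t - ξ| ≤ B * h := by gcongr
  have := abs_sub_abs_le_abs_sub (f1 t) (f1 ξ)
  linarith

lemma interpolation_absorb {Λ : ℝ} (hΛ : 1 ≤ Λ) : ∃ K : ℝ, 0 ≤ K ∧ ∀ X0 X1 X2 X3 X4 F : ℝ,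
    0 ≤ X0 → 0 ≤ X1 → 0 ≤ X2 → 0 ≤ X3 → 0 ≤ X4 → 0 ≤ F →
    (∀ h > 0, X1 ≤ 2 * X0 / h + h * X2) → (∀ h > 0, X2 ≤ 2 * X1 / h + h * X3) →
    (∀ h > 0, X3 ≤ 2 * X2 / h + h * X4) → X4 ≤ Λ * (X0 + X1 + X2 + X3) + F →
    X1 + X2 + X3 + X4 ≤ K * (X0 + F) := by
  set h : ℝ := 1 / (12 * Λ) with hh
  have hh0 : 0 < h := by positivity
  have hh1 : h ≤ 1 := by
    rw [hh, div_le_one (by positivity)]; linarith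
  have hhΛ : Λ * h = 1 / 12 := by rw [hh]; field_simp
  have hi1 : 1 ≤ 1 / h := by rw [le_div_iff₀ hh0]; linarith
  set c2 : ℝ := 43 * 256 * (1 / h) ^ 2
  set c3 : ℝ := 43 * 1024 * (1 / h) ^ 3
  refine ⟨2 + 4 * c2 + 4 * c3 + 8 * (Λ * (3 + 2 * c2 + 2 * c3) + 1), by positivity, ?_⟩
  intro X0 X1 X2 X3 X4 F hX0 hX1 hX2 hX3 hX4 hF l1 l2 l3 l4
  have s2 : ∀ k > 0, X2 ≤ 43 * (X0 * (1 / k) ^ 2) + 2 * (k * X3) := by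
    intro k hk
    have a1 := l1 (k / 8) (by positivity)
    have a2 := l2 k hk
    have a3 : 2 * X1 / k ≤ 2 * (2 * X0 / (k / 8) + k / 8 * X2) / k := by gcongr
    have a4 : 2 * (2 * X0 / (k / 8) + k / 8 * X2) / k = 32 * (X0 * (1 / k) ^ 2) + X2 / 4 := by
      field_simp; ring
    have a5 : 0 ≤ k * X3 := by positivity
    have a6 : 0 ≤ X0 * (1 / k) ^ 2 := by positivity
    linarith
  have b2 : X2 ≤ c2 * X0 + h * X3 / 8 := by
    have := s2 (h / 16) (by positivity)
    have e1 : 43 * (X0 * (1 / (h / 16)) ^ 2) = c2 * X0 := by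
      simp only [c2]; field_simp; ring
    linarith
  have b3 : X3 ≤ c3 * X0 + 2 * (h * X4) := by
    have a1 := l3 h hh0
    have a2 : 2 * X2 / h ≤ 2 * (c2 * X0 + h * X3 / 8) / h := by gcongr
    have a3 : 2 * (c2 * X0 + h * X3 / 8) / h = 1 / 2 * (c3 * X0) + X3 / 4 := by
      simp only [c2, c3]; field_simp; ring
    have : 0 ≤ c3 * X0 := by positivity
    have : 0 ≤ h * X4 := by positivity
    linarith
  have b1 : X1 ≤ 2 * X0 + X2 := by
    have := l1 1 one_pos
    linarith
  have hhX : h * X3 ≤ X3 := by nlinarith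
  have b4 : X0 + X1 + X2 + X3 ≤ (3 + 2 * c2 + 2 * c3) * X0 + 4 * (h * X4) := by
    have : 0 ≤ h * X4 := by positivity
    have : 0 ≤ c3 * X0 := by positivity
    linarith
  have b5 : X4 ≤ Λ * ((3 + 2 * c2 + 2 * c3) * X0) + 4 * (Λ * h) * X4 + F := by
    have : Λ * (X0 + X1 + X2 + X3) ≤ Λ * ((3 + 2 * c2 + 2 * c3) * X0 + 4 * (h * X4)) := by gcongr
    linarith
  rw [hhΛ] at b5
  have hhX4 : h * X4 ≤ X4 := by nlinarith
  have b6 : X4 ≤ 2 * (Λ * (3 + 2 * c2 + 2 * c3)) * X0 + 2 * F := by linarith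
  have n1 : 0 ≤ c2 * F := by positivity
  have n2 : 0 ≤ c3 * F := by positivity
  have n3 : 0 ≤ Λ * (3 + 2 * c2 + 2 * c3) * F := by positivity
  have n4 : 0 ≤ Λ * (3 + 2 * c2 + 2 * c3) * X0 := by positivity
  have n5 : 0 ≤ c2 * X0 := by positivity
  have n6 : 0 ≤ c3 * X0 := by positivity
  have n7 : (3 + 2 * c2 + 2 * c3) * X0 = 3 * X0 + 2 * (c2 * X0) + 2 * (c3 * X0) := by ring
  have n8 : (2 + 4 * c2 + 4 * c3 + 8 * (Λ * (3 + 2 * c2 + 2 * c3) + 1)) * (X0 + F) =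
    10 * X0 + 4 * (c2 * X0) + 4 * (c3 * X0) + 8 * (Λ * (3 + 2 * c2 + 2 * c3) * X0) +
    10 * F + 4 * (c2 * F) + 4 * (c3 * F) + 8 * (Λ * (3 + 2 * c2 + 2 * c3) * F) := by ring
  rw [n8]
  linarith

/-- A priori derivative bounds for bounded solutions of a linear equation of order four. -/
lemma exists_deriv_bounds (a0 a1 a2 a3 : ℝ) : ∃ K : ℝ, 0 ≤ K ∧
    ∀ (m0 m1 m2 m3 m4 : ℝ → ℝ) (T A B F : ℝ),
    (∀ t > T, HasDerivAt m0 (m1 t) t) → (∀ t > T, HasDerivAt m1 (m2 t) t) →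
    (∀ t > T, HasDerivAt m2 (m3 t) t) → (∀ t > T, HasDerivAt m3 (m4 t) t) →
    (∀ t > T, |m0 t| ≤ A) →
    (∀ t > T, |m1 t| ≤ B ∧ |m2 t| ≤ B ∧ |m3 t| ≤ B ∧ |m4 t| ≤ B) →
    (∀ t > T, |m4 t + a3 * m3 t + a2 * m2 t + a1 * m1 t + a0 * m0 t| ≤ F) →
    ∀ t > T, |m1 t| ≤ K * (A + F) ∧ |m2 t| ≤ K * (A + F) ∧ |m3 t| ≤ K * (A + F) ∧
      |m4 t| ≤ K * (A + F) := by
  set Λ := 1 + |a0| + |a1| + |a2| + |a3| with hΛ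
  have hΛ1 : 1 ≤ Λ := by
    have := abs_nonneg a0; have := abs_nonneg a1; have := abs_nonneg a2; have := abs_nonneg a3
    linarith
  obtain ⟨K, hK, hKX⟩ := interpolation_absorb hΛ1
  refine ⟨K, hK, fun m0 m1 m2 m3 m4 T A B F d0 d1 d2 d3 hA hB hF => ?_⟩
  set X : (ℝ → ℝ) → ℝ := fun m => sSup ((fun t => |m t|) '' Set.Ioi T) with hX
  have hne : ∀ m : ℝ → ℝ, ((fun t => |m t|) '' Set.Ioi T).Nonempty := fun m =>
    ⟨_, T + 1, by simp, rfl⟩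
  have hle : ∀ (m : ℝ → ℝ) (b : ℝ), (∀ t > T, |m t| ≤ b) → ∀ t > T, |m t| ≤ X m := by
    intro m b hb t ht
    refine le_csSup ⟨b, ?_⟩ ⟨t, ht, rfl⟩
    rintro _ ⟨s, hs, rfl⟩; exact hb s hs
  have hge : ∀ (m : ℝ → ℝ) (b : ℝ), (∀ t > T, |m t| ≤ b) → X m ≤ b := by
    intro m b hb
    refine csSup_le (hne m) ?_
    rintro _ ⟨s, hs, rfl⟩; exact hb s hs
  have x0 := hle m0 A hA
  have x1 := hle m1 B fun t ht => (hB t ht).1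
  have x2 := hle m2 B fun t ht => (hB t ht).2.1
  have x3 := hle m3 B fun t ht => (hB t ht).2.2.1
  have x4 := hle m4 B fun t ht => (hB t ht).2.2.2
  have hT : T + 1 > T := by linarith
  have hX0 : ∀ (m : ℝ → ℝ), (∀ t > T, |m t| ≤ X m) → 0 ≤ X m := fun m hm =>
    (abs_nonneg _).trans (hm _ hT)
  have hF0 : 0 ≤ F := (abs_nonneg _).trans (hF _ hT)
  have hsum := hKX (X m0) (X m1) (X m2) (X m3) (X m4) F (hX0 _ x0) (hX0 _ x1) (hX0 _ x2)
    (hX0 _ x3) (hX0 _ x4) hF0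
    (fun h hh => hge _ _ fun t ht => abs_deriv_le_of_abs_le d0 d1 x0 x2 hh ht)
    (fun h hh => hge _ _ fun t ht => abs_deriv_le_of_abs_le d1 d2 x1 x3 hh ht)
    (fun h hh => hge _ _ fun t ht => abs_deriv_le_of_abs_le d2 d3 x2 x4 hh ht)
    (hge _ _ fun t ht => by
      have e : m4 t = (m4 t + a3 * m3 t + a2 * m2 t + a1 * m1 t + a0 * m0 t) -
        (a3 * m3 t + a2 * m2 t + a1 * m1 t + a0 * m0 t) := by ring
      have b : ∀ (a x y : ℝ), |x| ≤ y → |a| ≤ Λ → |a * x| ≤ Λ * y := fun a x y hxy ha => by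
        rw [abs_mul]
        exact mul_le_mul ha hxy (abs_nonneg _) (by linarith)
      have := abs_nonneg a0; have := abs_nonneg a1; have := abs_nonneg a2; have := abs_nonneg a3
      have c0 := b a0 _ _ (x0 t ht) (by linarith)
      have c1 := b a1 _ _ (x1 t ht) (by linarith)
      have c2 := b a2 _ _ (x2 t ht) (by linarith)
      have c3 := b a3 _ _ (x3 t ht) (by linarith)
      have f := hF t ht
      rw [abs_le] at c0 c1 c2 c3 f ⊢
      constructor <;> linarith)
  have hKA : K * (X m0 + F) ≤ K * (A + F) := by
    have := hge m0 A hA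
    gcongr
  have y1 := hX0 _ x1
  have y2 := hX0 _ x2
  have y3 := hX0 _ x3
  have y4 := hX0 _ x4
  intro t ht
  exact ⟨by linarith [x1 t ht], by linarith [x2 t ht], by linarith [x3 t ht],
    by linarith [x4 t ht]⟩

end Interpolation

section Windows

/-- The function `m0`, with successive derivatives `m1, …, m4`, solves
`m4 + a3 m3 + a2 m2 + a1 m1 + a0 m0 = m0 ^ p` up to an error `η`. -/
structure IsApproxODE (p a0 a1 a2 a3 A C η T : ℝ) (m0 m1 m2 m3 m4 : ℝ → ℝ) : Prop where
  d0 : ∀ t > T, HasDerivAt m0 (m1 t) t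
  d1 : ∀ t > T, HasDerivAt m1 (m2 t) t
  d2 : ∀ t > T, HasDerivAt m2 (m3 t) t
  d3 : ∀ t > T, HasDerivAt m3 (m4 t) t
  nonneg : ∀ t > T, 0 ≤ m0 t
  le : ∀ t > T, m0 t ≤ A
  b1 : ∀ t > T, |m1 t| ≤ C
  b2 : ∀ t > T, |m2 t| ≤ C
  b3 : ∀ t > T, |m3 t| ≤ C
  b4 : ∀ t > T, |m4 t| ≤ C
  eqn : ∀ t > T, |m4 t + a3 * m3 t + a2 * m2 t + a1 * m1 t + a0 * m0 t - m0 t ^ p| ≤ η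

lemma exists_subinterval {j t h : ℝ} (ht : t ∈ Set.Icc j (j + 1)) (hh : 0 < h) (hh2 : h ≤ 1 / 2) :
    ∃ s, j ≤ s ∧ s + h ≤ j + 1 ∧ t ∈ Set.Icc s (s + h) := by
  rcases le_total t (j + 1 / 2) with h1 | h1
  · exact ⟨t, ht.1, by linarith, le_rfl, by linarith⟩
  · exact ⟨t - h, by linarith, by linarith [ht.2], by linarith, by linarith⟩

lemma exists_small_of_small_primitive {L ε : ℝ} (hL : 0 ≤ L) (hε : 0 < ε) :
    ∃ ε1 > 0, ∀ (f f1 g : ℝ → ℝ) (j : ℝ), (∀ t ∈ Set.Icc j (j + 1), HasDerivAt f (f1 t) t) →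
      (∀ t ∈ Set.Icc j (j + 1), |f1 t + g t| ≤ ε / 4) →
      (∀ s ∈ Set.Icc j (j + 1), ∀ t ∈ Set.Icc j (j + 1), |g s - g t| ≤ L * |s - t|) →
      (∀ t ∈ Set.Icc j (j + 1), |f t| ≤ ε1) → ∀ t ∈ Set.Icc j (j + 1), |g t| ≤ ε := by
  set h := min (1 / 2) (ε / (4 * (L + 1))) with hh
  have hh0 : 0 < h := by positivity
  have hLh : L * h ≤ ε / 4 := by
    have : h ≤ ε / (4 * (L + 1)) := min_le_right _ _
    rw [le_div_iff₀ (by positivity)] at this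
    linarith
  refine ⟨ε * h / 8, by positivity, fun f f1 g j hf hfg hg hf1 t ht => ?_⟩
  obtain ⟨s, hs1, hs2, hst⟩ := exists_subinterval ht hh0 (min_le_left _ _)
  have hin : ∀ x ∈ Set.Icc s (s + h), x ∈ Set.Icc j (j + 1) := fun x hx =>
    ⟨hs1.trans hx.1, hx.2.trans hs2⟩
  obtain ⟨ξ, hξ, hsl⟩ := exists_hasDerivAt_eq_slope f f1 (show s < s + h by linarith)
    (fun x hx => (hf x (hin x hx)).continuousAt.continuousWithinAt)
    (fun x hx => hf x (hin x (Set.Ioo_subset_Icc_self hx)))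
  have hξ' := hin ξ (Set.Ioo_subset_Icc_self hξ)
  have h1 : |f1 ξ| ≤ ε / 4 := by
    rw [hsl, abs_div, show s + h - s = h by ring, abs_of_pos hh0, div_le_iff₀ hh0]
    have := abs_sub (f (s + h)) (f s)
    linarith [hf1 (s + h) (hin _ ⟨by linarith, le_rfl⟩), hf1 s (hin _ ⟨le_rfl, by linarith⟩)]
  have h2 := hfg ξ hξ'
  have h3 := hg t ht ξ hξ'
  have h4 : |t - ξ| ≤ h := by
    rw [abs_le]; constructor <;> linarith [hξ.1, hξ.2, hst.1, hst.2]
  have h5 : L * |t - ξ| ≤ L * h := by gcongr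
  rw [abs_le] at h1 h2 h3 ⊢
  constructor <;> linarith

lemma exists_small_of_small_integral_sq {L ε : ℝ} (hL : 0 ≤ L) (hε : 0 < ε) :
    ∃ c > 0, ∀ (f : ℝ → ℝ) (j : ℝ), ContinuousOn f (Set.Icc j (j + 1)) →
      (∀ s ∈ Set.Icc j (j + 1), ∀ t ∈ Set.Icc j (j + 1), |f s - f t| ≤ L * |s - t|) →
      ∫ t in j..(j + 1), f t ^ 2 ≤ c → ∀ t ∈ Set.Icc j (j + 1), |f t| ≤ ε := by
  set h := min (1 / 2) (ε / (2 * (L + 1))) with hh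
  have hh0 : 0 < h := by positivity
  have hLh : L * h ≤ ε / 2 := by
    have : h ≤ ε / (2 * (L + 1)) := min_le_right _ _
    rw [le_div_iff₀ (by positivity)] at this
    linarith
  refine ⟨ε ^ 2 * h / 8, by positivity, fun f j hfc hf hint t ht => ?_⟩
  by_contra! hcon
  obtain ⟨s, hs1, hs2, hst⟩ := exists_subinterval ht hh0 (min_le_left _ _)
  have hin : ∀ x ∈ Set.Icc s (s + h), x ∈ Set.Icc j (j + 1) := fun x hx =>
    ⟨hs1.trans hx.1, hx.2.trans hs2⟩
  have hlow : ∀ x ∈ Set.Icc s (s + h), (ε / 2) ^ 2 ≤ f x ^ 2 := by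
    intro x hx
    have h3 := hf t ht x (hin x hx)
    have h4 : |t - x| ≤ h := by
      rw [abs_le]; constructor <;> linarith [hx.1, hx.2, hst.1, hst.2]
    have h5 : L * |t - x| ≤ L * h := by gcongr
    have h6 := abs_sub_abs_le_abs_sub (f t) (f x)
    have h7 : ε / 2 ≤ |f x| := by linarith
    rw [← sq_abs (f x)]
    gcongr
  have hi : IntervalIntegrable (fun t => f t ^ 2) volume j (j + 1) :=
    ContinuousOn.intervalIntegrable (by rw [Set.uIcc_of_le (by linarith)]; exact hfc.pow 2)
  have h1 : ∫ t in s..(s + h), f t ^ 2 ≤ ∫ t in j..(j + 1), f t ^ 2 :=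
    intervalIntegral.integral_mono_interval hs1 (by linarith) hs2
      (Eventually.of_forall fun x => sq_nonneg _) hi
  have h2 : ∫ _ in s..(s + h), (ε / 2) ^ 2 ≤ ∫ t in s..(s + h), f t ^ 2 := by
    refine intervalIntegral.integral_mono_on (by linarith) (by simp) ?_ hlow
    exact ContinuousOn.intervalIntegrable (by
      rw [Set.uIcc_of_le (by linarith)]; exact (hfc.mono hin).pow 2)
  rw [intervalIntegral.integral_const, smul_eq_mul] at h2
  have : 0 < ε ^ 2 * h := by positivity
  linarith

lemma abs_sub_le_of_hasDerivAt {f f1 : ℝ → ℝ} {C j : ℝ}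
    (hf : ∀ t ∈ Set.Icc j (j + 1), HasDerivAt f (f1 t) t)
    (hC : ∀ t ∈ Set.Icc j (j + 1), |f1 t| ≤ C) :
    ∀ s ∈ Set.Icc j (j + 1), ∀ t ∈ Set.Icc j (j + 1), |f s - f t| ≤ C * |s - t| := by
  intro s hs t ht
  have := Convex.norm_image_sub_le_of_norm_hasDerivWithin_le (f := f) (f' := f1)
    (C := C) (fun x hx => (hf x hx).hasDerivWithinAt) hC (convex_Icc j (j + 1)) ht hs
  simpa [Real.norm_eq_abs] using this

lemma IsApproxODE.exists_small_window {p a0 a1 a2 a3 A C ε : ℝ} (hp : 1 < p) (ha0 : 0 < a0)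
    (hA : 0 ≤ A) (hC : 0 ≤ C) (hε : 0 < ε) :
    ∃ c > 0, ∃ η0 > 0, ∀ (m0 m1 m2 m3 m4 : ℝ → ℝ) (η T j : ℝ),
      IsApproxODE p a0 a1 a2 a3 A C η T m0 m1 m2 m3 m4 → T < j → η ≤ η0 →
      ∫ t in j..(j + 1), m1 t ^ 2 ≤ c → ∀ t ∈ Set.Icc j (j + 1),
        |m1 t| ≤ ε ∧ |m2 t| ≤ ε ∧ |m3 t| ≤ ε ∧ |a0 * m0 t - m0 t ^ p| ≤ ε := by
  set Λ := 1 + |a1| + |a2| + |a3| with hΛ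
  have hΛ0 : 0 < Λ := by positivity
  have hL : 0 ≤ a0 * C + p * A ^ (p - 1) * C := by
    have : 0 ≤ A ^ (p - 1) := Real.rpow_nonneg hA _
    positivity
  obtain ⟨e3, he3, H3⟩ := exists_small_of_small_primitive hL hε
  set δ := min (min e3 (ε / (8 * Λ))) ε with hδ
  have hδ0 : 0 < δ := by positivity
  have hδ1 : δ ≤ e3 := (min_le_left _ _).trans (min_le_left _ _)
  have hδ2 : Λ * δ ≤ ε / 8 := by
    have : δ ≤ ε / (8 * Λ) := (min_le_left _ _).trans (min_le_right _ _)
    rw [le_div_iff₀ (by positivity)] at this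
    linarith
  have hδ3 : δ ≤ ε := min_le_right _ _
  obtain ⟨e2, he2, H2⟩ := exists_small_of_small_primitive hC hδ0
  obtain ⟨e1, he1, H1⟩ := exists_small_of_small_primitive hC (lt_min he2 hδ0)
  obtain ⟨c, hc, H0⟩ := exists_small_of_small_integral_sq hC (lt_min he1 hδ0)
  refine ⟨c, hc, ε / 8, by positivity, fun m0 m1 m2 m3 m4 η T j h hTj hη hD => ?_⟩
  have hin : ∀ t ∈ Set.Icc j (j + 1), t > T := fun t ht => hTj.trans_le ht.1
  have k1 := H0 m1 j (fun t ht => (h.d1 t (hin t ht)).continuousAt.continuousWithinAt)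
    (abs_sub_le_of_hasDerivAt (fun t ht => h.d1 t (hin t ht)) fun t ht => h.b2 t (hin t ht)) hD
  have k2 := H1 m1 m2 (fun t => - m2 t) j (fun t ht => h.d1 t (hin t ht))
    (fun t ht => by simp; positivity)
    (abs_sub_le_of_hasDerivAt (fun t ht => (h.d2 t (hin t ht)).neg)
      fun t ht => by rw [abs_neg]; exact h.b3 t (hin t ht))
    (fun t ht => (k1 t ht).trans (min_le_left _ _))
  simp only [abs_neg] at k2
  have k3 := H2 m2 m3 (fun t => - m3 t) j (fun t ht => h.d2 t (hin t ht))
    (fun t ht => by simp; positivity)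
    (abs_sub_le_of_hasDerivAt (fun t ht => (h.d3 t (hin t ht)).neg)
      fun t ht => by rw [abs_neg]; exact h.b4 t (hin t ht))
    (fun t ht => (k2 t ht).trans (min_le_left _ _))
  simp only [abs_neg] at k3
  have k1' : ∀ t ∈ Set.Icc j (j + 1), |m1 t| ≤ δ := fun t ht => (k1 t ht).trans (min_le_right _ _)
  have k2' : ∀ t ∈ Set.Icc j (j + 1), |m2 t| ≤ δ := fun t ht => (k2 t ht).trans (min_le_right _ _)
  have hmlip := abs_sub_le_of_hasDerivAt (fun t ht => h.d0 t (hin t ht))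
    fun t ht => h.b1 t (hin t ht)
  have hplip : ∀ x ∈ Set.Icc 0 A, ∀ y ∈ Set.Icc 0 A,
      |x ^ p - y ^ p| ≤ p * A ^ (p - 1) * |x - y| := by
    intro x hx y hy
    wlog hxy : y ≤ x generalizing x y
    · rw [abs_sub_comm, abs_sub_comm x]; exact this y hy x hx (by linarith)
    rw [abs_of_nonneg (by linarith : 0 ≤ x - y), abs_of_nonneg (by
      have := Real.rpow_le_rpow hy.1 hxy (by linarith : 0 ≤ p); linarith)]
    refine (rpow_sub_rpow_le hp.le hy.1 hxy).trans ?_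
    have h0 : 0 ≤ x - y := by linarith
    have := Real.rpow_le_rpow hx.1 hx.2 (by linarith : 0 ≤ p - 1)
    gcongr
  have k4 := H3 m3 m4 (fun t => a0 * m0 t - m0 t ^ p) j (fun t ht => h.d3 t (hin t ht)) (by
      intro t ht
      have b : ∀ (a x : ℝ), |x| ≤ δ → |a * x| ≤ |a| * δ := fun a x hx => by
        rw [abs_mul]; gcongr
      have c1 := b a1 _ (k1' t ht)
      have c2 := b a2 _ (k2' t ht)
      have c3 := b a3 _ (k3 t ht)
      have c4 := (h.eqn t (hin t ht)).trans hη
      have c5 : (|a1| + |a2| + |a3|) * δ ≤ ε / 8 := by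
        refine le_trans ?_ hδ2
        gcongr; linarith
      rw [abs_le] at c1 c2 c3 c4 ⊢
      constructor <;> linarith)
    (by
      intro s hs t ht
      have c1 := hmlip s hs t ht
      have c2 := hplip (m0 s) ⟨h.nonneg s (hin s hs), h.le s (hin s hs)⟩
        (m0 t) ⟨h.nonneg t (hin t ht), h.le t (hin t ht)⟩
      have c3 : 0 ≤ p * A ^ (p - 1) := by
        have : 0 ≤ A ^ (p - 1) := Real.rpow_nonneg hA _
        positivity
      have c4 : p * A ^ (p - 1) * |m0 s - m0 t| ≤ p * A ^ (p - 1) * (C * |s - t|) := by gcongr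
      have c5 : |a0 * m0 s - a0 * m0 t| ≤ a0 * (C * |s - t|) := by
        rw [← mul_sub, abs_mul, abs_of_pos ha0]; gcongr
      rw [abs_le] at c2 c5 ⊢
      constructor <;> linarith)
    (fun t ht => (k3 t ht).trans hδ1)
  exact fun t ht => ⟨(k1' t ht).trans hδ3, (k2' t ht).trans hδ3, (k3 t ht).trans hδ3, k4 t ht⟩

end Windows

section Dichotomy

lemma IsPreconnected.le_or_ge_of_gap {X : Type*} [TopologicalSpace X] {s : Set X} {f : X → ℝ}
    {a b : ℝ} (hs : IsPreconnected s) (hf : ContinuousOn f s) (hab : a < b)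
    (h : ∀ x ∈ s, f x ≤ a ∨ b ≤ f x) : (∀ x ∈ s, f x ≤ a) ∨ ∀ x ∈ s, b ≤ f x := by
  by_contra hcon
  push Not at hcon
  obtain ⟨⟨x, hx, hxa⟩, y, hy, hyb⟩ := hcon
  have hx' : b ≤ f x := (h x hx).resolve_left (by linarith)
  have hy' : f y ≤ a := (h y hy).resolve_right (by linarith)
  obtain ⟨z, hz, hze⟩ := hs.intermediate_value hy hx hf
    (show (a + b) / 2 ∈ Set.Icc (f y) (f x) from ⟨by linarith, by linarith⟩)
  rcases h z hz with h1 | h1 <;> linarith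

/-- A bounded sequence that increases, except for moves inside one of two disjoint bands, makes only
finitely many jumps of size at least five times the half-width of the bands. -/
lemma eventually_not_of_gain {e : ℕ → ℝ} {far : ℕ → Prop} {ω K M : ℝ} (hω : 0 < ω)
    (hK : 2 * ω < K) (hM : ∀ j, e j ≤ M) (hfar : ∀ j, far j → e j + 5 * ω ≤ e (j + 1))
    (hmono : ∀ j, e j ≤ e (j + 1) ∨ (|e j| ≤ ω ∧ |e (j + 1)| ≤ ω) ∨
      (|e j - K| ≤ ω ∧ |e (j + 1) - K| ≤ ω)) : ∀ᶠ j in atTop, ¬ far j := by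
  set ψ : ℝ → ℝ := fun x => x - max (-ω) (min ω x) - max (K - ω) (min (K + ω) x) with hψ
  have hψm : ∀ x y, x ≤ y → ψ x ≤ ψ y := by
    intro x y hxy
    simp only [hψ, max_def, min_def]
    split_ifs <;> linarith
  have hψ4 : ∀ x y, x ≤ y → y - x - 4 * ω ≤ ψ y - ψ x := by
    intro x y hxy
    simp only [hψ, max_def, min_def]
    split_ifs <;> linarith
  have hψ0 : ∀ x y, |x| ≤ ω → |y| ≤ ω → ψ x = ψ y := by
    intro x y hx hy
    rw [abs_le] at hx hy
    simp only [hψ]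
    rw [min_eq_right hx.2, min_eq_right hy.2, max_eq_right hx.1, max_eq_right hy.1,
      min_eq_right (by linarith : x ≤ K + ω), min_eq_right (by linarith : y ≤ K + ω),
      max_eq_left (by linarith : x ≤ K - ω), max_eq_left (by linarith : y ≤ K - ω)]
    ring
  have hψK : ∀ x y, |x - K| ≤ ω → |y - K| ≤ ω → ψ x = ψ y := by
    intro x y hx hy
    rw [abs_le] at hx hy
    simp only [hψ]
    rw [min_eq_left (by linarith : ω ≤ x), min_eq_left (by linarith : ω ≤ y),
      min_eq_right (by linarith : x ≤ K + ω), min_eq_right (by linarith : y ≤ K + ω),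
      max_eq_right (by linarith : K - ω ≤ x), max_eq_right (by linarith : K - ω ≤ y)]
    ring
  have hmon : Monotone fun j => ψ (e j) := by
    refine monotone_nat_of_le_succ fun j => ?_
    rcases hmono j with h | ⟨h1, h2⟩ | ⟨h1, h2⟩
    · exact hψm _ _ h
    · exact (hψ0 _ _ h1 h2).le
    · exact (hψK _ _ h1 h2).le
  have hbdd : BddAbove (Set.range fun j => ψ (e j)) := by
    refine ⟨ψ M, ?_⟩
    rintro _ ⟨j, rfl⟩
    exact hψm _ _ (hM j)
  have hlim := tendsto_atTop_ciSup hmon hbdd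
  have hlim2 := ((hlim.comp (tendsto_add_atTop_nat 1)).sub hlim)
  rw [sub_self] at hlim2
  filter_upwards [hlim2.eventually (gt_mem_nhds hω)] with j hj hf
  have h1 := hfar j hf
  have h2 := hψ4 _ _ (show e j ≤ e (j + 1) by linarith)
  simp only [Function.comp] at hj
  linarith

lemma exists_near_zero_of_small {p a0 A ε : ℝ} (hp : 1 < p) (hε : 0 < ε) :
    ∃ δ > 0, ∀ x ∈ Set.Icc 0 A, |a0 * x - x ^ p| ≤ δ → x ≤ ε ∨ |x - a0 ^ (1 / (p - 1))| ≤ ε := by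
  set S := {x ∈ Set.Icc 0 A | ε ≤ x ∧ ε ≤ |x - a0 ^ (1 / (p - 1))|} with hS
  have hScomp : IsCompact S := by
    refine isCompact_Icc.of_isClosed_subset ?_ (fun x hx => hx.1)
    refine isClosed_Icc.inter ((isClosed_le continuous_const continuous_id).inter
      (isClosed_le continuous_const (continuous_id.sub continuous_const).abs))
  have hcont : Continuous fun x : ℝ => |a0 * x - x ^ p| := by
    have : Continuous fun x : ℝ => x ^ p := Real.continuous_rpow_const (by linarith)
    fun_prop
  rcases S.eq_empty_or_nonempty with h | h
  · refine ⟨1, one_pos, fun x hx _ => ?_⟩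
    by_contra hcon
    push Not at hcon
    have : x ∈ S := ⟨hx, hcon.1.le, hcon.2.le⟩
    simp [h] at this
  · obtain ⟨x0, hx0, hmin⟩ := hScomp.exists_isMinOn h hcont.continuousOn
    have hpos : 0 < |a0 * x0 - x0 ^ p| := by
      rw [abs_pos]
      intro h0
      have hx0p : 0 < x0 := hε.trans_le hx0.2.1
      have h1 : x0 ^ (p - 1) = a0 := by
        rw [Real.rpow_sub_one hx0p.ne', div_eq_iff hx0p.ne']; linarith
      have h2 : a0 ^ (1 / (p - 1)) = x0 := by
        rw [← h1, ← Real.rpow_mul hx0p.le, mul_one_div_cancel (by linarith), Real.rpow_one]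
      have := hx0.2.2
      rw [h2] at this
      simp at this
      linarith
    refine ⟨|a0 * x0 - x0 ^ p| / 2, by positivity, fun x hx hxd => ?_⟩
    by_contra hcon
    push Not at hcon
    have := hmin (show x ∈ S from ⟨hx, hcon.1.le, hcon.2.le⟩)
    simp only [Set.mem_ofPred_eq] at this
    linarith

/-- The conserved quantity of `x⁗ + a2 x″ + a0 x = x ^ p`, in phase space coordinates. -/
noncomputable def phaseEnergy (p a0 a2 a3 x y z w : ℝ) : ℝ :=
  w * y - z ^ 2 / 2 + a3 * z * y + a2 / 2 * y ^ 2 + a0 / 2 * x ^ 2 - x ^ (p + 1) / (p + 1)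

lemma continuous_phaseEnergy {p a0 a2 a3 : ℝ} (hp : 1 < p) :
    Continuous fun q : ℝ × ℝ × ℝ × ℝ => phaseEnergy p a0 a2 a3 q.1 q.2.1 q.2.2.1 q.2.2.2 := by
  have : Continuous fun q : ℝ × ℝ × ℝ × ℝ => q.1 ^ (p + 1) :=
    continuous_fst.rpow_const fun _ => Or.inr (by linarith)
  unfold phaseEnergy
  fun_prop

lemma exists_phaseEnergy_near {p a0 a2 a3 x0 ω : ℝ} (hp : 1 < p) (hω : 0 < ω) :
    ∃ δ > 0, ∀ x y z w, |x - x0| ≤ δ → |y| ≤ δ → |z| ≤ δ → |w| ≤ δ →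
      |phaseEnergy p a0 a2 a3 x y z w - phaseEnergy p a0 a2 a3 x0 0 0 0| ≤ ω := by
  obtain ⟨δ, hδ, h⟩ := Metric.continuousAt_iff.mp
    ((continuous_phaseEnergy (a0 := a0) (a2 := a2) (a3 := a3) hp).continuousAt
      (x := (x0, 0, 0, 0))) ω hω
  refine ⟨δ / 2, by positivity, fun x y z w hx hy hz hw => ?_⟩
  have := h (x := (x, y, z, w)) (by
    simp only [Prod.dist_eq, Real.dist_eq, sub_zero, max_lt_iff]
    refine ⟨by linarith, by linarith, by linarith, by linarith⟩)
  exact (Real.dist_eq _ _ ▸ this).le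

lemma exists_phaseEnergy_le {p a0 a2 a3 A C : ℝ} (hp : 1 < p) :
    ∃ M, ∀ x y z w, x ∈ Set.Icc 0 A → |y| ≤ C → |z| ≤ C → |w| ≤ C →
      phaseEnergy p a0 a2 a3 x y z w ≤ M := by
  have hc : IsCompact (Set.Icc (0 : ℝ) A ×ˢ Set.Icc (-C) C ×ˢ Set.Icc (-C) C ×ˢ Set.Icc (-C) C) :=
    isCompact_Icc.prod (isCompact_Icc.prod (isCompact_Icc.prod isCompact_Icc))
  obtain ⟨M, hM⟩ := hc.bddAbove_image
    (continuous_phaseEnergy (a0 := a0) (a2 := a2) (a3 := a3) hp).continuousOn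
  refine ⟨M, fun x y z w hx hy hz hw => hM ⟨(x, y, z, w), ⟨hx, ?_, ?_, ?_⟩, rfl⟩⟩
  · exact abs_le.mp hy
  · exact abs_le.mp hz
  · exact abs_le.mp hw

lemma phaseEnergy_const_pos {p a0 a2 a3 : ℝ} (hp : 1 < p) (ha0 : 0 < a0) :
    0 < phaseEnergy p a0 a2 a3 (a0 ^ (1 / (p - 1))) 0 0 0 := by
  have hK : 0 < a0 ^ (1 / (p - 1)) := by positivity
  set K := a0 ^ (1 / (p - 1)) with hKd
  have h1 : K ^ (p - 1) = a0 := by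
    rw [hKd, ← Real.rpow_mul ha0.le, one_div_mul_cancel (by linarith), Real.rpow_one]
  have h2 : K ^ (p + 1) = a0 * K ^ 2 := by
    rw [← h1, ← Real.rpow_natCast K 2, ← Real.rpow_add hK]
    congr 1; push_cast; ring
  have h3 : phaseEnergy p a0 a2 a3 K 0 0 0 = a0 * K ^ 2 * ((p - 1) / (2 * (p + 1))) := by
    unfold phaseEnergy
    rw [h2]
    field_simp
    ring
  rw [h3]
  have : 0 < p - 1 := by linarith
  positivity

lemma IsApproxODE.energy_gain {p a0 a1 a2 a3 A C η T j : ℝ} {m0 m1 m2 m3 m4 : ℝ → ℝ}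
    (hp : 1 < p) (ha3 : 0 ≤ a3) (h : IsApproxODE p a0 a1 a2 a3 A C η T m0 m1 m2 m3 m4)
    (hj : T < j) (hη : 0 ≤ η) :
    (-a1) * (∫ t in j..(j + 1), m1 t ^ 2) - η * C ≤
      phaseEnergy p a0 a2 a3 (m0 (j + 1)) (m1 (j + 1)) (m2 (j + 1)) (m3 (j + 1)) -
        phaseEnergy p a0 a2 a3 (m0 j) (m1 j) (m2 j) (m3 j) := by
  have hcont1 : ContinuousOn m1 (Set.Icc j (j + 1)) := fun t ht =>
    (h.d1 t (hj.trans_le ht.1)).continuousAt.continuousWithinAt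
  have hder : ∀ t > T, HasDerivAt (fun t => phaseEnergy p a0 a2 a3 (m0 t) (m1 t) (m2 t) (m3 t))
      ((m4 t + a3 * m3 t + a2 * m2 t + a1 * m1 t + a0 * m0 t - m0 t ^ p) * m1 t
        + a3 * m2 t ^ 2 - a1 * m1 t ^ 2) t := by
    intro t ht
    have e1 := (h.d0 t ht).rpow_const (p := p + 1) (Or.inr (by linarith))
    have := (((((h.d3 t ht).mul (h.d1 t ht)).sub (((h.d2 t ht).pow 2).div_const 2)).add
      (((h.d2 t ht).const_mul a3).mul (h.d1 t ht))).add (((h.d1 t ht).pow 2).const_mul (a2 / 2))).add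
      (((h.d0 t ht).pow 2).const_mul (a0 / 2)) |>.sub (e1.div_const (p + 1))
    refine this.congr_deriv ?_
    have hp1 : p + 1 ≠ 0 := by linarith
    have : p + 1 - 1 = p := by ring
    rw [this]
    field_simp
    push_cast
    ring
  have key := intervalIntegral.integral_le_sub_of_hasDeriv_right_of_le
    (φ := fun t => (-a1) * m1 t ^ 2 - η * C) (show j ≤ j + 1 by linarith)
    (fun t ht => (hder t (hj.trans_le ht.1)).continuousAt.continuousWithinAt)
    (fun t ht => (hder t (hj.trans ht.1)).hasDerivWithinAt)
    (ContinuousOn.integrableOn_Icc (by fun_prop))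
    (fun t ht => by
      have htT : t > T := hj.trans ht.1
      have h1 := h.eqn t htT
      have h2 := h.b1 t htT
      have h3 : |(m4 t + a3 * m3 t + a2 * m2 t + a1 * m1 t + a0 * m0 t - m0 t ^ p) * m1 t|
          ≤ η * C := by
        rw [abs_mul]; gcongr
      have h4 := (abs_le.mp h3).1
      have h5 : 0 ≤ a3 * m2 t ^ 2 := by positivity
      linarith)
  refine le_trans (le_of_eq ?_) key
  rw [intervalIntegral.integral_sub, intervalIntegral.integral_const_mul,
    intervalIntegral.integral_const]
  · simp
  · refine ContinuousOn.intervalIntegrable ?_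
    rw [Set.uIcc_of_le (by linarith)]
    fun_prop
  · exact intervalIntegrable_const

/-- A bounded nonnegative approximate solution of the constant coefficient equation is eventually
close to one of the two nonnegative equilibria. -/
theorem exists_dichotomy_of_approxODE {p a0 a1 a2 a3 A C ε : ℝ} (hp : 1 < p) (ha3 : 0 ≤ a3)
    (ha1 : a1 < 0) (ha0 : 0 < a0) (hA : 0 ≤ A) (hC : 0 ≤ C) (hε : 0 < ε) :
    ∃ η > 0, ∀ (m0 m1 m2 m3 m4 : ℝ → ℝ) (T : ℝ),
      IsApproxODE p a0 a1 a2 a3 A C η T m0 m1 m2 m3 m4 →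
      (∃ T', ∀ t ≥ T', m0 t ≤ ε) ∨ ∃ T', ∀ t ≥ T', |m0 t - a0 ^ (1 / (p - 1))| ≤ ε := by
  have hK : 0 < a0 ^ (1 / (p - 1)) := by positivity
  set K := a0 ^ (1 / (p - 1)) with hKd
  set c0 := -a1 with hc0
  have hc0p : 0 < c0 := by linarith
  have hEK := phaseEnergy_const_pos (a2 := a2) (a3 := a3) hp ha0
  rw [← hKd] at hEK
  set EK := phaseEnergy p a0 a2 a3 K 0 0 0 with hEKd
  have hE0 : phaseEnergy p a0 a2 a3 0 0 0 0 = 0 := by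
    simp [phaseEnergy, Real.zero_rpow (show p + 1 ≠ 0 by linarith)]
  set ε0 := min ε (K / 4) with hε0
  have hε0p : 0 < ε0 := by positivity
  have hε0K : ε0 ≤ K / 4 := min_le_right _ _
  obtain ⟨δ1, hδ1, near1⟩ := exists_near_zero_of_small (a0 := a0) (A := A) hp hε0p
  rw [← hKd] at near1
  obtain ⟨c1, hc1, η1, hη1, win1⟩ := IsApproxODE.exists_small_window (a1 := a1) (a2 := a2)
    (a3 := a3) hp ha0 hA hC hδ1
  set ω := min (c0 * c1 / 10) (EK / 10) with hω
  have hωp : 0 < ω := by positivity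
  obtain ⟨δ2, hδ2, E2⟩ := exists_phaseEnergy_near (a0 := a0) (a2 := a2) (a3 := a3) (x0 := 0) hp hωp
  obtain ⟨δ3, hδ3, E3⟩ := exists_phaseEnergy_near (a0 := a0) (a2 := a2) (a3 := a3) (x0 := K) hp hωp
  rw [hE0] at E2
  simp only [sub_zero] at E2
  set ε2 := min ε0 (min δ2 δ3) with hε2
  have hε2p : 0 < ε2 := by positivity
  obtain ⟨δ4, hδ4, near2⟩ := exists_near_zero_of_small (a0 := a0) (A := A) hp hε2p
  rw [← hKd] at near2
  obtain ⟨c2, hc2, η2, hη2, win2⟩ := IsApproxODE.exists_small_window (a1 := a1) (a2 := a2)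
    (a3 := a3) hp ha0 hA hC (show 0 < min ε2 δ4 by positivity)
  set η := min (min η1 η2) (min (c0 * c1 / 2) (c0 * c2) / (C + 1)) with hη
  have hηp : 0 < η := by positivity
  have hηC : η * C ≤ min (c0 * c1 / 2) (c0 * c2) := by
    have h1 : η ≤ min (c0 * c1 / 2) (c0 * c2) / (C + 1) := min_le_right _ _
    rw [le_div_iff₀ (by positivity)] at h1
    linarith
  have hηC1 := hηC.trans (min_le_left _ _)
  have hηC2 := hηC.trans (min_le_right _ _)
  have hηη1 : η ≤ η1 := (min_le_left _ _).trans (min_le_left _ _)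
  have hηη2 : η ≤ η2 := (min_le_left _ _).trans (min_le_right _ _)
  have hε2ε0 : ε2 ≤ ε0 := min_le_left _ _
  have hε2δ2 : ε2 ≤ δ2 := (min_le_right _ _).trans (min_le_left _ _)
  have hε2δ3 : ε2 ≤ δ3 := (min_le_right _ _).trans (min_le_right _ _)
  refine ⟨η, hηp, fun m0 m1 m2 m3 m4 T h => ?_⟩
  set E : ℝ → ℝ := fun t => phaseEnergy p a0 a2 a3 (m0 t) (m1 t) (m2 t) (m3 t) with hE
  have hm0c : ContinuousOn m0 (Set.Ioi T) := fun t ht => (h.d0 t ht).continuousAt.continuousWithinAt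
  obtain ⟨M, hM⟩ := exists_phaseEnergy_le (p := p) (a0 := a0) (a2 := a2) (a3 := a3) (A := A)
    (C := C) hp
  have hTj : ∀ j : ℕ, T < T + 1 + j := fun j => by
    have : (0 : ℝ) ≤ j := Nat.cast_nonneg j
    linarith
  have hsucc : ∀ j : ℕ, T + 1 + ((j + 1 : ℕ) : ℝ) = T + 1 + j + 1 := fun j => by
    push_cast; ring
  have hgain : ∀ j : ℕ, c0 * (∫ t in (T + 1 + j)..(T + 1 + j + 1), m1 t ^ 2) - η * C ≤
      E (T + 1 + ((j + 1 : ℕ) : ℝ)) - E (T + 1 + j) := fun j => by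
    rw [hsucc]
    exact h.energy_gain hp ha3 (hTj j) hηp.le
  have hfin := eventually_not_of_gain (e := fun j : ℕ => E (T + 1 + j))
    (far := fun j : ℕ => c1 < ∫ t in (T + 1 + j)..(T + 1 + j + 1), m1 t ^ 2) (K := EK) (M := M) hωp
    (by have : ω ≤ EK / 10 := min_le_right _ _
        linarith)
    (fun j => hM _ _ _ _ ⟨h.nonneg _ (hTj j), h.le _ (hTj j)⟩ (h.b1 _ (hTj j)) (h.b2 _ (hTj j))
      (h.b3 _ (hTj j)))
    (fun j hj => by
      have h1 := hgain j
      have h2 : c0 * c1 ≤ c0 * ∫ t in (T + 1 + j)..(T + 1 + j + 1), m1 t ^ 2 := by gcongr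
      have h3 : ω ≤ c0 * c1 / 10 := min_le_left _ _
      linarith)
    (fun j => by
      by_cases hD : (∫ t in (T + 1 + j)..(T + 1 + j + 1), m1 t ^ 2) ≤ c2
      · right
        have w := win2 m0 m1 m2 m3 m4 η T _ h (hTj j) hηη2 hD
        have hsub : Set.Icc (T + 1 + (j : ℝ)) (T + 1 + j + 1) ⊆ Set.Ioi T :=
          fun t ht => (hTj j).trans_le ht.1
        have hd := isPreconnected_Icc.le_or_ge_of_gap (hm0c.mono hsub)
          (a := ε2) (b := K - ε2) (by linarith) (fun t ht => by
            rcases near2 (m0 t) ⟨h.nonneg t (hsub ht), h.le t (hsub ht)⟩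
              ((w t ht).2.2.2.trans (min_le_right _ _)) with h1 | h1
            · exact Or.inl h1
            · right; linarith [(abs_le.mp h1).1])
        rw [hsucc]
        have hl : T + 1 + (j : ℝ) ∈ Set.Icc (T + 1 + (j : ℝ)) (T + 1 + j + 1) :=
          ⟨le_rfl, by linarith⟩
        have hr : T + 1 + (j : ℝ) + 1 ∈ Set.Icc (T + 1 + (j : ℝ)) (T + 1 + j + 1) :=
          ⟨by linarith, le_rfl⟩
        rcases hd with hd | hd
        · left
          have key : ∀ t ∈ Set.Icc (T + 1 + (j : ℝ)) (T + 1 + j + 1), |E t| ≤ ω := fun t ht => by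
            obtain ⟨w1, w2, w3, -⟩ := w t ht
            have w0 := min_le_left ε2 δ4
            refine E2 _ _ _ _ ?_ (by linarith) (by linarith) (by linarith)
            rw [abs_of_nonneg (h.nonneg t (hsub ht))]
            linarith [hd t ht]
          exact ⟨key _ hl, key _ hr⟩
        · right
          have key : ∀ t ∈ Set.Icc (T + 1 + (j : ℝ)) (T + 1 + j + 1), |E t - EK| ≤ ω :=
            fun t ht => by
            obtain ⟨w1, w2, w3, w4⟩ := w t ht
            have w0 := min_le_left ε2 δ4
            refine E3 _ _ _ _ ?_ (by linarith) (by linarith) (by linarith)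
            rcases near2 (m0 t) ⟨h.nonneg t (hsub ht), h.le t (hsub ht)⟩
              (w4.trans (min_le_right _ _)) with h1 | h1
            · linarith [hd t ht]
            · linarith
          exact ⟨key _ hl, key _ hr⟩
      · left
        push Not at hD
        have h1 := hgain j
        have h2 : c0 * c2 ≤ c0 * ∫ t in (T + 1 + j)..(T + 1 + j + 1), m1 t ^ 2 := by gcongr
        linarith)
  obtain ⟨N, hN⟩ := eventually_atTop.mp hfin
  have hnear : ∀ t ∈ Set.Ici (T + 1 + (N : ℝ)), m0 t ≤ ε0 ∨ |m0 t - K| ≤ ε0 := by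
    intro t ht
    have ht' : (N : ℝ) ≤ t - (T + 1) := by
      have : T + 1 + (N : ℝ) ≤ t := ht
      linarith
    have h0 : 0 ≤ t - (T + 1) := le_trans (Nat.cast_nonneg _) ht'
    set j := ⌊t - (T + 1)⌋₊ with hj
    have hjN : N ≤ j := Nat.le_floor ht'
    have hj1 : (j : ℝ) ≤ t - (T + 1) := Nat.floor_le h0
    have hj2 : t - (T + 1) < j + 1 := Nat.lt_floor_add_one _
    have hD := hN j hjN
    push Not at hD
    have w := win1 m0 m1 m2 m3 m4 η T _ h (hTj j) hηη1 hD t ⟨by linarith, by linarith⟩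
    have htT : t > T := (hTj j).trans_le (by linarith)
    exact near1 (m0 t) ⟨h.nonneg t htT, h.le t htT⟩ w.2.2.2
  have hsub : Set.Ici (T + 1 + (N : ℝ)) ⊆ Set.Ioi T := fun t ht => (hTj N).trans_le ht
  have hd := isPreconnected_Ici.le_or_ge_of_gap (hm0c.mono hsub)
    (a := ε0) (b := K - ε0) (by linarith) (fun t ht => by
      rcases hnear t ht with h1 | h1
      · exact Or.inl h1
      · right; linarith [(abs_le.mp h1).1])
  have hεε : ε0 ≤ ε := min_le_left _ _
  rcases hd with hd | hd
  · exact Or.inl ⟨T + 1 + N, fun t ht => (hd t ht).trans hεε⟩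
  · refine Or.inr ⟨T + 1 + N, fun t ht => ?_⟩
    rcases hnear t ht with h1 | h1
    · linarith [hd t ht]
    · exact h1.trans hεε

end Dichotomy

section Laplacian

open Topology

variable {n : ℕ}

lemma lap_apply (u : EuclideanSpace ℝ (Fin n) → ℝ) (x : EuclideanSpace ℝ (Fin n)) :
    lap u x = ∑ i, fderiv ℝ (fderiv ℝ u) x (EuclideanSpace.single i 1)
      (EuclideanSpace.single i 1) := by
  simp [lap, iteratedFDeriv_two_apply]

lemma lap_eq_sum_of_contDiffAt {u : EuclideanSpace ℝ (Fin n) → ℝ} {x : EuclideanSpace ℝ (Fin n)}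
    (h : ContDiffAt ℝ 2 u x) :
    lap u x = ∑ i, fderiv ℝ (fun y => fderiv ℝ u y (EuclideanSpace.single i 1)) x
      (EuclideanSpace.single i 1) := by
  rw [lap_apply]
  refine Finset.sum_congr rfl fun i _ => ?_
  have hd : DifferentiableAt ℝ (fderiv ℝ u) x :=
    (h.fderiv_right (m := 1) (by norm_num)).differentiableAt (by norm_num)
  rw [fderiv_clm_apply hd (differentiableAt_const _)]
  simp

lemma Filter.EventuallyEq.lap {u v : EuclideanSpace ℝ (Fin n) → ℝ} {x : EuclideanSpace ℝ (Fin n)}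
    (h : u =ᶠ[𝓝 x] v) : _root_.lap u =ᶠ[𝓝 x] _root_.lap v := by
  filter_upwards [(h.fderiv (𝕜 := ℝ)).fderiv (𝕜 := ℝ)] with y hy
  simp only [lap_apply, hy]

lemma Filter.EventuallyEq.bilap {u v : EuclideanSpace ℝ (Fin n) → ℝ}
    {x : EuclideanSpace ℝ (Fin n)} (h : u =ᶠ[𝓝 x] v) :
    _root_.bilap u =ᶠ[𝓝 x] _root_.bilap v := h.lap.lap

lemma ContDiffAt.lap {u : EuclideanSpace ℝ (Fin n) → ℝ} {x : EuclideanSpace ℝ (Fin n)}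
    {k m : WithTop ℕ∞} (h : ContDiffAt ℝ k u x) (hm : m + 2 ≤ k) :
    ContDiffAt ℝ m (_root_.lap u) x := by
  have e : _root_.lap u = fun x => ∑ i, fderiv ℝ (fderiv ℝ u) x (EuclideanSpace.single i 1)
      (EuclideanSpace.single i 1) := funext fun x => lap_apply u x
  rw [e]
  have h2 : ContDiffAt ℝ m (fderiv ℝ (fderiv ℝ u)) x := by
    refine (h.fderiv_right (m := m + 1) ?_).fderiv_right le_rfl
    rw [add_assoc]; exact hm
  exact ContDiffAt.sum fun i _ => (h2.clm_apply contDiffAt_const).clm_apply contDiffAt_const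

lemma tsupport_lap_subset (u : EuclideanSpace ℝ (Fin n) → ℝ) : tsupport (lap u) ⊆ tsupport u := by
  intro x hx
  by_contra h
  rw [notMem_tsupport_iff_eventuallyEq] at h
  refine (notMem_tsupport_iff_eventuallyEq.mpr ?_) hx
  refine h.lap.trans ?_
  refine Eventually.of_forall fun y => ?_
  have : fderiv ℝ (0 : EuclideanSpace ℝ (Fin n) → ℝ) = 0 := by ext; simp
  rw [lap_apply, this]
  simp

lemma integrable_mul_of_tsupport_subset {f g : EuclideanSpace ℝ (Fin n) → ℝ}
    {U : Set (EuclideanSpace ℝ (Fin n))} (hU : IsOpen U) (hf : ContinuousOn f U)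
    (hg : Continuous g) (hgc : HasCompactSupport g) (hgU : tsupport g ⊆ U) :
    Integrable fun x => f x * g x := by
  have hsub : tsupport (fun x => f x * g x) ⊆ tsupport g := closure_mono fun x hx => by
    intro h0; exact hx (by simp [h0])
  refine Continuous.integrable_of_hasCompactSupport ?_ ?_
  · exact (hf.mul hg.continuousOn).continuous_of_tsupport_subset hU (hsub.trans hgU)
  · exact hgc.mono' (subset_tsupport _ |>.trans hsub)

/-- Green's second identity for a compactly supported test function. -/
lemma integral_mul_lap_eq {f g : EuclideanSpace ℝ (Fin n) → ℝ}
    {U : Set (EuclideanSpace ℝ (Fin n))} (hU : IsOpen U) (hf : ∀ x ∈ U, ContDiffAt ℝ 2 f x)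
    (hg : ContDiff ℝ 2 g) (hgc : HasCompactSupport g) (hgU : tsupport g ⊆ U) :
    ∫ x, f x * lap g x = ∫ x, lap f x * g x := by
  set e : Fin n → EuclideanSpace ℝ (Fin n) := fun i => EuclideanSpace.single i 1 with he
  have hfd : ∀ i, ∀ x ∈ U, ContDiffAt ℝ 1 (fun y => fderiv ℝ f y (e i)) x := fun i x hx =>
    ((hf x hx).fderiv_right (m := 1) (by norm_num)).clm_apply contDiffAt_const
  have hfdd : ∀ i, ∀ x ∈ U,
      ContDiffAt ℝ 0 (fun y => fderiv ℝ (fun z => fderiv ℝ f z (e i)) y (e i)) x := fun i x hx =>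
    ((hfd i x hx).fderiv_right (m := 0) (by norm_num)).clm_apply contDiffAt_const
  have hgd : ∀ i, ContDiff ℝ 1 (fun y => fderiv ℝ g y (e i)) := fun i =>
    (hg.fderiv_right (m := 1) (by norm_num)).clm_apply contDiff_const
  have hgdd : ∀ i, ContDiff ℝ 0 (fun y => fderiv ℝ (fun z => fderiv ℝ g z (e i)) y (e i)) :=
    fun i => ((hgd i).fderiv_right (m := 0) (by norm_num)).clm_apply contDiff_const
  have hfc : ContinuousOn f U := fun x hx => (hf x hx).continuousAt.continuousWithinAt
  have hfdc : ∀ i, ContinuousOn (fun y => fderiv ℝ f y (e i)) U := fun i x hx =>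
    (hfd i x hx).continuousAt.continuousWithinAt
  have hfddc : ∀ i, ContinuousOn (fun y => fderiv ℝ (fun z => fderiv ℝ f z (e i)) y (e i)) U :=
    fun i x hx => (hfdd i x hx).continuousAt.continuousWithinAt
  have hs1 : ∀ i, tsupport (fun y => fderiv ℝ g y (e i)) ⊆ tsupport g := fun i =>
    tsupport_fderiv_apply_subset ℝ _
  have hs2 : ∀ i, tsupport (fun y => fderiv ℝ (fun z => fderiv ℝ g z (e i)) y (e i)) ⊆
      tsupport g := fun i => (tsupport_fderiv_apply_subset ℝ _).trans (hs1 i)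
  have hc1 : ∀ i, HasCompactSupport (fun y => fderiv ℝ g y (e i)) := fun i =>
    hgc.mono' ((subset_tsupport _).trans (hs1 i))
  have hc2 : ∀ i, HasCompactSupport
      (fun y => fderiv ℝ (fun z => fderiv ℝ g z (e i)) y (e i)) := fun i =>
    hgc.mono' ((subset_tsupport _).trans (hs2 i))
  have i1 : ∀ i, Integrable fun x =>
      f x * fderiv ℝ (fun z => fderiv ℝ g z (e i)) x (e i) := fun i =>
    integrable_mul_of_tsupport_subset hU hfc (hgdd i).continuous (hc2 i) ((hs2 i).trans hgU)
  have i2 : ∀ i, Integrable fun x => fderiv ℝ f x (e i) * fderiv ℝ g x (e i) := fun i =>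
    integrable_mul_of_tsupport_subset hU (hfdc i) (hgd i).continuous (hc1 i) ((hs1 i).trans hgU)
  have i3 : ∀ i, Integrable fun x =>
      fderiv ℝ (fun z => fderiv ℝ f z (e i)) x (e i) * g x := fun i =>
    integrable_mul_of_tsupport_subset hU (hfddc i) hg.continuous hgc hgU
  have i4 : ∀ i, Integrable fun x => f x * fderiv ℝ g x (e i) := fun i =>
    integrable_mul_of_tsupport_subset hU hfc (hgd i).continuous (hc1 i) ((hs1 i).trans hgU)
  have i5 : ∀ i, Integrable fun x => fderiv ℝ f x (e i) * g x := fun i =>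
    integrable_mul_of_tsupport_subset hU (hfdc i) hg.continuous hgc hgU
  have key : ∀ i, ∫ x, f x * fderiv ℝ (fun z => fderiv ℝ g z (e i)) x (e i) =
      ∫ x, fderiv ℝ (fun z => fderiv ℝ f z (e i)) x (e i) * g x := by
    intro i
    rw [integral_mul_fderiv_eq_neg_fderiv_mul_of_integrable (i2 i) (i1 i) (i4 i)
      (fun x hx => (hf x (hgU (hs1 i hx))).differentiableAt (by norm_num))
      (fun x _ => (hgd i).differentiable (by norm_num) x),
      integral_mul_fderiv_eq_neg_fderiv_mul_of_integrable (i3 i) (i2 i) (i5 i)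
      (fun x hx => (hfd i x (hgU hx)).differentiableAt (by norm_num))
      (fun x _ => hg.differentiable (by norm_num) x), neg_neg]
  have e1 : (fun x => f x * lap g x) = fun x =>
      ∑ i, f x * fderiv ℝ (fun z => fderiv ℝ g z (e i)) x (e i) := by
    ext x
    rw [lap_eq_sum_of_contDiffAt hg.contDiffAt, Finset.mul_sum]
  have e2 : (fun x => lap f x * g x) = fun x =>
      ∑ i, fderiv ℝ (fun z => fderiv ℝ f z (e i)) x (e i) * g x := by
    ext x
    by_cases hx : x ∈ U
    · rw [lap_eq_sum_of_contDiffAt (hf x hx), Finset.sum_mul]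
    · have : g x = 0 := by
        by_contra h
        exact hx (hgU (subset_tsupport _ h))
      simp [this]
  rw [e1, e2, integral_finsetSum _ fun i _ => i1 i, integral_finsetSum _ fun i _ => i3 i]
  exact Finset.sum_congr rfl fun i _ => key i

lemma integral_mul_bilap_eq {f g : EuclideanSpace ℝ (Fin n) → ℝ}
    {U : Set (EuclideanSpace ℝ (Fin n))} (hU : IsOpen U) (hf : ∀ x ∈ U, ContDiffAt ℝ 4 f x)
    (hg : ContDiff ℝ 4 g) (hgc : HasCompactSupport g) (hgU : tsupport g ⊆ U) :
    ∫ x, f x * bilap g x = ∫ x, bilap f x * g x := by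
  have hg2 : ContDiff ℝ 2 (lap g) := contDiff_iff_contDiffAt.mpr fun x =>
    hg.contDiffAt.lap (by norm_num)
  unfold bilap
  rw [integral_mul_lap_eq hU (fun x hx => (hf x hx).of_le (by norm_num)) hg2
    (hgc.mono' ((subset_tsupport _).trans (tsupport_lap_subset g)))
    ((tsupport_lap_subset g).trans hgU),
    integral_mul_lap_eq hU (fun x hx => (hf x hx).lap (by norm_num)) (hg.of_le (by norm_num))
    hgc hgU]

end Laplacian

section LaplacianCalculus

open Topology

variable {n : ℕ}

lemma lap_comp_smul_add (f : EuclideanSpace ℝ (Fin n) → ℝ) (a : ℝ) (b : EuclideanSpace ℝ (Fin n)) :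
    lap (fun y => f (a • y + b)) = fun y => a ^ 2 * lap f (a • y + b) := by
  have h1 : fderiv ℝ (fun y => f (a • y + b)) = fun y => a • fderiv ℝ f (a • y + b) := by
    ext1 y
    have := fderiv_comp_smul (𝕜 := ℝ) (f := fun z => f (z + b)) (x := y) a
    rw [this, fderiv_comp_add_right]
  have h2 : ∀ y, fderiv ℝ (fun y => a • fderiv ℝ f (a • y + b)) y =
      a • a • fderiv ℝ (fderiv ℝ f) (a • y + b) := by
    intro y
    have h3 := congrFun (fderiv_const_smul_field (𝕜 := ℝ)
      (f := fun y => fderiv ℝ f (a • y + b)) a) y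
    have h4 := fderiv_comp_smul (𝕜 := ℝ) (f := fun z => fderiv ℝ f (z + b)) (x := y) a
    rw [fderiv_comp_add_right] at h4
    exact h3.trans (by rw [Pi.smul_apply, h4])
  ext y
  simp only [lap_apply, h1, h2, Finset.mul_sum]
  refine Finset.sum_congr rfl fun i _ => ?_
  simp
  ring

lemma lap_const_mul (f : EuclideanSpace ℝ (Fin n) → ℝ) (c : ℝ) :
    lap (fun y => c * f y) = fun y => c * lap f y := by
  have h1 : fderiv ℝ (fun y => c * f y) = fun y => c • fderiv ℝ f y := by
    ext1 y
    exact congrFun (fderiv_const_smul_field (𝕜 := ℝ) (f := f) c) y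
  have h2 : ∀ y, fderiv ℝ (fun y => c • fderiv ℝ f y) y = c • fderiv ℝ (fderiv ℝ f) y := by
    intro y
    exact congrFun (fderiv_const_smul_field (𝕜 := ℝ) (f := fderiv ℝ f) c) y
  ext y
  simp only [lap_apply, h1, h2, Finset.mul_sum]
  simp

lemma bilap_comp_smul_add (f : EuclideanSpace ℝ (Fin n) → ℝ) (a : ℝ)
    (b : EuclideanSpace ℝ (Fin n)) :
    bilap (fun y => f (a • y + b)) = fun y => a ^ 4 * bilap f (a • y + b) := by
  unfold bilap
  rw [lap_comp_smul_add, lap_const_mul, lap_comp_smul_add]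
  ext y; ring

lemma lap_sub {f g : EuclideanSpace ℝ (Fin n) → ℝ} {x : EuclideanSpace ℝ (Fin n)}
    (hf : ContDiffAt ℝ 2 f x) (hg : ContDiffAt ℝ 2 g x) :
    lap (fun y => f y - g y) x = lap f x - lap g x := by
  have hd : ∀ᶠ y in 𝓝 x, fderiv ℝ (fun y => f y - g y) y = fderiv ℝ f y - fderiv ℝ g y := by
    filter_upwards [hf.eventually (by simp), hg.eventually (by simp)] with y h1 h2
    exact fderiv_fun_sub (h1.differentiableAt (by norm_num)) (h2.differentiableAt (by norm_num))
  have hf2 : DifferentiableAt ℝ (fderiv ℝ f) x :=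
    (hf.fderiv_right (m := 1) (by norm_num)).differentiableAt (by norm_num)
  have hg2 : DifferentiableAt ℝ (fderiv ℝ g) x :=
    (hg.fderiv_right (m := 1) (by norm_num)).differentiableAt (by norm_num)
  have h2 : fderiv ℝ (fderiv ℝ (fun y => f y - g y)) x =
      fderiv ℝ (fderiv ℝ f) x - fderiv ℝ (fderiv ℝ g) x := by
    rw [EventuallyEq.fderiv_eq hd]
    exact fderiv_fun_sub hf2 hg2
  simp [lap_apply, h2]

variable {P : Type*} [NormedAddCommGroup P] [NormedSpace ℝ P]

/-- The Laplacian in the first variable of a function of two variables. -/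
noncomputable def lapFst (F : EuclideanSpace ℝ (Fin n) × P → ℝ) :
    EuclideanSpace ℝ (Fin n) × P → ℝ :=
  fun q => ∑ i, fderiv ℝ (fun r => fderiv ℝ F r (EuclideanSpace.single i 1, 0)) q
    (EuclideanSpace.single i 1, 0)

lemma ContDiffAt.lapFst {F : EuclideanSpace ℝ (Fin n) × P → ℝ} {q : EuclideanSpace ℝ (Fin n) × P}
    {k m : WithTop ℕ∞} (h : ContDiffAt ℝ k F q) (hm : m + 2 ≤ k) :
    ContDiffAt ℝ m (_root_.lapFst F) q := by
  refine ContDiffAt.sum fun i _ => ?_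
  have h1 : ContDiffAt ℝ (m + 1) (fderiv ℝ F) q := h.fderiv_right (by rw [add_assoc]; exact hm)
  exact (((h1.clm_apply contDiffAt_const).fderiv_right le_rfl).clm_apply contDiffAt_const)

lemma lap_slice_eq {F : EuclideanSpace ℝ (Fin n) × P → ℝ} {q : EuclideanSpace ℝ (Fin n) × P}
    (h : ContDiffAt ℝ 2 F q) : lap (fun y => F (y, q.2)) q.1 = lapFst F q := by
  have hι : ∀ y : EuclideanSpace ℝ (Fin n), HasFDerivAt (fun y => (y, q.2))
      (ContinuousLinearMap.inl ℝ (EuclideanSpace ℝ (Fin n)) P) y := fun y =>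
    hasFDerivAt_prodMk_left y q.2
  have hsl : ContDiffAt ℝ 2 (fun y => F (y, q.2)) q.1 :=
    ContDiffAt.comp (g := F) q.1 (by simpa using h) (contDiffAt_id.prodMk contDiffAt_const)
  rw [lap_eq_sum_of_contDiffAt hsl, lapFst]
  refine Finset.sum_congr rfl fun i _ => ?_
  set e : EuclideanSpace ℝ (Fin n) := EuclideanSpace.single i 1
  have hcont : Tendsto (fun y : EuclideanSpace ℝ (Fin n) => (y, q.2)) (𝓝 q.1) (𝓝 q) := by
    have : Continuous fun y : EuclideanSpace ℝ (Fin n) => (y, q.2) := by fun_prop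
    exact this.tendsto q.1
  have h1 : (fun y => fderiv ℝ (fun y => F (y, q.2)) y e) =ᶠ[𝓝 q.1]
      fun y => fderiv ℝ F (y, q.2) (e, 0) := by
    filter_upwards [hcont.eventually (h.eventually (by simp))] with y hy
    have := ((hy.differentiableAt (by norm_num)).hasFDerivAt.comp y (hι y)).fderiv
    have h2 : fderiv ℝ (fun y => F (y, q.2)) y = (fderiv ℝ F (y, q.2)).comp
      (ContinuousLinearMap.inl ℝ (EuclideanSpace ℝ (Fin n)) P) := this
    rw [h2]
    simp
  rw [h1.fderiv_eq]
  have h3 : DifferentiableAt ℝ (fun r => fderiv ℝ F r (e, 0)) q :=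
    ((h.fderiv_right (m := 1) (by norm_num)).clm_apply contDiffAt_const).differentiableAt
      (by norm_num)
  have h4 : fderiv ℝ (fun y => fderiv ℝ F (y, q.2) (e, 0)) q.1 =
      (fderiv ℝ (fun r => fderiv ℝ F r (e, 0)) q).comp
        (ContinuousLinearMap.inl ℝ (EuclideanSpace ℝ (Fin n)) P) :=
    (HasFDerivAt.comp (g := fun r => fderiv ℝ F r (e, 0)) q.1 h3.hasFDerivAt (hι q.1)).fderiv
  rw [h4]
  simp

lemma continuousAt_bilap_slice {F : EuclideanSpace ℝ (Fin n) × P → ℝ}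
    {q : EuclideanSpace ℝ (Fin n) × P} (h : ContDiffAt ℝ 4 F q) :
    ContinuousAt (fun r => bilap (fun y => F (y, r.2)) r.1) q := by
  have h1 : (fun r : EuclideanSpace ℝ (Fin n) × P => bilap (fun y => F (y, r.2)) r.1) =ᶠ[𝓝 q]
      lapFst (lapFst F) := by
    filter_upwards [h.eventually (by simp)] with r hr
    have hcont : Tendsto (fun y : EuclideanSpace ℝ (Fin n) => (y, r.2)) (𝓝 r.1) (𝓝 r) := by
      have : Continuous fun y : EuclideanSpace ℝ (Fin n) => (y, r.2) := by fun_prop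
      exact this.tendsto r.1
    have h2 : lap (fun y => F (y, r.2)) =ᶠ[𝓝 r.1] fun y => lapFst F (y, r.2) := by
      filter_upwards [hcont.eventually (hr.eventually (by simp))] with y hy
      exact lap_slice_eq (q := (y, r.2)) (hy.of_le (by norm_num))
    rw [bilap, h2.lap.eq_of_nhds]
    exact lap_slice_eq (hr.lapFst (by norm_num))
  exact ((h.lapFst (m := 2) (by norm_num)).lapFst (m := 0) (by norm_num)).continuousAt.congr h1.symm

lemma hasFDerivAt_comp_norm_sq {G : ℝ → ℝ} {g : ℝ} {x : EuclideanSpace ℝ (Fin n)}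
    (h : HasDerivAt G g (‖x‖ ^ 2)) :
    HasFDerivAt (fun y => G (‖y‖ ^ 2)) ((2 * g) • innerSL ℝ x) x := by
  have h1 : HasFDerivAt (fun y : EuclideanSpace ℝ (Fin n) => ‖y‖ ^ 2) (2 • innerSL ℝ x) x :=
    (hasStrictFDerivAt_norm_sq x).hasFDerivAt
  have := h.comp_hasFDerivAt x h1
  refine this.congr_fderiv ?_
  ext v
  simp
  ring

/-- The Laplacian of a function of `‖y‖ ^ 2`. -/
lemma lap_comp_norm_sq {G G1 : ℝ → ℝ} {g2 : ℝ} {x : EuclideanSpace ℝ (Fin n)}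
    (h1 : ∀ᶠ s in 𝓝 (‖x‖ ^ 2), HasDerivAt G (G1 s) s) (h2 : HasDerivAt G1 g2 (‖x‖ ^ 2)) :
    lap (fun y : EuclideanSpace ℝ (Fin n) => G (‖y‖ ^ 2)) x =
      4 * ‖x‖ ^ 2 * g2 + 2 * n * G1 (‖x‖ ^ 2) := by
  have hcont : Tendsto (fun y : EuclideanSpace ℝ (Fin n) => ‖y‖ ^ 2) (𝓝 x) (𝓝 (‖x‖ ^ 2)) := by
    have : Continuous fun y : EuclideanSpace ℝ (Fin n) => ‖y‖ ^ 2 := by fun_prop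
    exact this.tendsto x
  have e1 : fderiv ℝ (fun y : EuclideanSpace ℝ (Fin n) => G (‖y‖ ^ 2)) =ᶠ[𝓝 x]
      fun y => (2 * G1 (‖y‖ ^ 2)) • innerSL ℝ y := by
    filter_upwards [hcont.eventually h1] with y hy
    exact (hasFDerivAt_comp_norm_sq hy).fderiv
  let J : EuclideanSpace ℝ (Fin n) →L[ℝ] EuclideanSpace ℝ (Fin n) →L[ℝ] ℝ := innerSL ℝ
  have hJ : ∀ v w, J v w = inner ℝ v w := fun v w => rfl
  have e2 : HasFDerivAt (fun y : EuclideanSpace ℝ (Fin n) => (2 * G1 (‖y‖ ^ 2)) • innerSL ℝ y)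
      ((2 * G1 (‖x‖ ^ 2)) • J +
        ((2 : ℝ) • ((2 * g2) • innerSL ℝ x)).smulRight (innerSL ℝ x)) x :=
    ((hasFDerivAt_comp_norm_sq h2).const_mul 2).smul
      J.hasFDerivAt
  rw [lap_apply, e1.fderiv_eq, e2.fderiv]
  have h3 : ∀ i : Fin n, inner ℝ x (EuclideanSpace.single i (1 : ℝ)) = x i := fun i => by
    simp [EuclideanSpace.inner_single_right]
  simp only [add_apply, smul_apply,
    ContinuousLinearMap.smulRight_apply, innerSL_apply_apply, hJ, h3, smul_eq_mul,
    Finset.sum_add_distrib]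
  have h4 : ∑ i : Fin n, x i * x i = ‖x‖ ^ 2 := by
    rw [EuclideanSpace.norm_sq_eq]
    exact Finset.sum_congr rfl fun i _ => by simp [sq]
  have h5 : ∑ i : Fin n, 2 * (2 * g2 * x i) * x i = 4 * g2 * ‖x‖ ^ 2 := by
    rw [← h4, Finset.mul_sum]
    exact Finset.sum_congr rfl fun i _ => by ring
  rw [h5]
  simp
  ring

end LaplacianCalculus

section TestFunctions

open Topology
open scoped ContDiff

variable {n : ℕ}

lemma exists_fderiv_pow_mul {g h : EuclideanSpace ℝ (Fin n) → ℝ} (hg : ContDiff ℝ ∞ g)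
    (hh : ContDiff ℝ ∞ h) (k : ℕ) (v : EuclideanSpace ℝ (Fin n)) :
    ∃ h' : EuclideanSpace ℝ (Fin n) → ℝ, ContDiff ℝ ∞ h' ∧
      (fun y => fderiv ℝ (fun z => g z ^ (k + 1) * h z) y v) = fun y => g y ^ k * h' y := by
  refine ⟨fun y => (k + 1) * fderiv ℝ g y v * h y + g y * fderiv ℝ h y v, ?_, ?_⟩
  · have h1 : ContDiff ℝ ∞ (fun y => fderiv ℝ g y v) :=
      (hg.fderiv_right (m := ∞) (by simp)).clm_apply contDiff_const
    have h2 : ContDiff ℝ ∞ (fun y => fderiv ℝ h y v) :=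
      (hh.fderiv_right (m := ∞) (by simp)).clm_apply contDiff_const
    exact ((contDiff_const.mul h1).mul hh).add (hg.mul h2)
  · ext y
    have h1 := (hg.differentiable (by simp) y).hasFDerivAt
    have h2 := (hh.differentiable (by simp) y).hasFDerivAt
    have := ((h1.pow (k + 1)).mul h2).fderiv
    have e : fderiv ℝ (fun z => g z ^ (k + 1) * h z) y = _ := this
    rw [e]
    simp
    ring

lemma exists_lap_pow_mul {g h : EuclideanSpace ℝ (Fin n) → ℝ} (hg : ContDiff ℝ ∞ g)
    (hh : ContDiff ℝ ∞ h) (k : ℕ) :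
    ∃ h' : EuclideanSpace ℝ (Fin n) → ℝ, ContDiff ℝ ∞ h' ∧
      lap (fun z => g z ^ (k + 2) * h z) = fun y => g y ^ k * h' y := by
  have h1 := fun i : Fin n => exists_fderiv_pow_mul hg hh (k + 1) (EuclideanSpace.single i 1)
  choose h1 hh1 e1 using h1
  have h2 := fun i : Fin n => exists_fderiv_pow_mul hg (hh1 i) k (EuclideanSpace.single i 1)
  choose h2 hh2 e2 using h2
  refine ⟨fun y => ∑ i, h2 i y, ContDiff.sum fun i _ => hh2 i, ?_⟩
  ext y
  have hc : ContDiff ℝ ∞ fun z => g z ^ (k + 2) * h z := (hg.pow _).mul hh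
  rw [lap_eq_sum_of_contDiffAt (by exact_mod_cast (contDiff_infty.mp hc 2).contDiffAt),
    Finset.mul_sum]
  refine Finset.sum_congr rfl fun i _ => ?_
  rw [e1 i]
  exact congrFun (e2 i) y

lemma exists_bilap_pow {g : EuclideanSpace ℝ (Fin n) → ℝ} (hg : ContDiff ℝ ∞ g) (k : ℕ) :
    ∃ h' : EuclideanSpace ℝ (Fin n) → ℝ, ContDiff ℝ ∞ h' ∧
      bilap (fun z => g z ^ (k + 4)) = fun y => g y ^ k * h' y := by
  obtain ⟨h1, hh1, e1⟩ := exists_lap_pow_mul (h := fun _ => 1) hg contDiff_const (k + 2)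
  obtain ⟨h2, hh2, e2⟩ := exists_lap_pow_mul hg hh1 k
  refine ⟨h2, hh2, ?_⟩
  rw [← e2, ← e1]
  simp [bilap]

/-- A smooth function equal to `1` on `1 ≤ ‖y‖ ≤ 2` and supported in `1/2 ≤ ‖y‖ ≤ 3`. -/
lemma exists_annular_cutoff (n : ℕ) : ∃ g : EuclideanSpace ℝ (Fin n) → ℝ, ContDiff ℝ ∞ g ∧
    (∀ y, 0 ≤ g y) ∧ (∀ y, g y ≤ 1) ∧ (∀ y, 1 ≤ ‖y‖ → ‖y‖ ≤ 2 → g y = 1) ∧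
    (∀ y, ‖y‖ < 1 / 2 → g y = 0) ∧ (∀ y, 3 ≤ ‖y‖ → g y = 0) := by
  let b1 : ContDiffBump (0 : EuclideanSpace ℝ (Fin n)) := ⟨2, 3, by norm_num, by norm_num⟩
  let b2 : ContDiffBump (0 : EuclideanSpace ℝ (Fin n)) := ⟨1 / 2, 1, by norm_num, by norm_num⟩
  have hb1 : ∀ y : EuclideanSpace ℝ (Fin n), ‖y‖ ≤ 2 → b1 y = 1 := fun y hy =>
    b1.one_of_mem_closedBall (by simpa using hy)
  have hb2 : ∀ y : EuclideanSpace ℝ (Fin n), 1 ≤ ‖y‖ → b2 y = 0 := fun y hy =>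
    b2.zero_of_le_dist (by simpa using hy)
  refine ⟨fun y => b1 y - b2 y, b1.contDiff.sub b2.contDiff, fun y => ?_, fun y => ?_, ?_, ?_, ?_⟩
  · rcases le_total 1 ‖y‖ with h | h
    · simp [hb2 y h, b1.nonneg]
    · simp [hb1 y (by linarith), b2.le_one]
  · have := b2.nonneg (x := y)
    have := b1.le_one (x := y)
    linarith
  · intro y h1 h2
    simp [hb1 y h2, hb2 y h1]
  · intro y h
    have : b2 y = 1 := b2.one_of_mem_closedBall (mem_closedBall_zero_iff.mpr h.le)
    simp [hb1 y (by linarith), this]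
  · intro y h
    have : b1 y = 0 := b1.zero_of_le_dist (by simpa using h)
    simp [this, hb2 y (by linarith)]

/-- Test functions `Φ` on the annulus with `|Δ² Φ| ≤ M Φ ^ (1 / p)`. -/
lemma exists_test_function (n : ℕ) {p : ℝ} (hp : 1 < p) :
    ∃ Φ : EuclideanSpace ℝ (Fin n) → ℝ, ∃ M > 0, ContDiff ℝ ∞ Φ ∧ (∀ y, 0 ≤ Φ y) ∧
    (∀ y, 1 ≤ ‖y‖ → ‖y‖ ≤ 2 → Φ y = 1) ∧ (∀ y, ‖y‖ < 1 / 2 → Φ y = 0) ∧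
    (∀ y, 3 ≤ ‖y‖ → Φ y = 0) ∧ ∀ y, |bilap Φ y| ≤ M * Φ y ^ (1 / p) := by
  obtain ⟨g, hg, g0, g1, hg1, hgs, hgl⟩ := exists_annular_cutoff n
  obtain ⟨k, hk⟩ := exists_nat_gt (4 / (p - 1))
  have hp1 : 0 < p - 1 := by linarith
  have hk0 : (0 : ℝ) < k := lt_trans (by positivity) hk
  have hk0' : k ≠ 0 := by rintro rfl; simp at hk0
  obtain ⟨h, hh, e⟩ := exists_bilap_pow hg k
  obtain ⟨M, hM⟩ := (isCompact_closedBall (0 : EuclideanSpace ℝ (Fin n)) 3).exists_bound_of_continuousOn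
    hh.continuous.continuousOn
  refine ⟨fun y => g y ^ (k + 4), max M 1, by positivity, hg.pow _, fun y => pow_nonneg (g0 y) _,
    fun y h1 h2 => by simp [hg1 y h1 h2], fun y h1 => by simp [hgs y h1],
    fun y h1 => by simp [hgl y h1], fun y => ?_⟩
  rw [e]
  simp only
  rw [abs_mul, abs_of_nonneg (pow_nonneg (g0 y) _)]
  rcases le_total ‖y‖ 3 with hy | hy
  · have h1 : |h y| ≤ max M 1 := (hM y (by simpa using hy)).trans (le_max_left _ _)
    have h2 : g y ^ k ≤ (g y ^ (k + 4)) ^ (1 / p) := by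
      rcases (g0 y).eq_or_lt with h0 | h0
      · rw [← h0, zero_pow hk0']
        positivity
      · rw [← Real.rpow_natCast, ← Real.rpow_natCast, ← Real.rpow_mul h0.le]
        refine Real.rpow_le_rpow_of_exponent_ge h0 (g1 y) ?_
        rw [mul_one_div, div_le_iff₀ (by linarith)]
        rw [div_lt_iff₀ hp1] at hk
        push_cast
        linarith
    rw [mul_comm]
    have := pow_nonneg (g0 y) k
    gcongr
  · rw [hgl y hy, zero_pow hk0']
    simp only [zero_mul]
    positivity

lemma mul_le_half_rpow_add {X Y p : ℝ} (hp : 1 < p) (hX : 0 ≤ X) (hY : 0 ≤ Y) :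
    X * Y ≤ 1 / 2 * X ^ p + (2 * Y) ^ (p / (p - 1)) := by
  have hp1 : 0 < p - 1 := by linarith
  have n1 : 0 ≤ X ^ p := by positivity
  have n2 : 0 ≤ (2 * Y) ^ (p / (p - 1)) := by positivity
  rcases hX.eq_or_lt with h0 | h0
  · rw [← h0] at n1 ⊢; linarith
  rcases le_total (2 * Y) (X ^ (p - 1)) with h | h
  · have e : X * X ^ (p - 1) = X ^ p := by
      rw [Real.rpow_sub_one h0.ne']; field_simp
    have : X * (2 * Y) ≤ X * X ^ (p - 1) := by gcongr
    linarith
  · have h1 : X ≤ (2 * Y) ^ (1 / (p - 1)) := by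
      have := Real.rpow_le_rpow (by positivity) h (show 0 ≤ 1 / (p - 1) by positivity)
      rwa [← Real.rpow_mul hX, mul_one_div_cancel hp1.ne', Real.rpow_one] at this
    have hY0 : 0 < 2 * Y := lt_of_lt_of_le (by positivity) h
    have e : (2 * Y) ^ (p / (p - 1)) = (2 * Y) ^ (1 / (p - 1)) * (2 * Y) := by
      rw [← Real.rpow_add_one hY0.ne']
      congr 1; field_simp; ring
    rw [e]
    have : X * Y ≤ (2 * Y) ^ (1 / (p - 1)) * (2 * Y) := by
      gcongr; linarith
    linarith

end TestFunctions

section PuncturedSolutions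

open Topology
open scoped ContDiff

/-- A nonnegative `C⁴` solution of `Δ²u = u ^ p` in the punctured unit ball, where
`p > n / (n - 4)`. -/
structure IsPuncturedSolution (n : ℕ) (p : ℝ) (u : EuclideanSpace ℝ (Fin n) → ℝ) : Prop where
  five_le : 5 ≤ n
  one_lt : 1 < p
  supercrit : (n : ℝ) < p * (n - 4)
  reg : ∀ x ∈ ball (0 : EuclideanSpace ℝ (Fin n)) 1 \ {0}, ContDiffAt ℝ 4 u x
  nonneg : ∀ x ∈ ball (0 : EuclideanSpace ℝ (Fin n)) 1 \ {0}, 0 ≤ u x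
  eqn : ∀ x ∈ ball (0 : EuclideanSpace ℝ (Fin n)) 1 \ {0}, bilap u x = u x ^ p

/-- The closed shell `a ≤ ‖y‖ ≤ b`. -/
def shell (n : ℕ) (a b : ℝ) : Set (EuclideanSpace ℝ (Fin n)) := {y | a ≤ ‖y‖ ∧ ‖y‖ ≤ b}

lemma mem_shell {n : ℕ} {a b : ℝ} {y : EuclideanSpace ℝ (Fin n)} :
    y ∈ shell n a b ↔ a ≤ ‖y‖ ∧ ‖y‖ ≤ b := Iff.rfl

lemma isClosed_shell (n : ℕ) (a b : ℝ) : IsClosed (shell n a b) :=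
  (isClosed_le continuous_const continuous_norm).inter
    (isClosed_le continuous_norm continuous_const)

lemma shell_subset_closedBall (n : ℕ) (a b : ℝ) : shell n a b ⊆ closedBall 0 b := fun _ hy =>
  mem_closedBall_zero_iff.mpr hy.2

lemma isCompact_shell (n : ℕ) (a b : ℝ) : IsCompact (shell n a b) :=
  (isCompact_closedBall _ _).of_isClosed_subset (isClosed_shell n a b)
    (shell_subset_closedBall n a b)

lemma shell_subset_ball {n : ℕ} {a b : ℝ} (ha : 0 < a) (hb : b < 1) :
    shell n a b ⊆ ball 0 1 \ {0} := fun _ hy =>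
  ⟨mem_ball_zero_iff.mpr (hy.2.trans_lt hb), norm_pos_iff.mp (ha.trans_le hy.1)⟩

lemma volume_real_shell_le (n : ℕ) (a : ℝ) {b : ℝ} (hb : 0 ≤ b) :
    volume.real (shell n a b) ≤
      b ^ n * volume.real (ball (0 : EuclideanSpace ℝ (Fin n)) 1) := by
  have h := Measure.addHaar_real_closedBall volume (0 : EuclideanSpace ℝ (Fin n)) hb
  rw [finrank_euclideanSpace_fin] at h
  rw [← h]
  exact measureReal_mono (shell_subset_closedBall n a b) measure_closedBall_lt_top.ne

namespace IsPuncturedSolution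

variable {n : ℕ} {p : ℝ} {u : EuclideanSpace ℝ (Fin n) → ℝ}

lemma isOpen_domain : IsOpen (ball (0 : EuclideanSpace ℝ (Fin n)) 1 \ {0}) :=
  isOpen_ball.sdiff isClosed_singleton

lemma continuousOn (h : IsPuncturedSolution n p u) : ContinuousOn u (ball 0 1 \ {0}) := fun x hx =>
  (h.reg x hx).continuousAt.continuousWithinAt

lemma continuousOn_rpow (h : IsPuncturedSolution n p u) :
    ContinuousOn (fun y => u y ^ p) (ball 0 1 \ {0}) :=
  h.continuousOn.rpow_const fun _ _ => Or.inr (by linarith [h.one_lt])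

lemma integral_mul_bilap (h : IsPuncturedSolution n p u) {φ : EuclideanSpace ℝ (Fin n) → ℝ}
    (hφ : ContDiff ℝ 4 φ) (hφc : HasCompactSupport φ) (hφs : tsupport φ ⊆ ball 0 1 \ {0}) :
    ∫ y, u y * bilap φ y = ∫ y, u y ^ p * φ y := by
  rw [integral_mul_bilap_eq isOpen_domain h.reg hφ hφc hφs]
  refine integral_congr_ae (Eventually.of_forall fun y => ?_)
  by_cases hy : y ∈ ball (0 : EuclideanSpace ℝ (Fin n)) 1 \ {0}
  · simp only [h.eqn y hy]
  · have : φ y = 0 := by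
      by_contra h0
      exact hy (hφs (subset_tsupport _ h0))
    simp [this]

lemma exponent_pos (h : IsPuncturedSolution n p u) : 0 < (n : ℝ) - 4 * (p / (p - 1)) := by
  have h1 : 0 < p - 1 := by linarith [h.one_lt]
  rw [sub_pos, ← mul_div_assoc, div_lt_iff₀ h1]
  linarith [h.supercrit]

lemma exists_shell_integral_rpow_le (h : IsPuncturedSolution n p u) :
    ∃ C > 0, ∀ r, 0 < r → 3 * r < 1 → IntegrableOn (fun y => u y ^ p) (shell n r (2 * r)) ∧
      ∫ y in shell n r (2 * r), u y ^ p ≤ C * r ^ ((n : ℝ) - 4 * (p / (p - 1))) := by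
  obtain ⟨Φ, M, hM, hΦ, Φ0, Φ1, Φs, Φl, hb⟩ := exists_test_function n h.one_lt
  have hp0 : 0 < p := by linarith [h.one_lt]
  have hp1 : 0 < p - 1 := by linarith [h.one_lt]
  set V := volume.real (ball (0 : EuclideanSpace ℝ (Fin n)) 1) with hV
  have hV0 : 0 ≤ V := measureReal_nonneg
  refine ⟨2 * ((2 * M) ^ (p / (p - 1)) * (3 ^ n * V)) + 1, by positivity, fun r hr hr3 => ?_⟩
  have hsub : shell n (r / 2) (3 * r) ⊆ ball 0 1 \ {0} := shell_subset_ball (by positivity) hr3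
  have hsub2 : shell n r (2 * r) ⊆ ball 0 1 \ {0} := shell_subset_ball hr (by linarith)
  have hint : IntegrableOn (fun y => u y ^ p) (shell n r (2 * r)) :=
    (h.continuousOn_rpow.mono hsub2).integrableOn_compact (isCompact_shell _ _ _)
  refine ⟨hint, ?_⟩
  set φ : EuclideanSpace ℝ (Fin n) → ℝ := fun y => Φ (r⁻¹ • y) with hφd
  have hφ : ContDiff ℝ 4 φ := by
    have : ContDiff ℝ ∞ φ := hΦ.comp (contDiff_const_smul _)
    exact_mod_cast contDiff_infty.mp this 4
  have hnorm : ∀ y : EuclideanSpace ℝ (Fin n), ‖r⁻¹ • y‖ = ‖y‖ / r := fun y => by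
    rw [norm_smul, norm_inv, Real.norm_of_nonneg hr.le]; field_simp
  have hφ0 : ∀ y, y ∉ shell n (r / 2) (3 * r) → φ y = 0 := by
    intro y hy
    rw [mem_shell, not_and_or, not_le, not_le] at hy
    rcases hy with hy | hy
    · exact Φs _ (by rw [hnorm, div_lt_iff₀ hr]; linarith)
    · exact Φl _ (by rw [hnorm, le_div_iff₀ hr]; linarith)
  have hφs : tsupport φ ⊆ shell n (r / 2) (3 * r) := by
    refine closure_minimal (fun y hy => ?_) (isClosed_shell _ _ _)
    by_contra h0
    exact hy (hφ0 y h0)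
  have hφc : HasCompactSupport φ := (isCompact_shell _ _ _).of_isClosed_subset
    (isClosed_tsupport _) hφs
  have hbl : ∀ y, bilap φ y = (r⁻¹) ^ 4 * bilap Φ (r⁻¹ • y) := by
    intro y
    have := congrFun (bilap_comp_smul_add Φ r⁻¹ 0) y
    simpa using this
  have hweak := h.integral_mul_bilap hφ hφc (hφs.trans hsub)
  have hI1 : Integrable fun y => u y ^ p * φ y :=
    integrable_mul_of_tsupport_subset isOpen_domain h.continuousOn_rpow hφ.continuous hφc
      (hφs.trans hsub)
  have hblc : Continuous (bilap φ) := by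
    have : ContDiff ℝ 0 (bilap φ) := contDiff_iff_contDiffAt.mpr fun x =>
      (hφ.contDiffAt.lap (m := 2) (by norm_num)).lap (by norm_num)
    exact this.continuous
  have hbls : tsupport (bilap φ) ⊆ tsupport φ :=
    (tsupport_lap_subset _).trans (tsupport_lap_subset _)
  have hI2 : Integrable fun y => u y * bilap φ y :=
    integrable_mul_of_tsupport_subset isOpen_domain h.continuousOn hblc
      (hφc.mono' ((subset_tsupport _).trans hbls)) ((hbls.trans hφs).trans hsub)
  set K := (2 * ((r⁻¹) ^ 4 * M)) ^ (p / (p - 1)) with hK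
  have hK0 : 0 ≤ K := by positivity
  have hS := (isClosed_shell n (r / 2) (3 * r)).measurableSet
  have hSfin : volume (shell n (r / 2) (3 * r)) ≠ ⊤ := (isCompact_shell _ _ _).measure_lt_top.ne
  have hI3 : Integrable (Set.indicator (shell n (r / 2) (3 * r)) fun _ => K) :=
    (integrable_indicator_iff hS).mpr (integrableOn_const hSfin)
  have hpt : ∀ y, u y * bilap φ y ≤
      1 / 2 * (u y ^ p * φ y) + Set.indicator (shell n (r / 2) (3 * r)) (fun _ => K) y := by
    intro y
    by_cases hy : y ∈ shell n (r / 2) (3 * r)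
    · have hu := h.nonneg y (hsub hy)
      have hΦy := Φ0 (r⁻¹ • y)
      rw [Set.indicator_of_mem hy, hbl]
      have h1 := mul_le_half_rpow_add (X := u y * Φ (r⁻¹ • y) ^ (1 / p)) (Y := (r⁻¹) ^ 4 * M)
        h.one_lt (by positivity) (by positivity)
      rw [Real.mul_rpow hu (by positivity), ← Real.rpow_mul hΦy, one_div_mul_cancel hp0.ne',
        Real.rpow_one] at h1
      refine le_trans ?_ h1
      have h2 : bilap Φ (r⁻¹ • y) ≤ M * Φ (r⁻¹ • y) ^ (1 / p) := (le_abs_self _).trans (hb _)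
      calc u y * ((r⁻¹) ^ 4 * bilap Φ (r⁻¹ • y))
          ≤ u y * ((r⁻¹) ^ 4 * (M * Φ (r⁻¹ • y) ^ (1 / p))) := by gcongr
        _ = _ := by ring
    · have h1 : bilap φ y = 0 := by
        by_contra h0
        exact hy ((hbls.trans hφs) (subset_tsupport _ h0))
      simp [Set.indicator_of_notMem hy, h1, hφ0 y hy]
  have hle := integral_mono hI2 ((hI1.const_mul (1 / 2)).add hI3) hpt
  simp only [Pi.add_apply] at hle
  rw [integral_add (hI1.const_mul (1 / 2)) hI3, integral_const_mul, integral_indicator hS,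
    setIntegral_const, hweak, smul_eq_mul] at hle
  have hvol := volume_real_shell_le n (r / 2) (show 0 ≤ 3 * r by positivity)
  rw [← hV] at hvol
  have hvolK : volume.real (shell n (r / 2) (3 * r)) * K ≤ (3 * r) ^ n * V * K := by gcongr
  have hKe : (3 * r) ^ n * V * K =
      (2 * M) ^ (p / (p - 1)) * (3 ^ n * V) * r ^ ((n : ℝ) - 4 * (p / (p - 1))) := by
    have : K = (2 * M) ^ (p / (p - 1)) * r ^ (-(4 * (p / (p - 1)))) := by
      rw [hK, show 2 * ((r⁻¹) ^ 4 * M) = 2 * M * (r⁻¹) ^ 4 by ring,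
        Real.mul_rpow (by positivity) (by positivity), ← Real.rpow_natCast (r⁻¹) 4,
        ← Real.rpow_mul (by positivity), Real.inv_rpow hr.le, ← Real.rpow_neg hr.le]
      norm_num
    rw [this, sub_eq_add_neg (n : ℝ), Real.rpow_add hr, Real.rpow_natCast, mul_pow]
    ring
  have hlow : ∫ y in shell n r (2 * r), u y ^ p ≤ ∫ y, u y ^ p * φ y := by
    rw [← integral_indicator (isClosed_shell _ _ _).measurableSet]
    refine integral_mono ((integrable_indicator_iff (isClosed_shell _ _ _).measurableSet).mpr hint)
      hI1 fun y => ?_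
    by_cases hy : y ∈ shell n r (2 * r)
    · have : φ y = 1 := Φ1 _ (by rw [hnorm, le_div_iff₀ hr]; linarith [hy.1])
        (by rw [hnorm, div_le_iff₀ hr]; linarith [hy.2])
      simp [Set.indicator_of_mem hy, this]
    · simp only [Set.indicator_of_notMem hy]
      by_cases hy2 : y ∈ shell n (r / 2) (3 * r)
      · exact mul_nonneg (Real.rpow_nonneg (h.nonneg y (hsub hy2)) _) (Φ0 _)
      · simp [hφ0 y hy2]
  have hpos : 0 ≤ r ^ ((n : ℝ) - 4 * (p / (p - 1))) := by positivity
  linarith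

lemma exists_shell_integral_le (h : IsPuncturedSolution n p u) :
    ∃ C > 0, ∀ r, 0 < r → 3 * r < 1 →
      r⁻¹ ^ 4 * ∫ y in shell n r (2 * r), u y ≤ C * r ^ ((n : ℝ) - 4 * (p / (p - 1))) := by
  obtain ⟨C, hC, H⟩ := h.exists_shell_integral_rpow_le
  have hp1 : 0 < p - 1 := by linarith [h.one_lt]
  set V := volume.real (ball (0 : EuclideanSpace ℝ (Fin n)) 1) with hV
  have hV0 : 0 ≤ V := measureReal_nonneg
  refine ⟨C + 2 ^ (p / (p - 1)) * (2 ^ n * V), by positivity, fun r hr hr3 => ?_⟩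
  obtain ⟨hint, hle⟩ := H r hr hr3
  have hsub2 : shell n r (2 * r) ⊆ ball 0 1 \ {0} := shell_subset_ball hr (by linarith)
  have hS := (isClosed_shell n r (2 * r)).measurableSet
  have hSfin : volume (shell n r (2 * r)) ≠ ⊤ := (isCompact_shell _ _ _).measure_lt_top.ne
  have hintu : IntegrableOn u (shell n r (2 * r)) :=
    (h.continuousOn.mono hsub2).integrableOn_compact (isCompact_shell _ _ _)
  set K := (2 * (r⁻¹) ^ 4) ^ (p / (p - 1)) with hK
  have hK0 : 0 ≤ K := by positivity
  have hmono := setIntegral_mono_on (hintu.const_mul (r⁻¹ ^ 4))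
    ((hint.const_mul (1 / 2)).add (integrableOn_const hSfin (C := K))) hS (fun y hy => by
      have := mul_le_half_rpow_add (X := u y) (Y := (r⁻¹) ^ 4) h.one_lt
        (h.nonneg y (hsub2 hy)) (by positivity)
      simp only [Pi.add_apply]
      linarith)
  simp only [Pi.add_apply] at hmono
  rw [integral_const_mul, integral_add (hint.const_mul (1 / 2)) (integrableOn_const hSfin),
    integral_const_mul, setIntegral_const, smul_eq_mul] at hmono
  have hn0 : 0 ≤ ∫ y in shell n r (2 * r), u y ^ p := setIntegral_nonneg hS fun y hy =>
    Real.rpow_nonneg (h.nonneg y (hsub2 hy)) _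
  have hvol := volume_real_shell_le n r (show 0 ≤ 2 * r by positivity)
  rw [← hV] at hvol
  have hvolK : volume.real (shell n r (2 * r)) * K ≤ (2 * r) ^ n * V * K := by gcongr
  have hKe : (2 * r) ^ n * V * K =
      2 ^ (p / (p - 1)) * (2 ^ n * V) * r ^ ((n : ℝ) - 4 * (p / (p - 1))) := by
    have : K = 2 ^ (p / (p - 1)) * r ^ (-(4 * (p / (p - 1)))) := by
      rw [hK, Real.mul_rpow (by positivity) (by positivity), ← Real.rpow_natCast (r⁻¹) 4,
        ← Real.rpow_mul (by positivity), Real.inv_rpow hr.le, ← Real.rpow_neg hr.le]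
      norm_num
    rw [this, sub_eq_add_neg (n : ℝ), Real.rpow_add hr, Real.rpow_natCast, mul_pow]
    ring
  linarith

lemma aestronglyMeasurable_of_continuousOn {f : EuclideanSpace ℝ (Fin n) → ℝ} {ρ : ℝ}
    (hρ : ρ ≤ 1) (hf : ContinuousOn f (ball 0 1 \ {0})) :
    AEStronglyMeasurable f (volume.restrict (ball 0 ρ \ {0})) :=
  (hf.mono (Set.sdiff_subset_sdiff_left (ball_subset_ball hρ))).aestronglyMeasurable
    (isOpen_ball.sdiff isClosed_singleton).measurableSet

lemma integrableOn_rpow (h : IsPuncturedSolution n p u) :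
    IntegrableOn (fun y => u y ^ p) (ball 0 (1 / 2) \ {0}) := by
  obtain ⟨C, hC, H⟩ := h.exists_shell_integral_rpow_le
  set s := (n : ℝ) - 4 * (p / (p - 1)) with hs
  have hs0 : 0 < s := h.exponent_pos
  have hr : ∀ k : ℕ, 0 < ((1 : ℝ) / 2) ^ (k + 2) ∧ 3 * ((1 : ℝ) / 2) ^ (k + 2) < 1 := fun k => by
    refine ⟨by positivity, ?_⟩
    have : ((1 : ℝ) / 2) ^ (k + 2) ≤ (1 / 2) ^ 2 :=
      pow_le_pow_of_le_one (by norm_num) (by norm_num) (by omega)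
    linarith
  have hun : IntegrableOn (fun y => u y ^ p)
      (⋃ k : ℕ, shell n (((1 : ℝ) / 2) ^ (k + 2)) (2 * ((1 : ℝ) / 2) ^ (k + 2))) := by
    refine integrableOn_iUnion_of_summable_integral_norm
      (fun k => (H _ (hr k).1 (hr k).2).1) ?_
    refine Summable.of_nonneg_of_le (fun k => integral_nonneg fun y => norm_nonneg _)
      (fun k => ?_) (f := fun k : ℕ => C * (((1 : ℝ) / 2) ^ s) ^ (k + 2)) ?_
    · have hsub : shell n (((1 : ℝ) / 2) ^ (k + 2)) (2 * ((1 : ℝ) / 2) ^ (k + 2)) ⊆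
          ball 0 1 \ {0} := shell_subset_ball (hr k).1 (by linarith [hr k])
      refine le_trans (le_of_eq ?_) ((H _ (hr k).1 (hr k).2).2.trans (le_of_eq ?_))
      · refine setIntegral_congr_fun (isClosed_shell _ _ _).measurableSet fun y hy => ?_
        exact Real.norm_of_nonneg (Real.rpow_nonneg (h.nonneg y (hsub hy)) _)
      · rw [← Real.rpow_natCast, ← Real.rpow_natCast, ← Real.rpow_mul (by norm_num),
          ← Real.rpow_mul (by norm_num), mul_comm s]
    · refine ((summable_nat_add_iff 2).mpr (summable_geometric_of_lt_one (by positivity) ?_)).mul_left C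
      exact Real.rpow_lt_one (by norm_num) (by norm_num) hs0
  refine hun.mono_set fun y hy => ?_
  have hy0 : 0 < ‖y‖ := norm_pos_iff.mpr hy.2
  have hy1 : ‖y‖ < 1 / 2 := mem_ball_zero_iff.mp hy.1
  obtain ⟨k, hk1, hk2⟩ := exists_nat_pow_near_of_lt_one (x := 2 * ‖y‖) (y := (1 : ℝ) / 2)
    (by positivity) (by linarith) (by norm_num) (by norm_num)
  refine Set.mem_iUnion.mpr ⟨k, ?_, ?_⟩
  · rw [pow_succ] at hk1 ⊢
    rw [pow_succ]
    linarith
  · rw [pow_succ, pow_succ]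
    linarith

lemma integrableOn (h : IsPuncturedSolution n p u) : IntegrableOn u (ball 0 (1 / 2) \ {0}) := by
  have hfin : volume (ball (0 : EuclideanSpace ℝ (Fin n)) (1 / 2) \ {0}) ≠ ⊤ :=
    (measure_mono Set.sdiff_subset).trans_lt measure_ball_lt_top |>.ne
  refine Integrable.mono' ((integrableOn_const (C := (1 : ℝ)) hfin).add h.integrableOn_rpow)
    (aestronglyMeasurable_of_continuousOn (by norm_num) h.continuousOn) ?_
  refine (ae_restrict_iff' (isOpen_ball.sdiff isClosed_singleton).measurableSet).mpr
    (Eventually.of_forall fun y hy => ?_)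
  have hy' : y ∈ ball (0 : EuclideanSpace ℝ (Fin n)) 1 \ {0} :=
    ⟨ball_subset_ball (by norm_num) hy.1, hy.2⟩
  have h0 := h.nonneg y hy'
  rw [Real.norm_of_nonneg h0]
  simp only [Pi.add_apply]
  rcases le_total (u y) 1 with h1 | h1
  · have := Real.rpow_nonneg h0 p
    linarith
  · have := Real.self_le_rpow_of_one_le h1 h.one_lt.le
    linarith

end IsPuncturedSolution

end PuncturedSolutions

section Extension

open Topology
open scoped ContDiff

variable {n : ℕ}

lemma tsupport_bilap_subset (φ : EuclideanSpace ℝ (Fin n) → ℝ) :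
    tsupport (bilap φ) ⊆ tsupport φ :=
  (tsupport_lap_subset _).trans (tsupport_lap_subset _)

lemma ContDiff.continuous_bilap {φ : EuclideanSpace ℝ (Fin n) → ℝ} (hφ : ContDiff ℝ 4 φ) :
    Continuous (bilap φ) := by
  have : ContDiff ℝ 0 (bilap φ) := contDiff_iff_contDiffAt.mpr fun x =>
    (hφ.contDiffAt.lap (m := 2) (by norm_num)).lap (by norm_num)
  exact this.continuous

lemma bilap_eq_zero_of_notMem {φ : EuclideanSpace ℝ (Fin n) → ℝ} {y : EuclideanSpace ℝ (Fin n)}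
    (hy : y ∉ tsupport φ) : bilap φ y = 0 := by
  by_contra h0
  exact hy (tsupport_bilap_subset φ (subset_tsupport _ h0))

lemma eventually_punctured_near_zero (y : EuclideanSpace ℝ (Fin n)) (hy : y ≠ 0) :
    ∀ᶠ ε : ℝ in 𝓝[>] 0, 2 * ε < ‖y‖ := by
  have hy0 : 0 < ‖y‖ / 2 := by have := norm_pos_iff.mpr hy; positivity
  filter_upwards [Ioo_mem_nhdsGT hy0] with ε hε
  linarith [hε.2]

namespace IsPuncturedSolution

variable {p : ℝ} {u : EuclideanSpace ℝ (Fin n) → ℝ}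

lemma integral_mul_bilap_of_ball (h : IsPuncturedSolution n p u)
    {φ : EuclideanSpace ℝ (Fin n) → ℝ} (hφ : ContDiff ℝ 4 φ) (hφc : HasCompactSupport φ)
    (hφs : tsupport φ ⊆ ball 0 (1 / 2)) :
    ∫ y in ball 0 (1 / 2) \ {0}, u y * bilap φ y = ∫ y in ball 0 (1 / 2) \ {0}, u y ^ p * φ y := by
  set D : Set (EuclideanSpace ℝ (Fin n)) := ball 0 (1 / 2) \ {0} with hD
  have hDm : MeasurableSet D := (isOpen_ball.sdiff isClosed_singleton).measurableSet
  have hD1 : D ⊆ ball 0 1 \ {0} :=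
    Set.sdiff_subset_sdiff_left (ball_subset_ball (by norm_num))
  let η : ContDiffBump (0 : EuclideanSpace ℝ (Fin n)) := ⟨1, 2, by norm_num, by norm_num⟩
  have hη4 : ContDiff ℝ 4 (η : EuclideanSpace ℝ (Fin n) → ℝ) := η.contDiff
  have hη1 : ∀ z : EuclideanSpace ℝ (Fin n), ‖z‖ ≤ 1 → η z = 1 := fun z hz =>
    η.one_of_mem_closedBall (mem_closedBall_zero_iff.mpr hz)
  have hη2 : ∀ z : EuclideanSpace ℝ (Fin n), 2 ≤ ‖z‖ → η z = 0 := fun z hz =>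
    η.zero_of_le_dist (by simpa using hz)
  have hη01 : ∀ z, 0 ≤ 1 - η z ∧ 1 - η z ≤ 1 := fun z =>
    ⟨by linarith [η.le_one (x := z)], by linarith [η.nonneg (x := z)]⟩
  set F : EuclideanSpace ℝ (Fin n) × ℝ → ℝ := fun q => φ (q.2 • q.1) * (1 - η q.1) with hF
  have hFc : ContDiff ℝ 4 F :=
    (hφ.comp (contDiff_snd.smul contDiff_fst)).mul (contDiff_const.sub (hη4.comp contDiff_fst))
  have hFb : Continuous fun r : EuclideanSpace ℝ (Fin n) × ℝ => bilap (fun y => F (y, r.2)) r.1 :=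
    continuous_iff_continuousAt.mpr fun q => continuousAt_bilap_slice hFc.contDiffAt
  obtain ⟨M, hM⟩ := ((isCompact_closedBall (0 : EuclideanSpace ℝ (Fin n)) 2).prod
    (isCompact_Icc (a := (0 : ℝ)) (b := 1))).exists_bound_of_continuousOn hFb.continuousOn
  set ψ : ℝ → EuclideanSpace ℝ (Fin n) → ℝ := fun ε y => φ y * (1 - η (ε⁻¹ • y)) with hψ
  have hnorm : ∀ ε : ℝ, 0 < ε → ∀ y : EuclideanSpace ℝ (Fin n), ‖ε⁻¹ • y‖ = ‖y‖ / ε := by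
    intro ε hε y
    rw [norm_smul, norm_inv, Real.norm_of_nonneg hε.le]; field_simp
  have hψ4 : ∀ ε, ContDiff ℝ 4 (ψ ε) := fun ε =>
    hφ.mul (contDiff_const.sub (hη4.comp (contDiff_const_smul _)))
  have hψfar : ∀ ε, 0 < ε → ∀ y, 2 * ε ≤ ‖y‖ → ψ ε y = φ y := by
    intro ε hε y hy
    simp only [hψ]
    rw [hη2 _ (by rw [hnorm ε hε, le_div_iff₀ hε]; exact hy)]
    ring
  have hψnear : ∀ ε, 0 < ε → ∀ y, ‖y‖ ≤ ε → ψ ε y = 0 := by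
    intro ε hε y hy
    simp only [hψ]
    rw [hη1 _ (by rw [hnorm ε hε, div_le_iff₀ hε]; linarith)]
    ring
  have hψs : ∀ ε, 0 < ε → tsupport (ψ ε) ⊆ tsupport φ ∩ {y | ε ≤ ‖y‖} := by
    intro ε hε
    refine closure_minimal (fun y hy => ⟨subset_tsupport _ fun h0 => hy ?_, ?_⟩)
      ((isClosed_tsupport _).inter (isClosed_le continuous_const continuous_norm))
    · simp [hψ, h0]
    · by_contra h0
      exact hy (hψnear ε hε y (not_le.mp h0).le)
  have hψD : ∀ ε, 0 < ε → tsupport (ψ ε) ⊆ D := fun ε hε y hy =>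
    ⟨hφs (hψs ε hε hy).1, norm_pos_iff.mp (hε.trans_le (hψs ε hε hy).2)⟩
  have hψcpt : ∀ ε, 0 < ε → HasCompactSupport (ψ ε) := fun ε hε =>
    hφc.of_isClosed_subset (isClosed_tsupport _) fun y hy => (hψs ε hε hy).1
  have hweak : ∀ ε, 0 < ε → ∫ y in D, u y * bilap (ψ ε) y = ∫ y in D, u y ^ p * ψ ε y := by
    intro ε hε
    have := h.integral_mul_bilap (hψ4 ε) (hψcpt ε hε) ((hψD ε hε).trans hD1)
    rw [setIntegral_eq_integral_of_forall_compl_eq_zero,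
      setIntegral_eq_integral_of_forall_compl_eq_zero, this]
    · intro y hy
      rw [image_eq_zero_of_notMem_tsupport fun h0 => hy (hψD ε hε h0), mul_zero]
    · intro y hy
      rw [bilap_eq_zero_of_notMem fun h0 => hy (hψD ε hε h0), mul_zero]
  have hbfar : ∀ ε, 0 < ε → ∀ y, 2 * ε < ‖y‖ → bilap (ψ ε) y = bilap φ y := by
    intro ε hε y hy
    refine (Filter.EventuallyEq.bilap ?_).eq_of_nhds
    filter_upwards [(isOpen_lt continuous_const continuous_norm).mem_nhds hy] with z hz
    exact hψfar ε hε z hz.le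
  have hbnear : ∀ ε, 0 < ε → ∀ y, ‖y‖ < ε → bilap (ψ ε) y = 0 := by
    intro ε hε y hy
    exact bilap_eq_zero_of_notMem fun h0 => not_le.mpr hy (hψs ε hε h0).2
  have hbshell : ∀ ε, 0 < ε → ε ≤ 1 → ∀ y, ‖y‖ ≤ 2 * ε → |bilap (ψ ε) y| ≤ ε⁻¹ ^ 4 * M := by
    intro ε hε hε1 y hy
    have h1 : bilap (ψ ε) y = ε⁻¹ ^ 4 * bilap (fun z => F (z, ε)) (ε⁻¹ • y) := by
      have h2 := congrFun (bilap_comp_smul_add (fun z => F (z, ε)) ε⁻¹ 0) y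
      simp only [add_zero] at h2
      rw [← h2]
      congr 1
      ext z
      simp only [hψ, hF]
      rw [smul_inv_smul₀ hε.ne']
    rw [h1, abs_mul, abs_of_nonneg (by positivity)]
    gcongr
    refine hM (ε⁻¹ • y, ε) ⟨?_, hε.le, hε1⟩
    rw [mem_closedBall_zero_iff, hnorm ε hε, div_le_iff₀ hε]
    exact hy
  obtain ⟨B, hB⟩ := hφc.exists_bound_of_continuous hφ.continuous
  have hφc' : HasCompactSupport (bilap φ) := hφc.of_isClosed_subset (isClosed_tsupport _)
    (tsupport_bilap_subset φ)
  obtain ⟨B', hB'⟩ := hφc'.exists_bound_of_continuous hφ.continuous_bilap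
  set O : ℝ → Set (EuclideanSpace ℝ (Fin n)) := fun ε => {y | 2 * ε < ‖y‖} with hO
  have hOm : ∀ ε, MeasurableSet (O ε) := fun ε =>
    (isOpen_lt continuous_const continuous_norm).measurableSet
  have memO : ∀ ε y, y ∈ O ε ↔ 2 * ε < ‖y‖ := fun ε y => Iff.rfl
  have hup := h.integrableOn_rpow
  have hu := h.integrableOn
  rw [← hD] at hup hu
  have hmeasu := hu.aestronglyMeasurable
  have hmeasup := hup.aestronglyMeasurable
  have hR : Tendsto (fun ε => ∫ y in D, u y ^ p * ψ ε y) (𝓝[>] 0)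
      (𝓝 (∫ y in D, u y ^ p * φ y)) := by
    refine tendsto_integral_filter_of_dominated_convergence (fun y => u y ^ p * B)
      (Eventually.of_forall fun ε => hmeasup.mul (hψ4 ε).continuous.aestronglyMeasurable)
      (Eventually.of_forall fun ε => ?_) (hup.mul_const B) ?_
    · filter_upwards [ae_restrict_mem hDm] with y hy
      have h0 := Real.rpow_nonneg (h.nonneg y (hD1 hy)) p
      rw [norm_mul, Real.norm_of_nonneg h0]
      gcongr
      simp only [hψ]
      rw [norm_mul, Real.norm_of_nonneg (hη01 _).1]
      exact (mul_le_of_le_one_right (norm_nonneg _) (hη01 _).2).trans (hB y)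
    · filter_upwards [ae_restrict_mem hDm] with y hy
      refine tendsto_const_nhds.congr' ?_
      filter_upwards [eventually_punctured_near_zero y hy.2, self_mem_nhdsWithin] with ε hε hε0
      rw [hψfar ε hε0 y hε.le]
  have hL1 : Tendsto (fun ε : ℝ => ∫ y in D, (O ε).indicator
      (fun y => u y * bilap φ y) y) (𝓝[>] 0) (𝓝 (∫ y in D, u y * bilap φ y)) := by
    refine tendsto_integral_filter_of_dominated_convergence (fun y => u y * B')
      (Eventually.of_forall fun ε => ((hmeasu.mul hφ.continuous_bilap.aestronglyMeasurable)).indicator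
        (hOm ε))
      (Eventually.of_forall fun ε => ?_) (hu.mul_const B') ?_
    · filter_upwards [ae_restrict_mem hDm] with y hy
      refine (norm_indicator_le_norm_self _ _).trans ?_
      have h0 := h.nonneg y (hD1 hy)
      rw [norm_mul, Real.norm_of_nonneg h0]
      gcongr
      exact hB' y
    · filter_upwards [ae_restrict_mem hDm] with y hy
      refine tendsto_const_nhds.congr' ?_
      filter_upwards [eventually_punctured_near_zero y hy.2] with ε hε
      rw [Set.indicator_of_mem ((memO ε y).mpr hε)]
  obtain ⟨C, hC, hshell⟩ := h.exists_shell_integral_le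
  have hM0 : 0 ≤ M := (norm_nonneg _).trans (hM (0, 0) ⟨by simp, by simp⟩)
  have hL2 : Tendsto (fun ε : ℝ => (∫ y in D, u y * bilap (ψ ε) y) -
      ∫ y in D, (O ε).indicator
      (fun y => u y * bilap φ y) y) (𝓝[>] 0) (𝓝 0) := by
    refine squeeze_zero_norm' (a := fun ε => M * (C * ε ^ ((n : ℝ) - 4 * (p / (p - 1))))) ?_ ?_
    · filter_upwards [Ioo_mem_nhdsGT (show (0 : ℝ) < 1 / 4 by norm_num)] with ε hε
      have hε0 : 0 < ε := hε.1
      have hε4 : ε < 1 / 4 := hε.2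
      have hsD : shell n ε (2 * ε) ⊆ D := fun y hy =>
        ⟨mem_ball_zero_iff.mpr (by linarith [hy.2]), norm_pos_iff.mp (hε0.trans_le hy.1)⟩
      have hint1 : IntegrableOn (fun y => u y * bilap (ψ ε) y) D :=
        (integrable_mul_of_tsupport_subset isOpen_domain h.continuousOn
          (hψ4 ε).continuous_bilap ((hψcpt ε hε0).of_isClosed_subset (isClosed_tsupport _)
          (tsupport_bilap_subset _))
          ((tsupport_bilap_subset _).trans ((hψD ε hε0).trans hD1))).integrableOn
      have hint2 : IntegrableOn ((O ε).indicator
          (fun y => u y * bilap φ y)) D := by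
        refine Integrable.indicator ?_ (hOm ε)
        refine (hu.mul_const B').mono' (hmeasu.mul hφ.continuous_bilap.aestronglyMeasurable) ?_
        filter_upwards [ae_restrict_mem hDm] with y hy
        have h0 := h.nonneg y (hD1 hy)
        rw [norm_mul, Real.norm_of_nonneg h0]
        gcongr
        exact hB' y
      have hS := (isClosed_shell n ε (2 * ε)).measurableSet
      rw [← integral_sub hint1 hint2]
      have hle : ∀ y ∈ D, ‖u y * bilap (ψ ε) y -
          (O ε).indicator (fun y => u y * bilap φ y) y‖ ≤
          (shell n ε (2 * ε)).indicator (fun y => u y * (ε⁻¹ ^ 4 * M)) y := by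
        intro y hy
        have h0 := h.nonneg y (hD1 hy)
        by_cases h2 : y ∈ O ε
        · rw [Set.indicator_of_mem h2, hbfar ε hε0 y ((memO ε y).mp h2), sub_self, norm_zero]
          exact Set.indicator_nonneg (fun z hz => mul_nonneg (h.nonneg z (hD1 (hsD hz)))
            (by positivity)) _
        · rw [Set.indicator_of_notMem h2, sub_zero]
          by_cases h1 : ‖y‖ < ε
          · rw [hbnear ε hε0 y h1, mul_zero, norm_zero]
            exact Set.indicator_nonneg (fun z hz => mul_nonneg (h.nonneg z (hD1 (hsD hz)))
              (by positivity)) _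
          · rw [Set.indicator_of_mem (show y ∈ shell n ε (2 * ε) from
              ⟨not_lt.mp h1, not_lt.mp (mt (memO ε y).mpr h2)⟩), norm_mul, Real.norm_of_nonneg h0]
            gcongr
            exact hbshell ε hε0 (by linarith) y (not_lt.mp (mt (memO ε y).mpr h2))
      have hintS : IntegrableOn ((shell n ε (2 * ε)).indicator
          (fun y => u y * (ε⁻¹ ^ 4 * M))) D := (hu.mul_const _).indicator hS
      refine (norm_integral_le_of_norm_le hintS ((ae_restrict_iff' hDm).mpr
        (Eventually.of_forall hle))).trans ?_
      rw [setIntegral_indicator hS, Set.inter_eq_self_of_subset_right hsD, integral_mul_const]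
      have := hshell ε hε0 (by linarith)
      calc _ = M * (ε⁻¹ ^ 4 * ∫ y in shell n ε (2 * ε), u y) := by ring
        _ ≤ _ := by gcongr
    · have h1 : Tendsto (fun ε : ℝ => ε ^ ((n : ℝ) - 4 * (p / (p - 1)))) (𝓝[>] 0) (𝓝 0) := by
        have := (Real.continuousAt_rpow_const 0 ((n : ℝ) - 4 * (p / (p - 1)))
          (Or.inr h.exponent_pos.le)).tendsto
        rw [Real.zero_rpow h.exponent_pos.ne'] at this
        exact this.mono_left nhdsWithin_le_nhds
      simpa using (h1.const_mul C).const_mul M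
  have hL : Tendsto (fun ε : ℝ => ∫ y in D, u y * bilap (ψ ε) y) (𝓝[>] 0)
      (𝓝 (∫ y in D, u y * bilap φ y)) := by
    have := hL2.add hL1
    simpa using this
  refine tendsto_nhds_unique (hL.congr' ?_) hR
  filter_upwards [self_mem_nhdsWithin] with ε hε
  exact hweak ε hε

end IsPuncturedSolution

end Extension

section RegularisedKernel

open Topology
open scoped ContDiff

variable {n : ℕ}

lemma lap_rpow_norm_sq_add {e : ℝ} (he : 0 < e) (a : ℝ) (x : EuclideanSpace ℝ (Fin n)) :
    lap (fun y : EuclideanSpace ℝ (Fin n) => (‖y‖ ^ 2 + e) ^ (-a)) x =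
      a * (4 * (a + 1) - 2 * n) * (‖x‖ ^ 2 + e) ^ (-(a + 1)) -
        4 * a * (a + 1) * e * (‖x‖ ^ 2 + e) ^ (-(a + 2)) := by
  have hpos : 0 < ‖x‖ ^ 2 + e := by positivity
  have hd : ∀ (b s : ℝ), 0 < s + e →
      HasDerivAt (fun s : ℝ => (s + e) ^ (-b)) (-b * (s + e) ^ (-(b + 1))) s := by
    intro b s hs
    have := ((hasDerivAt_id s).add_const e).rpow_const (p := -b) (Or.inl hs.ne')
    rw [show -(b + 1) = -b - 1 by ring]
    simpa using this
  have hev : ∀ᶠ s in 𝓝 (‖x‖ ^ 2),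
      HasDerivAt (fun s : ℝ => (s + e) ^ (-a)) (-a * (s + e) ^ (-(a + 1))) s := by
    filter_upwards [(isOpen_lt (continuous_const (y := (0 : ℝ)))
      (continuous_id.add (continuous_const (y := e)))).mem_nhds hpos] with s hs
    exact hd a s hs
  rw [lap_comp_norm_sq hev ((hd (a + 1) _ hpos).const_mul (-a))]
  have h1 : (‖x‖ ^ 2 + e) ^ (-(a + 1)) = (‖x‖ ^ 2 + e) * (‖x‖ ^ 2 + e) ^ (-(a + 2)) := by
    rw [show -(a + 1) = 1 + -(a + 2) by ring, Real.rpow_add hpos, Real.rpow_one]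
  rw [show a + 1 + 1 = a + 2 by ring, h1]
  ring

lemma contDiff_rpow_norm_sq_add {e : ℝ} (he : 0 < e) (a : ℝ) {k : WithTop ℕ∞} :
    ContDiff ℝ k fun y : EuclideanSpace ℝ (Fin n) => (‖y‖ ^ 2 + e) ^ (-a) :=
  ((contDiff_norm_sq ℝ).add contDiff_const).rpow_const_of_ne fun y => by positivity

lemma bilap_rpow_norm_sq_add {e c : ℝ} (he : 0 < e) (hn : (n : ℝ) = 2 * c + 4)
    (x : EuclideanSpace ℝ (Fin n)) :
    bilap (fun y : EuclideanSpace ℝ (Fin n) => (‖y‖ ^ 2 + e) ^ (-c)) x =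
      16 * c * (c + 1) * (c + 2) * (c + 3) * e ^ 2 * (‖x‖ ^ 2 + e) ^ (-(c + 4)) := by
  have h1 : lap (fun y : EuclideanSpace ℝ (Fin n) => (‖y‖ ^ 2 + e) ^ (-c)) =
      fun y => (fun y => (-4 * c) * (‖y‖ ^ 2 + e) ^ (-(c + 1))) y -
        (fun y => (4 * c * (c + 1) * e) * (‖y‖ ^ 2 + e) ^ (-(c + 2))) y := by
    ext y
    rw [lap_rpow_norm_sq_add he, hn]
    ring
  unfold bilap
  rw [h1, lap_sub (contDiff_const.mul (contDiff_rpow_norm_sq_add he _)).contDiffAt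
    (contDiff_const.mul (contDiff_rpow_norm_sq_add he _)).contDiffAt, lap_const_mul, lap_const_mul]
  simp only [lap_rpow_norm_sq_add he, hn]
  rw [show c + 1 + 1 = c + 2 by ring, show c + 1 + 2 = c + 3 by ring,
    show c + 2 + 1 = c + 3 by ring, show c + 2 + 2 = c + 4 by ring]
  ring

lemma tendsto_integral_rpow_norm_sq_add {c : ℝ} (hn : (n : ℝ) = 2 * c + 4) :
    ∃ I > 0, ∀ (g : EuclideanSpace ℝ (Fin n) → ℝ) (x : EuclideanSpace ℝ (Fin n)), Integrable g →
      ContinuousAt g x → Tendsto (fun δ : ℝ => ∫ y, g y *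
        ((δ ^ 2) ^ 2 * (‖y - x‖ ^ 2 + δ ^ 2) ^ (-(c + 4)))) (𝓝[>] 0) (𝓝 (I * g x)) := by
  set J : EuclideanSpace ℝ (Fin n) → ℝ := fun z => (1 + ‖z‖ ^ 2) ^ (-((n : ℝ) + 4) / 2) with hJ
  have hJpos : ∀ z, 0 < J z := fun z => by positivity
  have hJint : Integrable J := integrable_rpow_neg_one_add_norm_sq (by simp)
  set I := ∫ z, J z with hI
  have hIpos : 0 < I := by
    have hsup : Function.support J = Set.univ := by
      ext z; simpa using (hJpos z).ne'
    rw [hI, integral_pos_iff_support_of_nonneg (fun z => (hJpos z).le) hJint, hsup]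
    exact isOpen_univ.measure_pos volume ⟨0, trivial⟩
  refine ⟨I, hIpos, fun g x hg hgx => ?_⟩
  clear_value I
  have hone : ∫ z, J z / I = 1 := by rw [integral_div, ← hI, div_self hIpos.ne']
  have hJI : ∀ z, 0 ≤ J z / I := fun z => div_nonneg (hJpos z).le hIpos.le
  have hcob : Tendsto (fun z : EuclideanSpace ℝ (Fin n) =>
      ‖z‖ ^ Module.finrank ℝ (EuclideanSpace ℝ (Fin n)) * (J z / I))
      (Bornology.cobounded _) (𝓝 0) := by
    have h0 : Tendsto (fun z : EuclideanSpace ℝ (Fin n) => I⁻¹ * ‖z‖ ^ (-(4 : ℝ)))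
        (Bornology.cobounded _) (𝓝 (I⁻¹ * 0)) :=
      ((tendsto_rpow_neg_atTop (by norm_num)).comp tendsto_norm_cobounded_atTop).const_mul _
    rw [mul_zero] at h0
    refine squeeze_zero' (Eventually.of_forall fun z => by have := hJpos z; positivity) ?_ h0
    filter_upwards [tendsto_norm_cobounded_atTop.eventually_gt_atTop 0] with z hz
    have h1 : J z ≤ ‖z‖ ^ (-((n : ℝ) + 4)) := by
      have : ‖z‖ ^ (-((n : ℝ) + 4)) = (‖z‖ ^ 2) ^ (-((n : ℝ) + 4) / 2) := by
        rw [← Real.rpow_natCast, ← Real.rpow_mul hz.le]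
        congr 1; push_cast; ring
      rw [this]
      exact Real.rpow_le_rpow_of_nonpos (by positivity) (by linarith)
        (by have : (0 : ℝ) ≤ n := by positivity
            linarith)
    rw [finrank_euclideanSpace_fin]
    calc ‖z‖ ^ n * (J z / I) ≤ ‖z‖ ^ n * (‖z‖ ^ (-((n : ℝ) + 4)) / I) := by gcongr
      _ = I⁻¹ * (‖z‖ ^ (n : ℝ) * ‖z‖ ^ (-((n : ℝ) + 4))) := by rw [Real.rpow_natCast]; ring
      _ = I⁻¹ * ‖z‖ ^ (-(4 : ℝ)) := by rw [← Real.rpow_add hz]; ring_nf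
  have key := tendsto_integral_comp_smul_smul_of_integrable' (μ := volume)
    (φ := fun z => J z / I) hJI hone hcob hg hgx
  have key2 := (key.comp tendsto_inv_nhdsGT_zero).const_mul I
  refine key2.congr' ?_
  filter_upwards [self_mem_nhdsWithin] with δ hδ
  have hδ0 : (0 : ℝ) < δ := hδ
  simp only [Function.comp_apply]
  rw [← integral_const_mul]
  refine integral_congr_ae (Eventually.of_forall fun y => ?_)
  simp only [smul_eq_mul, finrank_euclideanSpace_fin, hJ]
  have e1 : 1 + ‖δ⁻¹ • (x - y)‖ ^ 2 = (‖y - x‖ ^ 2 + δ ^ 2) * (δ ^ 2)⁻¹ := by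
    rw [norm_smul, norm_inv, Real.norm_of_nonneg hδ0.le, norm_sub_rev]
    field_simp
    ring
  have e2 : ((δ ^ 2)⁻¹ : ℝ) ^ (-((n : ℝ) + 4) / 2) = δ ^ n * δ ^ 4 := by
    rw [Real.inv_rpow (by positivity), ← Real.rpow_neg (by positivity), ← Real.rpow_natCast δ 2,
      ← Real.rpow_mul hδ0.le, ← Real.rpow_natCast δ n, ← Real.rpow_natCast δ 4,
      ← Real.rpow_add hδ0]
    congr 1; push_cast; ring
  have e3 : -((n : ℝ) + 4) / 2 = -(c + 4) := by rw [hn]; ring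
  rw [e1, Real.mul_rpow (by positivity) (by positivity), e2, e3]
  have e4 : (1 / δ) ^ n * δ ^ n = 1 := by
    rw [← mul_pow, one_div_mul_cancel hδ0.ne', one_pow]
  field_simp
  rw [e4, one_mul]

end RegularisedKernel

section Representation

open Topology
open scoped ContDiff

lemma rpow_norm_sq_neg_half {E : Type*} [SeminormedAddCommGroup E] (d : ℕ) (z : E) :
    (‖z‖ ^ 2) ^ (-((d : ℝ) / 2)) = (‖z‖ ^ d)⁻¹ := by
  rw [← Real.rpow_natCast, ← Real.rpow_mul (norm_nonneg z),
    show (((2 : ℕ) : ℝ) * -((d : ℝ) / 2)) = -(d : ℝ) by push_cast; ring,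
    Real.rpow_neg (norm_nonneg z), Real.rpow_natCast]

lemma exists_bound_bilap_regularised {n : ℕ} {ζ : EuclideanSpace ℝ (Fin n) → ℝ}
    (hζ : ContDiff ℝ 4 ζ) (c : ℝ) : ∃ M, ∀ x : EuclideanSpace ℝ (Fin n), ‖x‖ ≤ 1 / 8 →
      ∀ δ : ℝ, 0 ≤ δ → δ ≤ 1 → ∀ y : EuclideanSpace ℝ (Fin n), 1 / 4 ≤ ‖y‖ → ‖y‖ ≤ 3 / 8 →
        |bilap (fun y => ζ y * (‖y - x‖ ^ 2 + δ ^ 2) ^ (-c)) y| ≤ M := by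
  set F : EuclideanSpace ℝ (Fin n) × (EuclideanSpace ℝ (Fin n) × ℝ) → ℝ := fun q =>
    ζ q.1 * (‖q.1 - q.2.1‖ ^ 2 + q.2.2 ^ 2) ^ (-c) with hF
  have hcont : ContinuousOn (fun r : EuclideanSpace ℝ (Fin n) × (EuclideanSpace ℝ (Fin n) × ℝ) =>
      bilap (fun y => F (y, r.2)) r.1)
      (shell n (1 / 4) (3 / 8) ×ˢ (closedBall 0 (1 / 8) ×ˢ Set.Icc 0 1)) := by
    rintro ⟨y, x, δ⟩ ⟨hy, hx, -⟩
    have hx' : ‖x‖ ≤ 1 / 8 := mem_closedBall_zero_iff.mp hx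
    have hyx : 0 < ‖y - x‖ := by
      have h1 := hy.1
      have h2 := norm_sub_norm_le y x
      simp only at h1
      linarith
    refine (continuousAt_bilap_slice ?_).continuousWithinAt
    refine (hζ.comp contDiff_fst).contDiffAt.mul (ContDiffAt.rpow_const_of_ne ?_ ?_)
    · have : ContDiff ℝ 4 fun q : EuclideanSpace ℝ (Fin n) × (EuclideanSpace ℝ (Fin n) × ℝ) =>
          ‖q.1 - q.2.1‖ ^ 2 + q.2.2 ^ 2 := by
        have h1 : ContDiff ℝ 4 fun q : EuclideanSpace ℝ (Fin n) × (EuclideanSpace ℝ (Fin n) × ℝ) =>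
          ‖q.1 - q.2.1‖ ^ 2 :=
          (contDiff_fst.sub (contDiff_fst.comp contDiff_snd)).norm_sq ℝ
        exact h1.add ((contDiff_snd.comp contDiff_snd).pow 2)
      exact this.contDiffAt
    · positivity
  obtain ⟨M, hM⟩ := ((isCompact_shell n (1 / 4) (3 / 8)).prod
    ((isCompact_closedBall (0 : EuclideanSpace ℝ (Fin n)) (1 / 8)).prod
    (isCompact_Icc (a := (0 : ℝ)) (b := 1)))).exists_bound_of_continuousOn hcont
  refine ⟨M, fun x hx δ h0 h1 y hy1 hy2 => ?_⟩
  exact hM (y, x, δ) ⟨⟨hy1, hy2⟩, mem_closedBall_zero_iff.mpr hx, h0, h1⟩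

namespace IsPuncturedSolution

variable {d : ℕ} {p : ℝ} {u : EuclideanSpace ℝ (Fin (d + 4)) → ℝ}

lemma integrableOn_rpow_mul_inv_pow (h : IsPuncturedSolution (d + 4) p u)
    {x : EuclideanSpace ℝ (Fin (d + 4))} (hx : x ∈ ball 0 (1 / 2) \ {0}) :
    IntegrableOn (fun y => u y ^ p * (‖x - y‖ ^ d)⁻¹) (ball 0 (1 / 2) \ {0}) := by
  have hx0 : 0 < ‖x‖ := norm_pos_iff.mpr hx.2
  have hx1 : ‖x‖ < 1 / 2 := mem_ball_zero_iff.mp hx.1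
  set r := ‖x‖ / 2 with hr
  have hr0 : 0 < r := by positivity
  have hsub : closedBall x r ⊆ ball 0 1 \ {0} := by
    intro y hy
    have hy' : ‖y - x‖ ≤ r := by rwa [mem_closedBall, dist_eq_norm] at hy
    have h1 := norm_sub_norm_le y x
    have h2 := norm_sub_norm_le x y
    rw [norm_sub_rev] at h2
    exact ⟨mem_ball_zero_iff.mpr (by linarith), norm_pos_iff.mp (by linarith)⟩
  obtain ⟨B, hB⟩ := (isCompact_closedBall x r).exists_bound_of_continuousOn
    (h.continuousOn_rpow.mono hsub)
  have hDm : MeasurableSet (ball (0 : EuclideanSpace ℝ (Fin (d + 4))) (1 / 2) \ {0}) :=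
    (isOpen_ball.sdiff isClosed_singleton).measurableSet
  have hD1 : ball (0 : EuclideanSpace ℝ (Fin (d + 4))) (1 / 2) \ {0} ⊆ ball 0 1 \ {0} :=
    Set.sdiff_subset_sdiff_left (ball_subset_ball (by norm_num))
  have hk : IntegrableOn (fun y => (‖x - y‖ ^ d)⁻¹) (ball x r) := by
    have hlt : (d : ℝ) < Module.finrank ℝ (EuclideanSpace ℝ (Fin (d + 4))) := by
      rw [finrank_euclideanSpace_fin]; push_cast; linarith
    have := integrableOn_comp_sub_left measurableSet_ball x (integrableOn_ball_norm_rpow hlt r)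
    have hset : {z | x - z ∈ ball (0 : EuclideanSpace ℝ (Fin (d + 4))) r} = ball x r := by
      ext z; rw [mem_ball, dist_comm, dist_eq_norm, Set.mem_ofPred_eq, mem_ball_zero_iff]
    rw [hset] at this
    simpa only [Real.rpow_neg (norm_nonneg _), Real.rpow_natCast] using this
  have hup := h.integrableOn_rpow
  have hkI : Integrable ((ball x r).indicator fun y => B * (‖x - y‖ ^ d)⁻¹) :=
    (integrable_indicator_iff measurableSet_ball).mpr (hk.const_mul B)
  refine ((hup.mul_const (r ^ d)⁻¹).add hkI.integrableOn).mono'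
    (hup.aestronglyMeasurable.mul ?_) ?_
  · have : Measurable fun y : EuclideanSpace ℝ (Fin (d + 4)) => (‖x - y‖ ^ d)⁻¹ := by fun_prop
    exact this.aestronglyMeasurable
  · filter_upwards [ae_restrict_mem hDm] with y hy
    have h0 := Real.rpow_nonneg (h.nonneg y (hD1 hy)) p
    rw [Real.norm_of_nonneg (by positivity)]
    simp only [Pi.add_apply]
    by_cases hyr : y ∈ ball x r
    · rw [Set.indicator_of_mem hyr]
      have h1 : u y ^ p * (‖x - y‖ ^ d)⁻¹ ≤ B * (‖x - y‖ ^ d)⁻¹ := by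
        gcongr
        exact (le_abs_self _).trans (hB y (ball_subset_closedBall hyr))
      have h2 : 0 ≤ u y ^ p * (r ^ d)⁻¹ := by positivity
      linarith
    · rw [Set.indicator_of_notMem hyr, add_zero]
      rw [mem_ball, dist_comm, dist_eq_norm, not_lt] at hyr
      gcongr

lemma tendsto_setIntegral_regularised (h : IsPuncturedSolution (d + 4) p u)
    {ζ : EuclideanSpace ℝ (Fin (d + 4)) → ℝ} (hζ : Continuous ζ) (hζ0 : ∀ y, 0 ≤ ζ y)
    (hζ1 : ∀ y, ζ y ≤ 1)
    {x : EuclideanSpace ℝ (Fin (d + 4))} (hx : x ∈ ball 0 (1 / 2) \ {0}) :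
    Tendsto (fun δ : ℝ => ∫ y in ball 0 (1 / 2) \ {0},
      u y ^ p * (ζ y * (‖y - x‖ ^ 2 + δ ^ 2) ^ (-((d : ℝ) / 2)))) (𝓝[>] 0)
      (𝓝 (∫ y in ball 0 (1 / 2) \ {0}, u y ^ p * (ζ y * (‖x - y‖ ^ d)⁻¹))) := by
  have hDm : MeasurableSet (ball (0 : EuclideanSpace ℝ (Fin (d + 4))) (1 / 2) \ {0}) :=
    (isOpen_ball.sdiff isClosed_singleton).measurableSet
  have hD1 : ball (0 : EuclideanSpace ℝ (Fin (d + 4))) (1 / 2) \ {0} ⊆ ball 0 1 \ {0} :=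
    Set.sdiff_subset_sdiff_left (ball_subset_ball (by norm_num))
  have hup := h.integrableOn_rpow.aestronglyMeasurable
  have hne : ∀ᵐ y ∂(volume.restrict (ball (0 : EuclideanSpace ℝ (Fin (d + 4))) (1 / 2) \ {0})),
      y ≠ x := ae_restrict_of_ae (Measure.ae_ne volume x)
  have hpos : ∀ y : EuclideanSpace ℝ (Fin (d + 4)), y ≠ x → 0 < ‖y - x‖ := fun y hy =>
    norm_pos_iff.mpr (sub_ne_zero.mpr hy)
  refine tendsto_integral_filter_of_dominated_convergence
    (fun y => u y ^ p * (‖x - y‖ ^ d)⁻¹) ?_ ?_ (h.integrableOn_rpow_mul_inv_pow hx) ?_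
  · filter_upwards [self_mem_nhdsWithin] with δ hδ
    have hδ0 : (0 : ℝ) < δ := hδ
    refine hup.mul (Continuous.aestronglyMeasurable (hζ.mul ?_))
    refine Continuous.rpow_const (by fun_prop) fun y => Or.inl ?_
    positivity
  · filter_upwards [self_mem_nhdsWithin] with δ hδ
    have hδ0 : (0 : ℝ) < δ := hδ
    filter_upwards [ae_restrict_mem hDm, hne] with y hy hyx
    have h0 := Real.rpow_nonneg (h.nonneg y (hD1 hy)) p
    have hζy := hζ0 y
    rw [Real.norm_of_nonneg (by positivity)]
    gcongr
    have h1 : (‖y - x‖ ^ 2 + δ ^ 2) ^ (-((d : ℝ) / 2)) ≤ (‖y - x‖ ^ 2) ^ (-((d : ℝ) / 2)) :=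
      Real.rpow_le_rpow_of_nonpos (by have := hpos y hyx; positivity) (by nlinarith)
        (by have : (0 : ℝ) ≤ d := by positivity
            linarith)
    rw [rpow_norm_sq_neg_half, norm_sub_rev] at h1
    refine le_trans (mul_le_of_le_one_left (by positivity) (hζ1 y)) ?_
    rwa [norm_sub_rev]
  · filter_upwards [hne] with y hyx
    have h1 : ContinuousAt (fun δ : ℝ => (‖y - x‖ ^ 2 + δ ^ 2) ^ (-((d : ℝ) / 2))) 0 := by
      refine ContinuousAt.rpow_const (by fun_prop) (Or.inl ?_)
      have := hpos y hyx
      positivity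
    have h2 := h1.tendsto
    rw [show (‖y - x‖ ^ 2 + (0 : ℝ) ^ 2) = ‖y - x‖ ^ 2 by ring, rpow_norm_sq_neg_half,
      norm_sub_rev] at h2
    have h3 := ((h2.const_mul (ζ y)).const_mul (u y ^ p)).mono_left
      (nhdsWithin_le_nhds (s := Set.Ioi 0))
    refine h3.congr fun δ => ?_
    rw [norm_sub_rev]

end IsPuncturedSolution

end Representation

section PotentialOfSolution

open Topology
open scoped ContDiff

namespace IsPuncturedSolution

variable {d : ℕ} {p : ℝ} {u : EuclideanSpace ℝ (Fin (d + 4)) → ℝ}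

/-- The solution `u` restricted to a small punctured ball and extended by zero. -/
lemma integrable_indicator_ball (h : IsPuncturedSolution (d + 4) p u) :
    Integrable ((ball 0 (1 / 4) \ {0}).indicator u) :=
  (integrable_indicator_iff (isOpen_ball.sdiff isClosed_singleton).measurableSet).mpr
    (h.integrableOn.mono_set (Set.sdiff_subset_sdiff_left (ball_subset_ball (by norm_num))))

lemma exists_potential_sub_le (h : IsPuncturedSolution (d + 4) p u) (hd : d ≠ 0) :
    ∃ κ > 0, ∃ C, ∀ x ∈ ball (0 : EuclideanSpace ℝ (Fin (d + 4))) (1 / 8) \ {0},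
      |u x - κ * ∫ y in ball 0 (1 / 4) \ {0}, u y ^ p * (‖x - y‖ ^ d)⁻¹| ≤ C := by
  set D : Set (EuclideanSpace ℝ (Fin (d + 4))) := ball 0 (1 / 2) \ {0} with hD
  set S : Set (EuclideanSpace ℝ (Fin (d + 4))) := ball 0 (1 / 4) \ {0} with hS
  have hDm : MeasurableSet D := (isOpen_ball.sdiff isClosed_singleton).measurableSet
  have hSm : MeasurableSet S := (isOpen_ball.sdiff isClosed_singleton).measurableSet
  have hD1 : D ⊆ ball 0 1 \ {0} :=
    Set.sdiff_subset_sdiff_left (ball_subset_ball (by norm_num))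
  have hSD : S ⊆ D := Set.sdiff_subset_sdiff_left (ball_subset_ball (by norm_num))
  let ζ : ContDiffBump (0 : EuclideanSpace ℝ (Fin (d + 4))) :=
    ⟨1 / 4, 3 / 8, by norm_num, by norm_num⟩
  have hζ4 : ContDiff ℝ 4 (ζ : EuclideanSpace ℝ (Fin (d + 4)) → ℝ) := ζ.contDiff
  have hζone : ∀ z : EuclideanSpace ℝ (Fin (d + 4)), ‖z‖ ≤ 1 / 4 → ζ z = 1 := fun z hz =>
    ζ.one_of_mem_closedBall (mem_closedBall_zero_iff.mpr hz)
  have hζs : tsupport (ζ : EuclideanSpace ℝ (Fin (d + 4)) → ℝ) = closedBall 0 (3 / 8) :=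
    ζ.tsupport_eq
  set c : ℝ := (d : ℝ) / 2 with hc
  have hc0 : 0 < c := by
    have : 0 < (d : ℝ) := by exact_mod_cast Nat.pos_of_ne_zero hd
    positivity
  have hn : ((d + 4 : ℕ) : ℝ) = 2 * c + 4 := by rw [hc]; push_cast; ring
  obtain ⟨M, hM⟩ := exists_bound_bilap_regularised hζ4 c
  obtain ⟨I, hI, hlim⟩ := tendsto_integral_rpow_norm_sq_add hn
  set g := S.indicator u with hg
  have hgint : Integrable g := h.integrable_indicator_ball
  set c4 : ℝ := 16 * c * (c + 1) * (c + 2) * (c + 3) with hc4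
  have hc40 : 0 < c4 := by positivity
  have hu := h.integrableOn
  have hup := h.integrableOn_rpow
  rw [← hD] at hu hup
  refine ⟨(c4 * I)⁻¹, by positivity, (c4 * I)⁻¹ *
    ((∫ y in D, u y * M) + ∫ y in D, u y ^ p * 8 ^ d), fun x hx => ?_⟩
  have hx8 : ‖x‖ < 1 / 8 := mem_ball_zero_iff.mp hx.1
  have hxS : x ∈ S := ⟨ball_subset_ball (by norm_num) hx.1, hx.2⟩
  have hxD : x ∈ D := hSD hxS
  set Γ : ℝ → EuclideanSpace ℝ (Fin (d + 4)) → ℝ := fun δ y => (‖y - x‖ ^ 2 + δ ^ 2) ^ (-c) with hΓ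
  set φ : ℝ → EuclideanSpace ℝ (Fin (d + 4)) → ℝ := fun δ y => ζ y * Γ δ y with hφ
  have hΓ4 : ∀ δ, 0 < δ → ContDiff ℝ 4 (Γ δ) := fun δ hδ =>
    (contDiff_rpow_norm_sq_add (n := d + 4) (pow_pos hδ 2) c).comp (contDiff_id.sub contDiff_const)
  have hφ4 : ∀ δ, 0 < δ → ContDiff ℝ 4 (φ δ) := fun δ hδ => hζ4.mul (hΓ4 δ hδ)
  have hφs : ∀ δ, tsupport (φ δ) ⊆ closedBall 0 (3 / 8) := fun δ => by
    rw [← hζs]; exact tsupport_mul_subset_left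
  have hφc : ∀ δ, HasCompactSupport (φ δ) := fun δ =>
    (isCompact_closedBall _ _).of_isClosed_subset (isClosed_tsupport _) (hφs δ)
  have hweak : ∀ δ, 0 < δ → ∫ y in D, u y * bilap (φ δ) y = ∫ y in D, u y ^ p * φ δ y :=
    fun δ hδ => h.integral_mul_bilap_of_ball (hφ4 δ hδ) (hφc δ)
      ((hφs δ).trans (closedBall_subset_ball (by norm_num)))
  have hbΓ : ∀ δ, 0 < δ → ∀ y, bilap (Γ δ) y = c4 * ((δ ^ 2) ^ 2 *
      (‖y - x‖ ^ 2 + δ ^ 2) ^ (-(c + 4))) := by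
    intro δ hδ y
    have h1 := congrFun (bilap_comp_smul_add
      (fun z : EuclideanSpace ℝ (Fin (d + 4)) => (‖z‖ ^ 2 + δ ^ 2) ^ (-c)) 1 (-x)) y
    simp only [one_smul, one_pow, one_mul, ← sub_eq_add_neg] at h1
    rw [hΓ]
    simp only
    rw [h1, bilap_rpow_norm_sq_add (pow_pos hδ 2) hn]
    ring
  have hbin : ∀ δ, 0 < δ → ∀ y, ‖y‖ < 1 / 4 → bilap (φ δ) y = bilap (Γ δ) y := by
    intro δ hδ y hy
    refine (Filter.EventuallyEq.bilap ?_).eq_of_nhds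
    filter_upwards [(isOpen_lt continuous_norm continuous_const).mem_nhds hy] with z hz
    simp only [hφ]
    rw [hζone z (le_of_lt hz), one_mul]
  have hest : ∀ᶠ δ : ℝ in 𝓝[>] 0, |(∫ y in D, u y ^ p * φ δ y) - c4 * ∫ y, g y *
      ((δ ^ 2) ^ 2 * (‖y - x‖ ^ 2 + δ ^ 2) ^ (-(c + 4)))| ≤ ∫ y in D, u y * M := by
    filter_upwards [Ioo_mem_nhdsGT (show (0 : ℝ) < 1 by norm_num)] with δ hδ
    have hδ0 : 0 < δ := hδ.1
    have hcb : Continuous (bilap (φ δ)) := (hφ4 δ hδ0).continuous_bilap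
    have hb : HasCompactSupport (bilap (φ δ)) := (hφc δ).of_isClosed_subset (isClosed_tsupport _)
      (tsupport_bilap_subset _)
    obtain ⟨B, hB⟩ := hb.exists_bound_of_continuous hcb
    have hi1 : IntegrableOn (fun y => u y * bilap (φ δ) y) D := by
      refine (hu.mul_const B).mono' (hu.aestronglyMeasurable.mul hcb.aestronglyMeasurable) ?_
      filter_upwards [ae_restrict_mem hDm] with y hy
      have h0 := h.nonneg y (hD1 hy)
      rw [norm_mul, Real.norm_of_nonneg h0]
      gcongr
      exact hB y
    have heq1 : c4 * ∫ y, g y * ((δ ^ 2) ^ 2 * (‖y - x‖ ^ 2 + δ ^ 2) ^ (-(c + 4))) =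
        ∫ y in D, S.indicator (fun y => u y * bilap (φ δ) y) y := by
      rw [← integral_const_mul, setIntegral_indicator hSm, Set.inter_eq_self_of_subset_right hSD,
        ← integral_indicator hSm]
      refine integral_congr_ae (Eventually.of_forall fun y => ?_)
      by_cases hy : y ∈ S
      · simp only [hg, Set.indicator_of_mem hy]
        rw [hbin δ hδ0 y (mem_ball_zero_iff.mp hy.1), hbΓ δ hδ0]
        ring
      · simp [hg, Set.indicator_of_notMem hy]
    rw [heq1, ← hweak δ hδ0, ← integral_sub hi1 (hi1.indicator hSm), ← Real.norm_eq_abs]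
    refine norm_integral_le_of_norm_le (hu.mul_const M) ?_
    filter_upwards [ae_restrict_mem hDm] with y hy
    have h0 := h.nonneg y (hD1 hy)
    have hM0 : 0 ≤ M := by
      have hs : ∃ z : EuclideanSpace ℝ (Fin (d + 4)), ‖z‖ = 1 / 4 :=
        ⟨EuclideanSpace.single 0 (1 / 4), by simp⟩
      obtain ⟨z, hz⟩ := hs
      exact (abs_nonneg _).trans (hM x hx8.le δ hδ0.le hδ.2.le z hz.ge (by rw [hz]; norm_num))
    by_cases hyS : y ∈ S
    · rw [Set.indicator_of_mem hyS, sub_self, norm_zero]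
      positivity
    · rw [Set.indicator_of_notMem hyS, sub_zero, norm_mul, Real.norm_of_nonneg h0]
      gcongr
      have hy4 : 1 / 4 ≤ ‖y‖ := by
        by_contra h1
        exact hyS ⟨mem_ball_zero_iff.mpr (not_le.mp h1), hy.2⟩
      rcases le_or_gt ‖y‖ (3 / 8) with h38 | h38
      · exact hM x hx8.le δ hδ0.le hδ.2.le y hy4 h38
      · rw [bilap_eq_zero_of_notMem, norm_zero]
        · exact hM0
        · intro h1
          exact absurd (mem_closedBall_zero_iff.mp (hφs δ h1)) (not_le.mpr h38)
  have hgx : ContinuousAt g x := by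
    have h1 : g =ᶠ[𝓝 x] u := by
      filter_upwards [(isOpen_ball.sdiff isClosed_singleton).mem_nhds hxS] with y hy
      exact Set.indicator_of_mem hy u
    exact ((h.reg x (hD1 hxD)).continuousAt).congr h1.symm
  have hgxu : g x = u x := Set.indicator_of_mem hxS u
  have hT1 := h.tendsto_setIntegral_regularised ζ.continuous (fun y => ζ.nonneg)
    (fun y => ζ.le_one) hxD
  have hT2 := (hlim g x hgint hgx).const_mul c4
  rw [hgxu] at hT2
  have hfin := le_of_tendsto (hT1.sub hT2).abs hest
  have hk := h.integrableOn_rpow_mul_inv_pow hxD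
  rw [← hD] at hk
  have hkζ : IntegrableOn (fun y => u y ^ p * (ζ y * (‖x - y‖ ^ d)⁻¹)) D := by
    have hm : Measurable fun y : EuclideanSpace ℝ (Fin (d + 4)) => (‖x - y‖ ^ d)⁻¹ := by fun_prop
    refine hk.mono' (hup.aestronglyMeasurable.mul
      (ζ.continuous.aestronglyMeasurable.mul hm.aestronglyMeasurable)) ?_
    filter_upwards [ae_restrict_mem hDm] with y hy
    have h0 := Real.rpow_nonneg (h.nonneg y (hD1 hy)) p
    have hζy : 0 ≤ ζ y := ζ.nonneg
    rw [Real.norm_of_nonneg (by positivity)]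
    gcongr
    exact mul_le_of_le_one_left (by positivity) ζ.le_one
  have hfin2 : |(∫ y in D, u y ^ p * (ζ y * (‖x - y‖ ^ d)⁻¹)) -
      ∫ y in S, u y ^ p * (‖x - y‖ ^ d)⁻¹| ≤ ∫ y in D, u y ^ p * 8 ^ d := by
    have heq : ∫ y in S, u y ^ p * (‖x - y‖ ^ d)⁻¹ =
        ∫ y in D, S.indicator (fun y => u y ^ p * (‖x - y‖ ^ d)⁻¹) y := by
      rw [setIntegral_indicator hSm, Set.inter_eq_self_of_subset_right hSD]
    rw [heq, ← integral_sub hkζ (hk.indicator hSm), ← Real.norm_eq_abs]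
    refine norm_integral_le_of_norm_le (hup.mul_const _) ?_
    filter_upwards [ae_restrict_mem hDm] with y hy
    have h0 := Real.rpow_nonneg (h.nonneg y (hD1 hy)) p
    by_cases hyS : y ∈ S
    · rw [Set.indicator_of_mem hyS, hζone y (mem_ball_zero_iff.mp hyS.1).le, one_mul, sub_self,
        norm_zero]
      positivity
    · have hζy : 0 ≤ ζ y := ζ.nonneg
      rw [Set.indicator_of_notMem hyS, sub_zero, Real.norm_of_nonneg (by positivity)]
      gcongr
      have hy4 : 1 / 4 ≤ ‖y‖ := by
        by_contra h1
        exact hyS ⟨mem_ball_zero_iff.mpr (not_le.mp h1), hy.2⟩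
      have h8 : 1 / 8 ≤ ‖x - y‖ := by
        have := norm_sub_norm_le y x
        rw [norm_sub_rev] at this
        linarith
      refine (mul_le_of_le_one_left (by positivity) ζ.le_one).trans ?_
      rw [← inv_pow]
      gcongr
      rw [inv_le_comm₀ (by linarith) (by norm_num)]
      linarith
  set V := ∫ y in S, u y ^ p * (‖x - y‖ ^ d)⁻¹ with hV
  set W := ∫ y in D, u y ^ p * (ζ y * (‖x - y‖ ^ d)⁻¹) with hW
  have hcI : 0 < c4 * I := by positivity
  have heq : u x - (c4 * I)⁻¹ * V = (c4 * I)⁻¹ * (c4 * (I * u x) - V) := by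
    field_simp
  rw [heq, abs_mul, abs_of_pos (inv_pos.mpr hcI)]
  gcongr
  rw [abs_le] at hfin hfin2 ⊢
  constructor <;> linarith [hfin.1, hfin.2, hfin2.1, hfin2.2]

lemma exists_isSingularPotential (h : IsPuncturedSolution (d + 4) p u)
    (hsub : p * d < d + 8) :
    ∃ κ C, IsSingularPotential d p κ C (1 / 8) ((ball 0 (1 / 4) \ {0}).indicator u) := by
  have hd : d ≠ 0 := by have := h.five_le; omega
  obtain ⟨κ, hκ, C, hC⟩ := h.exists_potential_sub_le hd
  have hp0 : p ≠ 0 := by linarith [h.one_lt]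
  set S : Set (EuclideanSpace ℝ (Fin (d + 4))) := ball 0 (1 / 4) \ {0} with hS
  have hSm : MeasurableSet S := (isOpen_ball.sdiff isClosed_singleton).measurableSet
  have hS1 : S ⊆ ball 0 1 \ {0} := Set.sdiff_subset_sdiff_left (ball_subset_ball (by norm_num))
  have hS8 : ball (0 : EuclideanSpace ℝ (Fin (d + 4))) (1 / 8) \ {0} ⊆ S :=
    Set.sdiff_subset_sdiff_left (ball_subset_ball (by norm_num))
  refine ⟨κ, C, ⟨by simp, hd, h.one_lt, ?_, hsub, hκ, by norm_num, ?_, ?_, ?_, ?_⟩⟩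
  · have := h.supercrit
    push_cast at this
    linarith
  · classical
    rw [← Set.piecewise_eq_indicator]
    exact ContinuousOn.measurable_piecewise (h.continuousOn.mono hS1) continuousOn_const hSm
  · exact fun x => Set.indicator_nonneg (fun y hy => h.nonneg y (hS1 hy)) x
  · exact (h.continuousOn.mono (hS8.trans hS1)).congr fun y hy => Set.indicator_of_mem (hS8 hy) u
  · intro x hx
    have hfun : (fun z => (‖x - z‖ ^ d)⁻¹ * S.indicator u z ^ p) =
        S.indicator fun z => u z ^ p * (‖x - z‖ ^ d)⁻¹ := by
      ext z
      by_cases hz : z ∈ S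
      · simp only [Set.indicator_of_mem hz]; ring
      · simp [Set.indicator_of_notMem hz, Real.zero_rpow hp0]
    rw [hfun, integral_indicator hSm, Set.indicator_of_mem (hS8 hx)]
    refine ⟨(integrable_indicator_iff hSm).mpr ?_, hC x hx⟩
    exact (h.integrableOn_rpow_mul_inv_pow ⟨ball_subset_ball (by norm_num) hx.1, hx.2⟩).mono_set
      (Set.sdiff_subset_sdiff_left (ball_subset_ball (by norm_num)))

end IsPuncturedSolution

end PotentialOfSolution

section RadialBump

open Topology
open scoped ContDiff

variable {n : ℕ}

/-- The radial function `‖y‖ ^ a * ψ (log ‖y‖ + t)`. -/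
noncomputable def radialBump (n : ℕ) (a : ℝ) (ψ : ℝ → ℝ) (t : ℝ)
    (y : EuclideanSpace ℝ (Fin n)) : ℝ :=
  ‖y‖ ^ a * ψ (Real.log ‖y‖ + t)

lemma log_norm_mem_of_radialBump_ne_zero {ψ : ℝ → ℝ} (hψ : ∀ s, 1 < |s| → ψ s = 0)
    {t : ℝ} (ht : 1 < t) {y : EuclideanSpace ℝ (Fin n)} (hy : ψ (Real.log ‖y‖ + t) ≠ 0) :
    0 < ‖y‖ ∧ |Real.log ‖y‖ + t| ≤ 1 := by
  constructor
  · by_contra h0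
    have h1 : ‖y‖ = 0 := le_antisymm (not_lt.mp h0) (norm_nonneg y)
    refine hy (hψ _ ?_)
    rw [h1, Real.log_zero, zero_add]
    exact ht.trans_le (le_abs_self t)
  · by_contra h1
    exact hy (hψ _ (not_le.mp h1))

lemma mem_shell_of_abs_log_le {b t : ℝ} {y : EuclideanSpace ℝ (Fin n)} (hy : 0 < ‖y‖)
    (h : |Real.log ‖y‖ + t| ≤ b) : y ∈ shell n (Real.exp (-t - b)) (Real.exp (-t + b)) := by
  rw [abs_le] at h
  constructor
  · rw [← Real.le_log_iff_exp_le hy]; linarith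
  · rw [← Real.log_le_iff_le_exp hy]; linarith

lemma shell_exp_subset {b t : ℝ} (h : b < t) :
    shell n (Real.exp (-t - b)) (Real.exp (-t + b)) ⊆ ball 0 1 \ {0} :=
  shell_subset_ball (Real.exp_pos _) (by rw [Real.exp_lt_one_iff]; linarith)

lemma tsupport_radialBump_subset {a : ℝ} {ψ : ℝ → ℝ} (hψ : ∀ s, 1 < |s| → ψ s = 0)
    {t : ℝ} (ht : 1 < t) :
    tsupport (radialBump n a ψ t) ⊆ shell n (Real.exp (-t - 1)) (Real.exp (-t + 1)) := by
  refine closure_minimal (fun y hy => ?_) (isClosed_shell _ _ _)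
  have h1 : ψ (Real.log ‖y‖ + t) ≠ 0 := fun h0 => hy (by simp [radialBump, h0])
  obtain ⟨h2, h3⟩ := log_norm_mem_of_radialBump_ne_zero hψ ht h1
  exact mem_shell_of_abs_log_le h2 h3

lemma hasCompactSupport_radialBump {a : ℝ} {ψ : ℝ → ℝ} (hψ : ∀ s, 1 < |s| → ψ s = 0)
    {t : ℝ} (ht : 1 < t) : HasCompactSupport (radialBump n a ψ t) :=
  (isCompact_shell _ _ _).of_isClosed_subset (isClosed_tsupport _)
    (tsupport_radialBump_subset hψ ht)

lemma contDiff_radialBump {a : ℝ} {ψ : ℝ → ℝ} {k : ℕ} (hk : ContDiff ℝ k ψ)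
    (hψ : ∀ s, 1 < |s| → ψ s = 0) {t : ℝ} (ht : 1 < t) : ContDiff ℝ k (radialBump n a ψ t) := by
  refine contDiff_iff_contDiffAt.mpr fun y => ?_
  by_cases hy : y ∈ tsupport (radialBump n a ψ t)
  swap
  · exact contDiffAt_const.congr_of_eventuallyEq (notMem_tsupport_iff_eventuallyEq.mp hy)
  have hy0 : y ≠ 0 := (shell_exp_subset ht (tsupport_radialBump_subset hψ ht hy)).2
  have h1 : ContDiffAt ℝ k (fun y : EuclideanSpace ℝ (Fin n) => ‖y‖) y := contDiffAt_norm ℝ hy0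
  have h2 : ‖y‖ ≠ 0 := norm_ne_zero_iff.mpr hy0
  exact (h1.rpow_const_of_ne h2).mul (hk.contDiffAt.comp y ((h1.log h2).add contDiffAt_const))

lemma lap_radialBump {a t : ℝ} {ψ0 ψ1 ψ2 : ℝ → ℝ} (h0 : ∀ s, HasDerivAt ψ0 (ψ1 s) s)
    (h1 : ∀ s, HasDerivAt ψ1 (ψ2 s) s) {y : EuclideanSpace ℝ (Fin n)} (hy : y ≠ 0) :
    lap (radialBump n a ψ0 t) y = radialBump n (a - 2)
      (fun s => ψ2 s + (2 * a + n - 2) * ψ1 s + a * (a + n - 2) * ψ0 s) t y := by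
  have hy0 : 0 < ‖y‖ := norm_pos_iff.mpr hy
  have hs0 : 0 < ‖y‖ ^ 2 := by positivity
  have hd : ∀ (b : ℝ) (Ψ Ψ' : ℝ → ℝ), (∀ s, HasDerivAt Ψ (Ψ' s) s) → ∀ s : ℝ, 0 < s →
      HasDerivAt (fun s : ℝ => s ^ b * Ψ (1 / 2 * Real.log s + t))
        (s ^ (b - 1) * (b * Ψ (1 / 2 * Real.log s + t) + 1 / 2 * Ψ' (1 / 2 * Real.log s + t))) s := by
    intro b Ψ Ψ' hΨ s hs
    have e1 := (Real.hasDerivAt_rpow_const (x := s) (p := b) (Or.inl hs.ne'))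
    have e2 := (hΨ (1 / 2 * Real.log s + t)).comp s
      (((Real.hasDerivAt_log hs.ne').const_mul (1 / 2)).add_const t)
    refine (e1.mul e2).congr_deriv ?_
    have e3 : s ^ b = s ^ (b - 1) * s := by
      rw [← Real.rpow_add_one hs.ne']; ring_nf
    simp only [Function.comp_apply]
    rw [e3]
    field_simp
  have hG : radialBump n a ψ0 t = fun y : EuclideanSpace ℝ (Fin n) =>
      (fun s : ℝ => s ^ (a / 2) * ψ0 (1 / 2 * Real.log s + t)) (‖y‖ ^ 2) := by
    ext z
    simp only [radialBump]
    rw [← Real.rpow_natCast, ← Real.rpow_mul (norm_nonneg z), Real.rpow_natCast, Real.log_pow]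
    congr 2
    · push_cast; ring
    · push_cast; ring
  set Φ : ℝ → ℝ := fun s => a / 2 * ψ0 s + 1 / 2 * ψ1 s with hΦ
  have hΦd : ∀ s, HasDerivAt Φ (a / 2 * ψ1 s + 1 / 2 * ψ2 s) s := fun s =>
    ((h0 s).const_mul _).add ((h1 s).const_mul _)
  have hev : ∀ᶠ s in 𝓝 (‖y‖ ^ 2), HasDerivAt
      (fun s : ℝ => s ^ (a / 2) * ψ0 (1 / 2 * Real.log s + t))
      (s ^ (a / 2 - 1) * Φ (1 / 2 * Real.log s + t)) s := by
    filter_upwards [lt_mem_nhds hs0] with s hs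
    exact hd _ _ _ h0 s hs
  rw [hG, lap_comp_norm_sq hev (hd _ _ _ hΦd _ hs0)]
  have e1 : (1 : ℝ) / 2 * Real.log (‖y‖ ^ 2) = Real.log ‖y‖ := by
    rw [Real.log_pow]; push_cast; ring
  have e2 : (‖y‖ ^ 2) ^ (a / 2 - 1) = ‖y‖ ^ (a - 2) := by
    rw [← Real.rpow_natCast, ← Real.rpow_mul hy0.le]; congr 1; push_cast; ring
  have e3 : (‖y‖ ^ 2) * (‖y‖ ^ 2) ^ (a / 2 - 1 - 1) = ‖y‖ ^ (a - 2) := by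
    rw [← e2, mul_comm, ← Real.rpow_add_one hs0.ne']; ring_nf
  simp only [radialBump, e1, hΦ]
  rw [e2]
  linear_combination (4 * ((a / 2 - 1) * (a / 2 * ψ0 (Real.log ‖y‖ + t) +
    1 / 2 * ψ1 (Real.log ‖y‖ + t)) + 1 / 2 * (a / 2 * ψ1 (Real.log ‖y‖ + t) +
    1 / 2 * ψ2 (Real.log ‖y‖ + t)))) * e3

lemma bilap_radialBump {a t : ℝ} {ψ0 ψ1 ψ2 ψ3 ψ4 : ℝ → ℝ} (h0 : ∀ s, HasDerivAt ψ0 (ψ1 s) s)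
    (h1 : ∀ s, HasDerivAt ψ1 (ψ2 s) s) (h2 : ∀ s, HasDerivAt ψ2 (ψ3 s) s)
    (h3 : ∀ s, HasDerivAt ψ3 (ψ4 s) s) {b0 b1 c0 c1 : ℝ} (hb1 : b1 = 2 * a + n - 2)
    (hb0 : b0 = a * (a + n - 2)) (hc1 : c1 = 2 * a + n - 6) (hc0 : c0 = (a - 2) * (a + n - 4))
    {y : EuclideanSpace ℝ (Fin n)} (hy : y ≠ 0) :
    bilap (radialBump n a ψ0 t) y = radialBump n (a - 4)
      (fun s => ψ4 s + (b1 + c1) * ψ3 s + (b0 + c0 + b1 * c1) * ψ2 s +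
        (b1 * c0 + b0 * c1) * ψ1 s + b0 * c0 * ψ0 s) t y := by
  have hev : lap (radialBump n a ψ0 t) =ᶠ[𝓝 y] radialBump n (a - 2)
      (fun s => ψ2 s + (2 * a + n - 2) * ψ1 s + a * (a + n - 2) * ψ0 s) t := by
    filter_upwards [isOpen_ne.mem_nhds hy] with z hz
    exact lap_radialBump h0 h1 hz
  unfold bilap
  rw [hev.lap.eq_of_nhds, lap_radialBump
    (ψ0 := fun s => ψ2 s + (2 * a + n - 2) * ψ1 s + a * (a + n - 2) * ψ0 s)
    (ψ1 := fun s => ψ3 s + (2 * a + n - 2) * ψ2 s + a * (a + n - 2) * ψ1 s)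
    (ψ2 := fun s => ψ4 s + (2 * a + n - 2) * ψ3 s + a * (a + n - 2) * ψ2 s)
    (fun s => ((h2 s).add ((h1 s).const_mul _)).add ((h0 s).const_mul _))
    (fun s => ((h3 s).add ((h2 s).const_mul _)).add ((h1 s).const_mul _)) hy]
  simp only [radialBump]
  rw [show a - 2 - 2 = a - 4 by ring, hb1, hb0, hc1, hc0]
  ring

end RadialBump

section RadialBumpIntegrals

open Topology

variable {n : ℕ}

lemma continuous_radialBump {a : ℝ} {ψ : ℝ → ℝ} (hc : Continuous ψ)
    (hψ : ∀ s, 1 < |s| → ψ s = 0) {t : ℝ} (ht : 1 < t) : Continuous (radialBump n a ψ t) := by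
  have := contDiff_radialBump (n := n) (a := a) (k := 0)
    (by exact_mod_cast contDiff_zero.mpr hc) hψ ht
  exact this.continuous

lemma integrable_mul_radialBump {w : EuclideanSpace ℝ (Fin n) → ℝ}
    (hw : ContinuousOn w (ball 0 1 \ {0})) {a : ℝ} {ψ : ℝ → ℝ} (hc : Continuous ψ)
    (hψ : ∀ s, 1 < |s| → ψ s = 0) {t : ℝ} (ht : 1 < t) :
    Integrable fun y => w y * radialBump n a ψ t y :=
  integrable_mul_of_tsupport_subset (isOpen_ball.sdiff isClosed_singleton) hw
    (continuous_radialBump hc hψ ht) (hasCompactSupport_radialBump hψ ht)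
    ((tsupport_radialBump_subset hψ ht).trans (shell_exp_subset ht))

lemma exists_abs_le_of_support {ψ : ℝ → ℝ} (hc : Continuous ψ) (hψ : ∀ s, 1 < |s| → ψ s = 0) :
    ∃ K, 0 ≤ K ∧ ∀ s, |ψ s| ≤ K := by
  have hb : HasCompactSupport ψ := HasCompactSupport.intro (isCompact_Icc (a := (-1 : ℝ)) (b := 1))
    fun s hs => hψ s (by
      by_contra h0
      exact hs (abs_le.mp (not_lt.mp h0)))
  obtain ⟨K, hK⟩ := hb.exists_bound_of_continuous hc
  exact ⟨K, (norm_nonneg _).trans (hK 0), hK⟩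

lemma hasDerivAt_integral_mul_radialBump {w : EuclideanSpace ℝ (Fin n) → ℝ}
    (hw : ContinuousOn w (ball 0 1 \ {0})) (a : ℝ) {ψ ψ' : ℝ → ℝ}
    (hd : ∀ s, HasDerivAt ψ (ψ' s) s) (hc' : Continuous ψ') (hψ : ∀ s, 1 < |s| → ψ s = 0)
    (hψ' : ∀ s, 1 < |s| → ψ' s = 0) {t : ℝ} (ht : 3 < t) :
    HasDerivAt (fun t => ∫ y, w y * radialBump n a ψ t y) (∫ y, w y * radialBump n a ψ' t y) t := by
  have hc : Continuous ψ := continuous_iff_continuousAt.mpr fun s => (hd s).continuousAt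
  obtain ⟨K, hK0, hK⟩ := exists_abs_le_of_support hc' hψ'
  have hball : ∀ t' ∈ ball t 1, 1 < t' := by
    intro t' ht'
    rw [mem_ball, Real.dist_eq, abs_lt] at ht'
    linarith
  set S := shell n (Real.exp (-t - 2)) (Real.exp (-t + 2)) with hS
  have hSs : S ⊆ ball 0 1 \ {0} := shell_exp_subset (by linarith)
  refine (hasDerivAt_integral_of_dominated_loc_of_deriv_le (μ := volume) (s := ball t 1)
    (F := fun t y => w y * radialBump n a ψ t y) (F' := fun t y => w y * radialBump n a ψ' t y)
    (bound := S.indicator fun y => |w y| * (‖y‖ ^ a * K)) (ball_mem_nhds t one_pos)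
    ?_ (integrable_mul_radialBump hw hc hψ (by linarith))
    (integrable_mul_radialBump hw hc' hψ' (by linarith)).aestronglyMeasurable ?_ ?_ ?_).2
  · filter_upwards [ball_mem_nhds t one_pos] with t' ht'
    exact (integrable_mul_radialBump hw hc hψ (hball t' ht')).aestronglyMeasurable
  · refine Eventually.of_forall fun y t' ht' => ?_
    by_cases h0 : ψ' (Real.log ‖y‖ + t') = 0
    · simp only [radialBump, h0, mul_zero, norm_zero]
      exact Set.indicator_nonneg (fun y _ => by positivity) y
    obtain ⟨h1, h2⟩ := log_norm_mem_of_radialBump_ne_zero hψ' (hball t' ht') h0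
    have hyS : y ∈ S := mem_shell_of_abs_log_le h1 (by
      rw [mem_ball, Real.dist_eq, abs_lt] at ht'
      rw [abs_le] at h2 ⊢
      constructor <;> linarith)
    rw [Set.indicator_of_mem hyS, norm_mul, radialBump, norm_mul, Real.norm_eq_abs,
      Real.norm_of_nonneg (show 0 ≤ ‖y‖ ^ a by positivity)]
    gcongr
    exact hK _
  · refine (integrable_indicator_iff (isClosed_shell _ _ _).measurableSet).mpr ?_
    refine ContinuousOn.integrableOn_compact (isCompact_shell _ _ _) ?_
    refine ((hw.mono hSs).abs).mul (ContinuousOn.mul ?_ continuousOn_const)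
    exact continuous_norm.continuousOn.rpow_const fun y hy =>
      Or.inl (norm_ne_zero_iff.mpr (hSs hy).2)
  · refine Eventually.of_forall fun y t' _ => ?_
    exact ((HasDerivAt.comp_const_add (Real.log ‖y‖) t' (hd _)).const_mul (‖y‖ ^ a)).const_mul (w y)

/-- The integral of `‖y‖ ^ (-n) * ψ (log ‖y‖ + t)` does not depend on `t`. -/
lemma integral_radialBump_eq (hn : n ≠ 0) (ψ : ℝ → ℝ) (t : ℝ) :
    ∫ y, radialBump n (-n) ψ t y = ∫ y, radialBump n (-n) ψ 0 y := by
  have h := Measure.integral_comp_smul_of_nonneg (volume : Measure (EuclideanSpace ℝ (Fin n)))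
    (radialBump n (-n) ψ 0) (Real.exp t) (hR := (Real.exp_pos t).le)
  rw [finrank_euclideanSpace_fin] at h
  have hpt : ∀ y : EuclideanSpace ℝ (Fin n), radialBump n (-n) ψ 0 (Real.exp t • y) =
      (Real.exp t ^ n)⁻¹ * radialBump n (-n) ψ t y := by
    intro y
    have he := Real.exp_pos t
    simp only [radialBump]
    rw [norm_smul, Real.norm_of_nonneg he.le, Real.mul_rpow he.le (norm_nonneg y),
      Real.rpow_neg he.le, Real.rpow_natCast]
    rcases eq_or_ne y 0 with rfl | hy
    · rw [norm_zero, Real.zero_rpow (by simpa using hn)]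
      ring
    · rw [Real.log_mul he.ne' (norm_ne_zero_iff.mpr hy), Real.log_exp, add_zero,
        add_comm t, mul_assoc]
  simp_rw [hpt] at h
  rw [integral_const_mul, smul_eq_mul] at h
  exact mul_left_cancel₀ (by positivity) h

lemma integral_radialBump_pos (hn : n ≠ 0) {ψ : ℝ → ℝ} (hc : Continuous ψ)
    (hψ : ∀ s, 1 < |s| → ψ s = 0) (hψ0 : ∀ s, 0 ≤ ψ s) (hψ1 : 0 < ψ 0) :
    0 < ∫ y, radialBump n (-n) ψ 2 y := by
  have hn' : 0 < n := Nat.pos_of_ne_zero hn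
  set e : EuclideanSpace ℝ (Fin n) := EuclideanSpace.single ⟨0, hn'⟩ (Real.exp (-2)) with he
  have hne : ‖e‖ = Real.exp (-2) := by
    rw [he, PiLp.norm_single, Real.norm_of_nonneg (Real.exp_pos _).le]
  refine (continuous_radialBump hc hψ (by norm_num)).integral_pos_of_hasCompactSupport_nonneg_nonzero
    (hasCompactSupport_radialBump hψ (by norm_num)) (x := e)
    (fun y => mul_nonneg (by positivity) (hψ0 _)) ?_
  rw [radialBump, hne, Real.log_exp, neg_add_cancel]
  positivity

lemma deriv_eq_zero_of_support {ψ : ℝ → ℝ} (hψ : ∀ s, 1 < |s| → ψ s = 0) :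
    ∀ s, 1 < |s| → deriv ψ s = 0 := by
  intro s hs
  have h : ψ =ᶠ[𝓝 s] fun _ => 0 := by
    filter_upwards [continuous_abs.continuousAt.eventually (lt_mem_nhds hs)] with s' hs'
    exact hψ s' hs'
  rw [h.deriv_eq, deriv_const]

/-- Averaging windows in the logarithmic radius. -/
structure IsLogWindow (n : ℕ) (δ : ℝ) (χ0 χ1 χ2 χ3 χ4 : ℝ → ℝ) : Prop where
  d0 : ∀ s, HasDerivAt χ0 (χ1 s) s
  d1 : ∀ s, HasDerivAt χ1 (χ2 s) s
  d2 : ∀ s, HasDerivAt χ2 (χ3 s) s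
  d3 : ∀ s, HasDerivAt χ3 (χ4 s) s
  contDiff : ContDiff ℝ 4 χ0
  c1 : Continuous χ1
  c2 : Continuous χ2
  c3 : Continuous χ3
  c4 : Continuous χ4
  z0 : ∀ s, 1 < |s| → χ0 s = 0
  z1 : ∀ s, 1 < |s| → χ1 s = 0
  z2 : ∀ s, 1 < |s| → χ2 s = 0
  z3 : ∀ s, 1 < |s| → χ3 s = 0
  z4 : ∀ s, 1 < |s| → χ4 s = 0
  zero_of_lt : ∀ s, δ < |s| → χ0 s = 0
  nonneg : ∀ s, 0 ≤ χ0 s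
  integral : ∀ t, ∫ y, radialBump n (-n) χ0 t y = 1

lemma exists_isLogWindow (hn : n ≠ 0) {δ : ℝ} (hδ : 0 < δ) :
    ∃ χ0 χ1 χ2 χ3 χ4, IsLogWindow n δ χ0 χ1 χ2 χ3 χ4 := by
  have hm : 0 < min δ 1 := by positivity
  let f : ContDiffBump (0 : ℝ) := ⟨min δ 1 / 2, min δ 1, by positivity, by linarith⟩
  have fz : ∀ s, min δ 1 ≤ |s| → f s = 0 := fun s hs =>
    f.zero_of_le_dist (by rw [Real.dist_eq, sub_zero]; exact hs)
  have fz1 : ∀ s, 1 < |s| → f s = 0 := fun s hs => fz s ((min_le_right _ _).trans hs.le)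
  have f0 : f 0 = 1 := f.one_of_mem_closedBall (mem_closedBall_self (by positivity))
  set I := ∫ y, radialBump n (-n) f 2 y with hI
  have hIp : 0 < I := integral_radialBump_pos hn f.continuous fz1 (fun s => f.nonneg)
    (by rw [f0]; norm_num)
  set χ : ℝ → ℝ := fun s => I⁻¹ * f s with hχ
  have hs0 : ContDiff ℝ ((⊤ : ℕ∞) : WithTop ℕ∞) χ := contDiff_const.mul f.contDiff
  have hs1 := (contDiff_infty_iff_deriv.mp hs0).2
  have hs2 := (contDiff_infty_iff_deriv.mp hs1).2
  have hs3 := (contDiff_infty_iff_deriv.mp hs2).2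
  have hs4 := (contDiff_infty_iff_deriv.mp hs3).2
  have z0 : ∀ s, 1 < |s| → χ s = 0 := fun s hs => by simp only [hχ, fz1 s hs, mul_zero]
  have z1 := deriv_eq_zero_of_support z0
  have z2 := deriv_eq_zero_of_support z1
  have z3 := deriv_eq_zero_of_support z2
  refine ⟨χ, deriv χ, deriv (deriv χ), deriv (deriv (deriv χ)), deriv (deriv (deriv (deriv χ))),
    fun s => ((contDiff_infty_iff_deriv.mp hs0).1 s).hasDerivAt,
    fun s => ((contDiff_infty_iff_deriv.mp hs1).1 s).hasDerivAt,
    fun s => ((contDiff_infty_iff_deriv.mp hs2).1 s).hasDerivAt,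
    fun s => ((contDiff_infty_iff_deriv.mp hs3).1 s).hasDerivAt,
    by exact_mod_cast contDiff_infty.mp hs0 4, hs1.continuous, hs2.continuous, hs3.continuous,
    hs4.continuous, z0, z1, z2, z3, deriv_eq_zero_of_support z3, fun s hs => ?_, fun s => ?_,
    fun t => ?_⟩
  · simp only [hχ, fz s ((min_le_left _ _).trans hs.le), mul_zero]
  · exact mul_nonneg (by positivity) f.nonneg
  · rw [integral_radialBump_eq hn, ← integral_radialBump_eq hn χ 2]
    have : ∀ y, radialBump n (-n) χ 2 y = I⁻¹ * radialBump n (-n) f 2 y := fun y => by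
      simp only [radialBump, hχ]; ring
    simp_rw [this]
    rw [integral_const_mul, ← hI, inv_mul_cancel₀ hIp.ne']

end RadialBumpIntegrals

section LogAverages

open Topology

variable {n : ℕ}

lemma mul_radialBump_eq {w : EuclideanSpace ℝ (Fin n) → ℝ} (a : ℝ) {ψ : ℝ → ℝ}
    (hψ : ∀ s, 1 < |s| → ψ s = 0) {t : ℝ} (ht : 1 < t) (y : EuclideanSpace ℝ (Fin n)) :
    w y * radialBump n (a - n) ψ t y = (‖y‖ ^ a * w y) * radialBump n (-n) ψ t y := by
  rcases eq_or_ne y 0 with rfl | hy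
  · have : ψ t = 0 := hψ t (ht.trans_le (le_abs_self t))
    simp [radialBump, this]
  · simp only [radialBump]
    rw [sub_eq_add_neg a, Real.rpow_add (norm_pos_iff.mpr hy)]
    ring

lemma continuousOn_norm_rpow_mul {w : EuclideanSpace ℝ (Fin n) → ℝ}
    (hw : ContinuousOn w (ball 0 1 \ {0})) (a : ℝ) :
    ContinuousOn (fun y => ‖y‖ ^ a * w y) (ball 0 1 \ {0}) :=
  (continuous_norm.continuousOn.rpow_const fun _ hy =>
    Or.inl (norm_ne_zero_iff.mpr hy.2)).mul hw

lemma IsLogWindow.abs_average_sub_le {δ : ℝ} {χ0 χ1 χ2 χ3 χ4 : ℝ → ℝ}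
    (hχ : IsLogWindow n δ χ0 χ1 χ2 χ3 χ4) {g : EuclideanSpace ℝ (Fin n) → ℝ}
    (hg : ContinuousOn g (ball 0 1 \ {0})) {t c ε : ℝ} (ht : 1 < t)
    (h : ∀ y, y ≠ 0 → |Real.log ‖y‖ + t| ≤ min δ 1 → |g y - c| ≤ ε) :
    |(∫ y, g y * radialBump n (-n) χ0 t y) - c| ≤ ε := by
  have hc0 : Continuous χ0 := hχ.contDiff.continuous
  have i1 := integrable_mul_radialBump hg (a := -n) hc0 hχ.z0 ht
  have i2 : Integrable (radialBump n (-n) χ0 t) :=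
    (continuous_radialBump hc0 hχ.z0 ht).integrable_of_hasCompactSupport
      (hasCompactSupport_radialBump hχ.z0 ht)
  have e1 : (∫ y, g y * radialBump n (-n) χ0 t y) - c =
      ∫ y, (g y - c) * radialBump n (-n) χ0 t y := by
    simp_rw [sub_mul]
    rw [integral_sub i1 (i2.const_mul c), integral_const_mul, hχ.integral, mul_one]
  rw [e1, ← Real.norm_eq_abs]
  refine (norm_integral_le_of_norm_le (i2.const_mul ε) (Eventually.of_forall fun y => ?_)).trans ?_
  · by_cases h0 : χ0 (Real.log ‖y‖ + t) = 0
    · simp [radialBump, h0]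
    obtain ⟨h1, h2⟩ := log_norm_mem_of_radialBump_ne_zero hχ.z0 ht h0
    have h3 : |Real.log ‖y‖ + t| ≤ δ := by
      by_contra h3
      exact h0 (hχ.zero_of_lt _ (not_le.mp h3))
    have h4 : 0 ≤ radialBump n (-n) χ0 t y := mul_nonneg (by positivity) (hχ.nonneg _)
    rw [norm_mul, Real.norm_of_nonneg h4]
    gcongr
    exact h y (norm_pos_iff.mp h1) (le_min h3 h2)
  · rw [integral_const_mul, hχ.integral, mul_one]

lemma exists_abs_average_le (hn : n ≠ 0) {ψ : ℝ → ℝ} (hc : Continuous ψ)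
    (hψ : ∀ s, 1 < |s| → ψ s = 0) (A : ℝ) :
    ∃ B, ∀ (g : EuclideanSpace ℝ (Fin n) → ℝ) (t : ℝ), 1 < t →
      (∀ y, y ≠ 0 → |Real.log ‖y‖ + t| ≤ 1 → |g y| ≤ A) →
      |∫ y, g y * radialBump n (-n) ψ t y| ≤ B := by
  refine ⟨A * ∫ y, radialBump n (-n) (fun s => |ψ s|) 0 y, fun g t ht h => ?_⟩
  have hψ' : ∀ s, 1 < |s| → |ψ s| = 0 := fun s hs => by rw [hψ s hs, abs_zero]
  have i2 : Integrable (radialBump n (-n) (fun s => |ψ s|) t) :=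
    (continuous_radialBump hc.abs hψ' ht).integrable_of_hasCompactSupport
      (hasCompactSupport_radialBump hψ' ht)
  rw [← Real.norm_eq_abs, ← integral_radialBump_eq hn _ t, ← integral_const_mul]
  refine norm_integral_le_of_norm_le (i2.const_mul A) (Eventually.of_forall fun y => ?_)
  by_cases h0 : ψ (Real.log ‖y‖ + t) = 0
  · simp [radialBump, h0]
  obtain ⟨h1, h2⟩ := log_norm_mem_of_radialBump_ne_zero hψ ht h0
  simp only [radialBump]
  rw [norm_mul, norm_mul, Real.norm_of_nonneg (show 0 ≤ ‖y‖ ^ (-n : ℝ) by positivity)]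
  simp only [Real.norm_eq_abs]
  gcongr
  exact h y (norm_pos_iff.mp h1) h2

lemma integral_linear_combination {f0 f1 f2 f3 f4 : EuclideanSpace ℝ (Fin n) → ℝ}
    (h0 : Integrable f0) (h1 : Integrable f1) (h2 : Integrable f2) (h3 : Integrable f3)
    (h4 : Integrable f4) {k0 k1 k2 k3 : ℝ} :
    ∫ y, (f4 y + k3 * f3 y + k2 * f2 y + k1 * f1 y + k0 * f0 y) =
      (∫ y, f4 y) + k3 * (∫ y, f3 y) + k2 * (∫ y, f2 y) + k1 * (∫ y, f1 y) + k0 * ∫ y, f0 y := by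
  have e3 := h4.add (h3.const_mul k3)
  have e2 := e3.add (h2.const_mul k2)
  have e1 := e2.add (h1.const_mul k1)
  rw [← integral_const_mul, ← integral_const_mul, ← integral_const_mul, ← integral_const_mul,
    ← integral_add h4 (h3.const_mul k3)]
  refine (integral_add e1 (h0.const_mul k0)).trans ?_
  congr 1
  refine (integral_add e2 (h1.const_mul k1)).trans ?_
  congr 1
  exact integral_add e3 (h2.const_mul k2)

variable {d : ℕ} {p : ℝ} {u : EuclideanSpace ℝ (Fin (d + 4)) → ℝ}

/-- The equation tested against a radial bump. -/
lemma IsPuncturedSolution.average_eq (h : IsPuncturedSolution (d + 4) p u) {δ : ℝ}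
    {χ0 χ1 χ2 χ3 χ4 : ℝ → ℝ} (hχ : IsLogWindow (d + 4) δ χ0 χ1 χ2 χ3 χ4) (τ : ℝ)
    {b0 b1 c0 c1 : ℝ} (hb1 : b1 = 2 * τ - d + 2) (hb0 : b0 = (τ - d) * (τ + 2))
    (hc1 : c1 = 2 * τ - d - 2) (hc0 : c0 = (τ - d - 2) * τ) {t : ℝ} (ht : 1 < t) :
    (∫ y, u y * radialBump (d + 4) (τ - (d + 4 : ℕ)) χ4 t y)
      + (b1 + c1) * (∫ y, u y * radialBump (d + 4) (τ - (d + 4 : ℕ)) χ3 t y)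
      + (b0 + c0 + b1 * c1) * (∫ y, u y * radialBump (d + 4) (τ - (d + 4 : ℕ)) χ2 t y)
      + (b1 * c0 + b0 * c1) * (∫ y, u y * radialBump (d + 4) (τ - (d + 4 : ℕ)) χ1 t y)
      + b0 * c0 * (∫ y, u y * radialBump (d + 4) (τ - (d + 4 : ℕ)) χ0 t y)
      = ∫ y, u y ^ p * radialBump (d + 4) (τ + 4 - (d + 4 : ℕ)) χ0 t y := by
  have hcc : Continuous χ0 := hχ.contDiff.continuous
  have hs := (tsupport_radialBump_subset (n := d + 4) (a := τ + 4 - (d + 4 : ℕ)) hχ.z0 ht).trans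
    (shell_exp_subset ht)
  rw [← h.integral_mul_bilap (contDiff_radialBump (k := 4) (by exact_mod_cast hχ.contDiff) hχ.z0 ht)
    (hasCompactSupport_radialBump hχ.z0 ht) hs]
  have key : ∀ y, bilap (radialBump (d + 4) (τ + 4 - (d + 4 : ℕ)) χ0 t) y =
      radialBump (d + 4) (τ - (d + 4 : ℕ)) (fun s => χ4 s + (b1 + c1) * χ3 s +
        (b0 + c0 + b1 * c1) * χ2 s + (b1 * c0 + b0 * c1) * χ1 s + b0 * c0 * χ0 s) t y := by
    intro y
    rcases eq_or_ne y 0 with rfl | hy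
    · have h1 : 1 < |t| := ht.trans_le (le_abs_self t)
      rw [bilap_eq_zero_of_notMem fun h0 => (hs h0).2 rfl]
      simp [radialBump, hχ.z0 t h1, hχ.z1 t h1, hχ.z2 t h1, hχ.z3 t h1, hχ.z4 t h1]
    · rw [bilap_radialBump hχ.d0 hχ.d1 hχ.d2 hχ.d3 (b0 := b0) (b1 := b1) (c0 := c0) (c1 := c1)
        (by rw [hb1]; push_cast; ring) (by rw [hb0]; push_cast; ring)
        (by rw [hc1]; push_cast; ring) (by rw [hc0]; push_cast; ring) hy]
      congr 1
      ring
  simp_rw [key]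
  have i0 := integrable_mul_radialBump h.continuousOn (a := τ - (d + 4 : ℕ)) hcc hχ.z0 ht
  have i1 := integrable_mul_radialBump h.continuousOn (a := τ - (d + 4 : ℕ)) hχ.c1 hχ.z1 ht
  have i2 := integrable_mul_radialBump h.continuousOn (a := τ - (d + 4 : ℕ)) hχ.c2 hχ.z2 ht
  have i3 := integrable_mul_radialBump h.continuousOn (a := τ - (d + 4 : ℕ)) hχ.c3 hχ.z3 ht
  have i4 := integrable_mul_radialBump h.continuousOn (a := τ - (d + 4 : ℕ)) hχ.c4 hχ.z4 ht
  rw [← integral_linear_combination i0 i1 i2 i3 i4]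
  refine integral_congr_ae (Eventually.of_forall fun y => ?_)
  simp only [radialBump]
  ring

end LogAverages

section Classification

open Topology

lemma abs_rpow_sub_rpow_le {p A a b : ℝ} (hp : 1 ≤ p) (ha : 0 ≤ a) (hb : 0 ≤ b) (haA : a ≤ A)
    (hbA : b ≤ A) : |a ^ p - b ^ p| ≤ p * A ^ (p - 1) * |a - b| := by
  wlog hba : b ≤ a generalizing a b
  · rw [abs_sub_comm, abs_sub_comm a]
    exact this hb ha hbA haA (le_of_not_ge hba)
  have h1 : b ^ p ≤ a ^ p := Real.rpow_le_rpow hb hba (by linarith)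
  rw [abs_of_nonneg (by linarith), abs_of_nonneg (by linarith)]
  refine (rpow_sub_rpow_le hp hb hba).trans ?_
  have h2 : a ^ (p - 1) ≤ A ^ (p - 1) := Real.rpow_le_rpow ha haA (by linarith)
  have h3 : 0 ≤ a - b := by linarith
  gcongr

lemma eventually_lt_neg_log_norm {E : Type*} [NormedAddCommGroup E] (T : ℝ) :
    ∀ᶠ x : E in 𝓝[≠] 0, x ≠ 0 ∧ T < -Real.log ‖x‖ := by
  filter_upwards [self_mem_nhdsWithin,
    mem_nhdsWithin_of_mem_nhds (ball_mem_nhds (0 : E) (Real.exp_pos (-T)))] with x hx hx2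
  refine ⟨hx, ?_⟩
  have := (Real.log_lt_iff_lt_exp (norm_pos_iff.mpr hx)).mpr (mem_ball_zero_iff.mp hx2)
  linarith

lemma K0_eq {d : ℕ} {p : ℝ} (hp : 1 < p) :
    K0 (d + 4) p =
      ((4 / (p - 1) - d) * (4 / (p - 1) + 2)) * ((4 / (p - 1) - d - 2) * (4 / (p - 1))) := by
  have : p - 1 ≠ 0 := by linarith
  have hq : ∀ q : ℝ, q ≠ 0 → 8 / q ^ 4 *
      ((((d + 4 : ℕ) : ℝ) - 2) * (((d + 4 : ℕ) : ℝ) - 4) * q ^ 3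
      + 2 * (((d + 4 : ℕ) : ℝ) ^ 2 - 10 * ((d + 4 : ℕ) : ℝ) + 20) * q ^ 2
      - 16 * (((d + 4 : ℕ) : ℝ) - 4) * q + 32) =
      ((4 / q - d) * (4 / q + 2)) * ((4 / q - d - 2) * (4 / q)) := by
    intro q hq
    push_cast
    field_simp
    ring
  exact hq _ this

variable {d : ℕ} {p : ℝ} {u : EuclideanSpace ℝ (Fin (d + 4)) → ℝ}

lemma IsPuncturedSolution.d_pos (h : IsPuncturedSolution (d + 4) p u) : (0 : ℝ) < d := by
  have := h.five_le
  have : 0 < d := by omega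
  exact_mod_cast this

lemma IsPuncturedSolution.tau_lt (h : IsPuncturedSolution (d + 4) p u) : 4 / (p - 1) < d := by
  have h1 := h.supercrit
  push_cast at h1
  rw [div_lt_iff₀ (by linarith [h.one_lt])]
  linarith

/-- The rescaled solution is controlled by an approximate solution of the autonomous equation. -/
theorem IsPuncturedSolution.exists_isApproxODE (h : IsPuncturedSolution (d + 4) p u)
    (hsub : p * d < d + 8) {a0 a1 a2 a3 b0 b1 c0 c1 : ℝ}
    (hb1 : b1 = 2 * (4 / (p - 1)) - d + 2) (hb0 : b0 = (4 / (p - 1) - d) * (4 / (p - 1) + 2))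
    (hc1 : c1 = 2 * (4 / (p - 1)) - d - 2) (hc0 : c0 = (4 / (p - 1) - d - 2) * (4 / (p - 1)))
    (h3 : a3 = b1 + c1) (h2 : a2 = b0 + c0 + b1 * c1) (h1 : a1 = b1 * c0 + b0 * c1)
    (h0 : a0 = b0 * c0) :
    ∃ A C, 0 ≤ A ∧ 0 ≤ C ∧ ∀ η > 0, ∀ ε > 0, ∃ (m0 m1 m2 m3 m4 : ℝ → ℝ) (T : ℝ),
      IsApproxODE p a0 a1 a2 a3 A C η T m0 m1 m2 m3 m4 ∧
      ∀ x, x ≠ 0 → T < -Real.log ‖x‖ →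
        |m0 (-Real.log ‖x‖) - ‖x‖ ^ (4 / (p - 1)) * u x| ≤ ε := by
  obtain ⟨κ, C, hU⟩ := h.exists_isSingularPotential hsub
  obtain ⟨A, r, hA, hr, hr8, hAr⟩ := hU.exists_upper_bound
  have hp := h.one_lt
  have hp1 : 0 < p - 1 := by linarith
  set τ := 4 / (p - 1) with hτ
  have hτ0 : 0 < τ := by positivity
  have hτp : τ * p = τ + 4 := by rw [hτ]; field_simp; ring
  have hn : d + 4 ≠ 0 := by omega
  set v : EuclideanSpace ℝ (Fin (d + 4)) → ℝ := fun y => ‖y‖ ^ τ * u y with hv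
  have hUu : ∀ y, y ≠ 0 → ‖y‖ < r → (ball 0 (1 / 4) \ {0}).indicator u y = u y := by
    intro y hy hyr
    exact Set.indicator_of_mem
      (show y ∈ ball 0 (1 / 4) \ {0} from ⟨mem_ball_zero_iff.mpr (by linarith), hy⟩) u
  have hvA : ∀ y, y ≠ 0 → ‖y‖ < r → v y ≤ A := by
    intro y hy hyr
    have hy0 : 0 < ‖y‖ := norm_pos_iff.mpr hy
    have e1 := hAr y hy hyr
    rw [hUu y hy hyr] at e1
    calc v y ≤ ‖y‖ ^ τ * (A * ‖y‖ ^ (-τ)) := by simp only [hv]; gcongr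
      _ = A := by rw [Real.rpow_neg hy0.le]; field_simp
  have hv0 : ∀ y, y ≠ 0 → ‖y‖ < r → 0 ≤ v y := fun y hy hyr =>
    mul_nonneg (by positivity) (h.nonneg y ⟨mem_ball_zero_iff.mpr (by linarith), hy⟩)
  have hvp : ∀ y, y ≠ 0 → ‖y‖ < r → ‖y‖ ^ (τ + 4) * u y ^ p = v y ^ p := by
    intro y hy hyr
    simp only [hv]
    rw [Real.mul_rpow (by positivity) (h.nonneg y ⟨mem_ball_zero_iff.mpr (by linarith), hy⟩),
      ← Real.rpow_mul (norm_nonneg y), hτp]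
  have hvc : ContinuousOn v (ball 0 1 \ {0}) := continuousOn_norm_rpow_mul h.continuousOn τ
  have hvpc := continuousOn_norm_rpow_mul h.continuousOn_rpow (τ + 4)
  obtain ⟨K, hK, hKb⟩ := exists_deriv_bounds a0 a1 a2 a3
  have hAp : 0 < A ^ p := by positivity
  refine ⟨A, K * (A + A ^ p), hA.le, by positivity, fun η hη ε hε => ?_⟩
  have hpA : 0 < p * A ^ (p - 1) := by positivity
  set ε' := min ε (η / (p * A ^ (p - 1))) with hε'
  have hε'0 : 0 < ε' := by positivity
  have hε'η : p * A ^ (p - 1) * ε' ≤ η := by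
    rw [mul_comm, ← le_div_iff₀ hpA]
    exact min_le_right _ _
  obtain ⟨δ, hδ, r2, hr2, hosc⟩ := hU.exists_oscillation_le hε'0
  set ρ := min r r2 with hρ
  have hρ0 : 0 < ρ := by positivity
  obtain ⟨χ0, χ1, χ2, χ3, χ4, hχ⟩ := exists_isLogWindow hn (half_pos hδ)
  set T := max 3 (1 - Real.log ρ) with hT
  have hT3 : ∀ t, T < t → 3 < t := fun t ht => (le_max_left _ _).trans_lt ht
  have hT1 : ∀ t, T < t → 1 < t := fun t ht => by linarith [hT3 t ht]
  have hTρ : ∀ t, T < t → ∀ y : EuclideanSpace ℝ (Fin (d + 4)), y ≠ 0 →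
      |Real.log ‖y‖ + t| ≤ 1 → ‖y‖ < r ∧ ‖y‖ < r2 := by
    intro t ht y hy hyt
    have e1 : 1 - Real.log ρ < t := (le_max_right _ _).trans_lt ht
    have e2 := (abs_le.mp hyt).2
    exact lt_min_iff.mp ((Real.log_lt_log_iff (norm_pos_iff.mpr hy) hρ0).mp (by linarith))
  have hosc' : ∀ t, T < t → ∀ y : EuclideanSpace ℝ (Fin (d + 4)), y ≠ 0 →
      |Real.log ‖y‖ + t| ≤ min (δ / 2) 1 →
      |(∫ z, v z * radialBump (d + 4) (-(d + 4 : ℕ)) χ0 t z) - v y| ≤ ε' := by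
    intro t ht y hy hyt
    refine hχ.abs_average_sub_le hvc (hT1 t ht) fun z hz hzt => ?_
    obtain ⟨y1, y2⟩ := hTρ t ht y hy (hyt.trans (min_le_right _ _))
    obtain ⟨z1, z2⟩ := hTρ t ht z hz (hzt.trans (min_le_right _ _))
    have e := (hosc z y hz hy z2 y2 (by
      have e1 := abs_le.mp (hyt.trans (min_le_left _ _))
      have e2 := abs_le.mp (hzt.trans (min_le_left _ _))
      rw [abs_le]
      constructor <;> linarith)).le
    rwa [hUu z hz z1, hUu y hy y1] at e
  have hmv : ∀ (ψ : ℝ → ℝ), (∀ s, 1 < |s| → ψ s = 0) → ∀ t, T < t →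
      ∫ y, u y * radialBump (d + 4) (τ - (d + 4 : ℕ)) ψ t y =
      ∫ y, v y * radialBump (d + 4) (-(d + 4 : ℕ)) ψ t y := fun ψ hψ t ht =>
    integral_congr_ae (Eventually.of_forall fun y => mul_radialBump_eq τ hψ (hT1 t ht) y)
  have hmp : ∀ t, T < t → ∫ y, u y ^ p * radialBump (d + 4) (τ + 4 - (d + 4 : ℕ)) χ0 t y =
      ∫ y, (‖y‖ ^ (τ + 4) * u y ^ p) * radialBump (d + 4) (-(d + 4 : ℕ)) χ0 t y := fun t ht =>
    integral_congr_ae (Eventually.of_forall fun y =>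
      mul_radialBump_eq (w := fun y => u y ^ p) (τ + 4) hχ.z0 (hT1 t ht) y)
  have hvabs : ∀ t, T < t → ∀ y, y ≠ 0 → |Real.log ‖y‖ + t| ≤ 1 → |v y| ≤ A := by
    intro t ht y hy hyt
    have hyr := (hTρ t ht y hy hyt).1
    rw [abs_of_nonneg (hv0 y hy hyr)]
    exact hvA y hy hyr
  obtain ⟨B1, hB1⟩ := exists_abs_average_le hn hχ.c1 hχ.z1 A
  obtain ⟨B2, hB2⟩ := exists_abs_average_le hn hχ.c2 hχ.z2 A
  obtain ⟨B3, hB3⟩ := exists_abs_average_le hn hχ.c3 hχ.z3 A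
  obtain ⟨B4, hB4⟩ := exists_abs_average_le hn hχ.c4 hχ.z4 A
  set M : (ℝ → ℝ) → ℝ → ℝ := fun ψ t =>
    ∫ y, u y * radialBump (d + 4) (τ - (d + 4 : ℕ)) ψ t y with hM
  have d0 : ∀ t > T, HasDerivAt (M χ0) (M χ1 t) t := fun t ht =>
    hasDerivAt_integral_mul_radialBump h.continuousOn _ hχ.d0 hχ.c1 hχ.z0 hχ.z1 (hT3 t ht)
  have d1 : ∀ t > T, HasDerivAt (M χ1) (M χ2 t) t := fun t ht =>
    hasDerivAt_integral_mul_radialBump h.continuousOn _ hχ.d1 hχ.c2 hχ.z1 hχ.z2 (hT3 t ht)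
  have d2 : ∀ t > T, HasDerivAt (M χ2) (M χ3 t) t := fun t ht =>
    hasDerivAt_integral_mul_radialBump h.continuousOn _ hχ.d2 hχ.c3 hχ.z2 hχ.z3 (hT3 t ht)
  have d3 : ∀ t > T, HasDerivAt (M χ3) (M χ4 t) t := fun t ht =>
    hasDerivAt_integral_mul_radialBump h.continuousOn _ hχ.d3 hχ.c4 hχ.z3 hχ.z4 (hT3 t ht)
  have hm0 : ∀ t > T, 0 ≤ M χ0 t ∧ M χ0 t ≤ A := by
    intro t ht
    have e := hχ.abs_average_sub_le hvc (hT1 t ht) (c := A / 2) (ε := A / 2) fun y hy hyt => by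
      have hyr := (hTρ t ht y hy (hyt.trans (min_le_right _ _))).1
      have e1 := hv0 y hy hyr
      have e2 := hvA y hy hyr
      rw [abs_le]
      constructor <;> linarith
    rw [← hmv χ0 hχ.z0 t ht, abs_le] at e
    constructor <;> linarith
  have heq : ∀ t > T, M χ4 t + a3 * M χ3 t + a2 * M χ2 t + a1 * M χ1 t + a0 * M χ0 t =
      ∫ y, (‖y‖ ^ (τ + 4) * u y ^ p) * radialBump (d + 4) (-(d + 4 : ℕ)) χ0 t y := by
    intro t ht
    rw [← hmp t ht, ← h.average_eq hχ τ hb1 hb0 hc1 hc0 (hT1 t ht), h3, h2, h1, h0]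
  have hF : ∀ t > T, |M χ4 t + a3 * M χ3 t + a2 * M χ2 t + a1 * M χ1 t + a0 * M χ0 t| ≤ A ^ p := by
    intro t ht
    have e := hχ.abs_average_sub_le hvpc (hT1 t ht) (c := A ^ p / 2) (ε := A ^ p / 2)
      fun y hy hyt => by
        have hyr := (hTρ t ht y hy (hyt.trans (min_le_right _ _))).1
        rw [hvp y hy hyr]
        have e1 : 0 ≤ v y ^ p := Real.rpow_nonneg (hv0 y hy hyr) p
        have e2 : v y ^ p ≤ A ^ p :=
          Real.rpow_le_rpow (hv0 y hy hyr) (hvA y hy hyr) (by linarith)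
        rw [abs_le]
        constructor <;> linarith
    rw [← heq t ht, abs_le] at e
    rw [abs_le]
    constructor <;> linarith
  have hder := hKb (M χ0) (M χ1) (M χ2) (M χ3) (M χ4) T A (|B1| + |B2| + |B3| + |B4|) (A ^ p)
    d0 d1 d2 d3 (fun t ht => by rw [abs_of_nonneg (hm0 t ht).1]; exact (hm0 t ht).2)
    (fun t ht => by
      have e1 := hB1 v t (hT1 t ht) (hvabs t ht)
      have e2 := hB2 v t (hT1 t ht) (hvabs t ht)
      have e3 := hB3 v t (hT1 t ht) (hvabs t ht)
      have e4 := hB4 v t (hT1 t ht) (hvabs t ht)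
      rw [← hmv _ hχ.z1 t ht] at e1
      rw [← hmv _ hχ.z2 t ht] at e2
      rw [← hmv _ hχ.z3 t ht] at e3
      rw [← hmv _ hχ.z4 t ht] at e4
      have := le_abs_self B1; have := le_abs_self B2
      have := le_abs_self B3; have := le_abs_self B4
      have := abs_nonneg B1; have := abs_nonneg B2
      have := abs_nonneg B3; have := abs_nonneg B4
      refine ⟨?_, ?_, ?_, ?_⟩ <;> simp only [hM] <;> linarith) hF
  refine ⟨M χ0, M χ1, M χ2, M χ3, M χ4, T, ⟨d0, d1, d2, d3, fun t ht => (hm0 t ht).1,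
    fun t ht => (hm0 t ht).2, fun t ht => (hder t ht).1, fun t ht => (hder t ht).2.1,
    fun t ht => (hder t ht).2.2.1, fun t ht => (hder t ht).2.2.2, fun t ht => ?_⟩, ?_⟩
  · rw [heq t ht]
    refine hχ.abs_average_sub_le hvpc (hT1 t ht) fun y hy hyt => ?_
    have hyr := (hTρ t ht y hy (hyt.trans (min_le_right _ _))).1
    rw [hvp y hy hyr]
    have e := hosc' t ht y hy hyt
    rw [← hmv _ hχ.z0 t ht, abs_sub_comm] at e
    refine (abs_rpow_sub_rpow_le hp.le (hv0 y hy hyr) (hm0 t ht).1 (hvA y hy hyr)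
      (hm0 t ht).2).trans (le_trans ?_ hε'η)
    gcongr
  · intro x hx hxT
    have e := hosc' _ hxT x hx (by rw [add_neg_cancel, abs_zero]; positivity)
    rw [← hmv _ hχ.z0 _ hxT] at e
    exact e.trans (min_le_left _ _)

theorem IsPuncturedSolution.eventually_le_or_abs_sub_le (h : IsPuncturedSolution (d + 4) p u)
    (hsub : p * d < d + 8) {ε : ℝ} (hε : 0 < ε) :
    (∀ᶠ x in 𝓝[≠] 0, ‖x‖ ^ (4 / (p - 1)) * u x ≤ 2 * ε) ∨
      ∀ᶠ x in 𝓝[≠] 0, |‖x‖ ^ (4 / (p - 1)) * u x - K0 (d + 4) p ^ (1 / (p - 1))| ≤ 2 * ε := by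
  have hp := h.one_lt
  have hp1 : 0 < p - 1 := by linarith
  have hd := h.d_pos
  have hτd := h.tau_lt
  have hτ2 : (d : ℝ) / 2 < 4 / (p - 1) := by
    rw [lt_div_iff₀ hp1]
    linarith
  obtain ⟨A, C, hA, hC, hode⟩ := h.exists_isApproxODE hsub rfl rfl rfl rfl rfl rfl rfl
    (K0_eq (d := d) hp)
  set τ := 4 / (p - 1) with hτ
  have hτ0 : 0 < τ := by positivity
  have ha3 : 0 ≤ 2 * τ - d + 2 + (2 * τ - d - 2) := by linarith
  have ha1 : (2 * τ - d + 2) * ((τ - d - 2) * τ) + (τ - d) * (τ + 2) * (2 * τ - d - 2) < 0 := by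
    obtain ⟨e, c, rfl', hde, he, hc⟩ : ∃ e c : ℝ, τ = e + c ∧ (d : ℝ) = 2 * c ∧ 0 < e ∧ e < c :=
      ⟨τ - d / 2, d / 2, by ring, by ring, by linarith, by linarith⟩
    rw [rfl', hde]
    have e1 : 0 < 4 * e * ((c - e) * (c + e) + 2 * c + 2) := by
      have : 0 < c - e := by linarith
      have : 0 < c := by linarith
      positivity
    linarith
  have ha0 : 0 < K0 (d + 4) p := by
    rw [K0_eq hp, ← hτ]
    exact mul_pos_of_neg_of_neg (mul_neg_of_neg_of_pos (by linarith) (by linarith))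
      (mul_neg_of_neg_of_pos (by linarith) hτ0)
  obtain ⟨η, hη, hdich⟩ := exists_dichotomy_of_approxODE
    (a2 := (τ - d) * (τ + 2) + (τ - d - 2) * τ + (2 * τ - d + 2) * (2 * τ - d - 2))
    hp ha3 ha1 ha0 hA hC hε
  obtain ⟨m0, m1, m2, m3, m4, T, hm, hmx⟩ := hode η hη ε hε
  refine (hdich m0 m1 m2 m3 m4 T hm).imp ?_ ?_
  · rintro ⟨T', hT'⟩
    filter_upwards [eventually_lt_neg_log_norm (max T T')] with x hx
    have e1 := hmx x hx.1 ((le_max_left _ _).trans_lt hx.2)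
    have e2 := hT' _ ((le_max_right _ _).trans hx.2.le)
    rw [abs_le] at e1
    linarith
  · rintro ⟨T', hT'⟩
    filter_upwards [eventually_lt_neg_log_norm (max T T')] with x hx
    have e1 := hmx x hx.1 ((le_max_left _ _).trans_lt hx.2)
    have e2 := hT' _ ((le_max_right _ _).trans hx.2.le)
    rw [abs_le] at e1 e2 ⊢
    constructor <;> linarith

theorem IsPuncturedSolution.tendsto_or_tendsto (h : IsPuncturedSolution (d + 4) p u)
    (hsub : p * d < d + 8) :
    Tendsto (fun x => ‖x‖ ^ (4 / (p - 1)) * u x) (𝓝[≠] 0) (𝓝 0) ∨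
      Tendsto (fun x => ‖x‖ ^ (4 / (p - 1)) * u x) (𝓝[≠] 0)
        (𝓝 (K0 (d + 4) p ^ (1 / (p - 1)))) := by
  by_cases hall : ∀ ε > 0, ∀ᶠ x in 𝓝[≠] 0, ‖x‖ ^ (4 / (p - 1)) * u x ≤ 2 * ε
  · left
    rw [Metric.tendsto_nhds]
    intro ε hε
    filter_upwards [hall (ε / 4) (by positivity), self_mem_nhdsWithin,
      mem_nhdsWithin_of_mem_nhds (ball_mem_nhds 0 one_pos)] with x hx hx0 hx1
    have := mul_nonneg (show 0 ≤ ‖x‖ ^ (4 / (p - 1)) by positivity) (h.nonneg x ⟨hx1, hx0⟩)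
    rw [Real.dist_eq, sub_zero, abs_of_nonneg this]
    linarith
  · right
    simp only [not_forall] at hall
    obtain ⟨ε0, hε0, hno⟩ := hall
    rw [Metric.tendsto_nhds]
    intro ε hε
    rcases h.eventually_le_or_abs_sub_le hsub (show 0 < min ε0 (ε / 4) by positivity) with h1 | h1
    · exact absurd (h1.mono fun x hx => hx.trans
        (mul_le_mul_of_nonneg_left (min_le_left _ _) zero_le_two)) hno
    · filter_upwards [h1] with x hx
      rw [Real.dist_eq]
      have := min_le_right ε0 (ε / 4)
      linarith

end Classification

/-- Dichotomy for the blow-up limit: for a nonnegative `C⁴` solution of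
`Δ²u = u^p` in the punctured unit ball with `n/(n-4) < p < (n+4)/(n-4)`, either
`|x|^{4/(p-1)} u(x) → 0` or `|x|^{4/(p-1)} u(x) → K₀(p,n)^{1/(p-1)}` as `x → 0`. -/
theorem stmt_11 (n : ℕ) (hn : 5 ≤ n) (p : ℝ)
    (hp1 : (n : ℝ) / ((n : ℝ) - 4) < p) (hp2 : p < ((n : ℝ) + 4) / ((n : ℝ) - 4))
    (u : EuclideanSpace ℝ (Fin n) → ℝ)
    (hreg : ContDiffOn ℝ 4 u (ball 0 1 \ {0}))
    (hpos : ∀ x ∈ ball (0 : EuclideanSpace ℝ (Fin n)) 1 \ {0}, 0 ≤ u x)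
    (heq : ∀ x ∈ ball (0 : EuclideanSpace ℝ (Fin n)) 1 \ {0}, bilap u x = u x ^ p) :
    Tendsto (fun x : EuclideanSpace ℝ (Fin n) => ‖x‖ ^ ((4 : ℝ) / (p - 1)) * u x)
      (nhdsWithin 0 {0}ᶜ) (nhds 0) ∨
    Tendsto (fun x : EuclideanSpace ℝ (Fin n) => ‖x‖ ^ ((4 : ℝ) / (p - 1)) * u x)
      (nhdsWithin 0 {0}ᶜ) (nhds (K0 n p ^ ((1 : ℝ) / (p - 1)))) := by
  have hn4 : 4 ≤ n := by omega
  obtain ⟨d, rfl⟩ := Nat.exists_eq_add_of_le' hn4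
  have hd : (0 : ℝ) < d := by
    have : 0 < d := by omega
    exact_mod_cast this
  push_cast at hp1 hp2
  rw [add_sub_cancel_right, div_lt_iff₀ hd] at hp1
  rw [add_sub_cancel_right, lt_div_iff₀ hd] at hp2
  have hp : 1 < p := by
    by_contra h0
    have : p * d ≤ 1 * d := by gcongr; linarith
    linarith
  have h : IsPuncturedSolution (d + 4) p u :=
    { five_le := hn
      one_lt := hp
      supercrit := by push_cast; rwa [add_sub_cancel_right]
      reg := fun x hx => hreg.contDiffAt (IsPuncturedSolution.isOpen_domain.mem_nhds hx)
      nonneg := hpos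
      eqn := heq }
  exact h.tendsto_or_tendsto (by linarith)
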